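/- Let 0 < δ < 1. There exist an absolute constant ℓ > 0 and a constant C = C(δ) > 0 such that for all X ≥ 2 and every subinterval I of [(δX)^{1/2}, X^{1/2}], | ∑_{m ∈ I ∩ ℕ} ρ(m) − ℓ |I| (log X)^{−1} | ≤ C X^{1/2} (log X)^{−2}, where |I| denotes the length of I. -/

import Mathlib

open scoped Classical
open MeasureTheory

noncomputable section

/-- `e x = exp(2πix)` -/
def e (x : ℝ) : ℂ := Complex.exp (2 * Real.pi * Complex.I * x)

/-- The exponential sum `S_k(α)` over primes `p` with `δX ≤ p^k ≤ X`. -/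
def S (k δ X α : ℝ) : ℂ :=
  ∑ p ∈ (Finset.range (⌈X⌉₊ + 1)).filter
      (fun p : ℕ => p.Prime ∧ δ * X ≤ (p : ℝ) ^ k ∧ (p : ℝ) ^ k ≤ X),
    (Real.log p : ℂ) * e ((p : ℝ) ^ k * α)

/-- The exponential sum `U_k(α)` over naturals `n` with `δX ≤ n^k ≤ X`. -/
def U (k δ X α : ℝ) : ℂ :=
  ∑ n ∈ (Finset.range (⌈X⌉₊ + 1)).filter
      (fun n : ℕ => δ * X ≤ (n : ℝ) ^ k ∧ (n : ℝ) ^ k ≤ X),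
    e ((n : ℝ) ^ k * α)

/-- The exponential integral `T_k(α)`. -/
def T (k δ X α : ℝ) : ℂ :=
  ∫ t in (δ * X) ^ (1 / k)..(X ^ (1 / k)), e (α * t ^ k)

/-- Chebyshev theta function. -/
def theta (x : ℝ) : ℝ :=
  ∑ p ∈ (Finset.range (⌊x⌋₊ + 1)).filter Nat.Prime, Real.log p

/-- The generalized Selberg integral `𝒥_k(X,h)`. -/
def selbergJ (k X h : ℝ) : ℝ :=
  ∫ x in X..(2 * X),
    (theta ((x + h) ^ (1 / k)) - theta (x ^ (1 / k)) -
      ((x + h) ^ (1 / k) - x ^ (1 / k))) ^ 2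

/-- `ψ(m,z) = 1` iff every prime factor of `m` is at least `z`. -/
def psi (m : ℕ) (z : ℝ) : ℝ :=
  if ∀ p : ℕ, p.Prime → p ∣ m → z ≤ (p : ℝ) then 1 else 0

/-- The function `z(p)` of Harman–Kumchev. -/
def zfun (X : ℝ) (p : ℕ) : ℝ :=
  if (p : ℝ) < X ^ ((1 : ℝ) / 7) then X ^ ((5 : ℝ) / 28) * (p : ℝ) ^ (-(1 : ℝ) / 2)
  else if (p : ℝ) ≤ X ^ ((3 : ℝ) / 14) then (p : ℝ)
  else X ^ ((5 : ℝ) / 14) * (p : ℝ)⁻¹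

/-- The Harman–Kumchev sieve weight `ρ(m)`. -/
def rho (X : ℝ) (m : ℕ) : ℝ :=
  psi m (X ^ ((5 : ℝ) / 42)) -
    ∑ p ∈ (Finset.range (⌈X ^ ((1 : ℝ) / 4)⌉₊ + 1)).filter
        (fun p : ℕ => p.Prime ∧ X ^ ((5 : ℝ) / 42) ≤ (p : ℝ) ∧ (p : ℝ) < X ^ ((1 : ℝ) / 4) ∧ p ∣ m),
      psi (m / p) (zfun X p)

/-- The sieved exponential sum `S̃_2(α)`. -/
def Stilde (δ X α : ℝ) : ℂ :=
  ∑ m ∈ (Finset.range (⌈X⌉₊ + 1)).filter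
      (fun m : ℕ => δ * X ≤ (m : ℝ) ^ 2 ∧ (m : ℝ) ^ 2 ≤ X),
    (rho X m : ℂ) * e ((m : ℝ) ^ 2 * α)

/-- The Fejér-type kernel `K_η(α)`. -/
def Kf (η α : ℝ) : ℝ :=
  if α = 0 then η ^ 2 else (Real.sin (Real.pi * α * η) / (Real.pi * α)) ^ 2


namespace HarmanKumchev

open Complex Filter Topology

lemma hasDerivAt_real_cpow_const (r : ℂ) {x : ℝ} (hx : 0 < x) :
    HasDerivAt (fun y : ℝ => (y : ℂ) ^ r) (r * (x : ℂ) ^ (r - 1)) x := by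
  have h : HasDerivAt (fun z : ℂ => z ^ r) (r * (x : ℂ) ^ (r - 1)) (x : ℂ) := by
    simpa using (hasDerivAt_id (x : ℂ)).cpow_const (c := r) (Or.inl (by simpa using hx))
  exact h.comp_ofReal

/-- The `n`-th term of the series `(s - 1) ζ(s) - 1 = ∑ n, zetaTerm n s`, valid for `0 < re s`. -/
def zetaTerm (n : ℕ) (s : ℂ) : ℂ :=
  (s - 1) * ((n + 1 : ℝ) : ℂ) ^ (-s) - (((n + 1 : ℝ) : ℂ) ^ (1 - s) - ((n + 2 : ℝ) : ℂ) ^ (1 - s))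

lemma differentiable_zetaTerm (n : ℕ) : Differentiable ℂ (zetaTerm n) := by
  have h1 : ((n + 1 : ℝ) : ℂ) ≠ 0 := by exact_mod_cast (by positivity : (n + 1 : ℝ) ≠ 0)
  have h2 : ((n + 2 : ℝ) : ℂ) ≠ 0 := by exact_mod_cast (by positivity : (n + 2 : ℝ) ≠ 0)
  unfold zetaTerm
  intro s
  refine DifferentiableAt.sub (DifferentiableAt.mul (by fun_prop) ?_) (DifferentiableAt.sub ?_ ?_)
  · exact (differentiableAt_id.neg).const_cpow (Or.inl h1)
  · exact (differentiableAt_id.const_sub 1).const_cpow (Or.inl h1)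
  · exact (differentiableAt_id.const_sub 1).const_cpow (Or.inl h2)

lemma norm_cpow_neg_sub_cpow_neg_le {s : ℂ} (hs : 0 < s.re) {N x : ℝ} (hN : 0 < N)
    (hx : x ∈ Set.Icc N (N + 1)) :
    ‖(N : ℂ) ^ (-s) - (x : ℂ) ^ (-s)‖ ≤ ‖s‖ * N ^ (-s.re - 1) := by
  have h := Convex.norm_image_sub_le_of_norm_hasDerivWithin_le (𝕜 := ℝ)
    (f := fun y : ℝ => (y : ℂ) ^ (-s)) (f' := fun y : ℝ => -s * (y : ℂ) ^ (-s - 1))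
    (s := Set.Icc N (N + 1)) (C := ‖s‖ * N ^ (-s.re - 1)) (x := x) (y := N)
    (fun y hy => (hasDerivAt_real_cpow_const (-s) (hN.trans_le hy.1)).hasDerivWithinAt)
    (fun y hy => by
      rw [norm_mul, norm_neg, norm_cpow_eq_rpow_re_of_pos (hN.trans_le hy.1)]
      gcongr
      simp only [sub_re, neg_re, one_re]
      exact Real.rpow_le_rpow_of_nonpos hN hy.1 (by linarith))
    (convex_Icc _ _) hx ⟨le_rfl, by linarith⟩
  refine h.trans ?_
  have h2 : ‖N - x‖ ≤ 1 := by
    rw [Real.norm_eq_abs, abs_le]; constructor <;> linarith [hx.1, hx.2]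
  exact mul_le_of_le_one_right (by positivity) h2

lemma norm_cpow_neg_sub_cpow_neg_le_two {s : ℂ} (hs : 0 < s.re) {N x : ℝ} (hN : 0 < N)
    (hx : x ∈ Set.Icc N (N + 1)) :
    ‖(N : ℂ) ^ (-s) - (x : ℂ) ^ (-s)‖ ≤ 2 * N ^ (-s.re) := by
  refine (norm_sub_le _ _).trans ?_
  rw [norm_cpow_eq_rpow_re_of_pos hN, norm_cpow_eq_rpow_re_of_pos (hN.trans_le hx.1)]
  have : x ^ (-s).re ≤ N ^ (-s).re := Real.rpow_le_rpow_of_nonpos hN hx.1 (by simp; linarith)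
  simp only [neg_re] at *
  linarith

lemma norm_cpow_neg_sub_cpow_neg_le_rpow {s : ℂ} (hs : 0 < s.re) {N x θ : ℝ} (hN : 0 < N)
    (hθ0 : 0 ≤ θ) (hθ1 : θ ≤ 1) (hx : x ∈ Set.Icc N (N + 1)) :
    ‖(N : ℂ) ^ (-s) - (x : ℂ) ^ (-s)‖ ≤ 2 * ‖s‖ ^ θ * N ^ (-s.re - θ) := by
  have hs0 : 0 < ‖s‖ := by
    rw [norm_pos_iff]; rintro rfl; simp at hs
  have key : ‖s‖ ^ θ * N ^ (-s.re - θ) = (‖s‖ / N) ^ θ * N ^ (-s.re) := by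
    rw [Real.div_rpow hs0.le hN.le, Real.rpow_sub hN]; field_simp
  rw [mul_assoc, key]
  rcases le_total ‖s‖ N with h | h
  · refine (norm_cpow_neg_sub_cpow_neg_le hs hN hx).trans ?_
    have h1 : ‖s‖ * N ^ (-s.re - 1) = (‖s‖ / N) * N ^ (-s.re) := by
      rw [Real.rpow_sub hN, Real.rpow_one]; field_simp
    rw [h1]
    have h2 : ‖s‖ / N ≤ (‖s‖ / N) ^ θ := by
      have := Real.rpow_le_rpow_of_exponent_ge (x := ‖s‖ / N) (by positivity)
        ((div_le_one hN).2 h) hθ1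
      simpa using this
    have h3 : 0 ≤ (‖s‖ / N) ^ θ * N ^ (-s.re) := by positivity
    have h4 : ‖s‖ / N * N ^ (-s.re) ≤ (‖s‖ / N) ^ θ * N ^ (-s.re) := by gcongr
    linarith
  · refine (norm_cpow_neg_sub_cpow_neg_le_two hs hN hx).trans ?_
    have h2 : 1 ≤ (‖s‖ / N) ^ θ := Real.one_le_rpow ((one_le_div hN).2 h) hθ0
    have : 0 ≤ N ^ (-s.re) := by positivity
    nlinarith

lemma norm_zetaTerm_le {s : ℂ} (hs : 0 < s.re) (n : ℕ) {θ : ℝ} (hθ0 : 0 ≤ θ) (hθ1 : θ ≤ 1) :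
    ‖zetaTerm n s‖ ≤ ‖s - 1‖ * (2 * ‖s‖ ^ θ * (n + 1 : ℝ) ^ (-s.re - θ)) := by
  set N : ℝ := n + 1 with hNdef
  have hN : 0 < N := by positivity
  have h := Convex.norm_image_sub_le_of_norm_hasDerivWithin_le (𝕜 := ℝ)
    (f := fun y : ℝ => (s - 1) * ((y : ℂ) * (N : ℂ) ^ (-s)) + (y : ℂ) ^ (1 - s))
    (f' := fun y : ℝ => (s - 1) * ((N : ℂ) ^ (-s) - (y : ℂ) ^ (-s)))
    (s := Set.Icc N (N + 1)) (C := ‖s - 1‖ * (2 * ‖s‖ ^ θ * N ^ (-s.re - θ)))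
    (x := N) (y := N + 1)
    (fun y hy => by
      have h1 := hasDerivAt_real_cpow_const (1 - s) (hN.trans_le hy.1)
      have h2 : HasDerivAt (fun y : ℝ => (s - 1) * ((y : ℂ) * (N : ℂ) ^ (-s)))
          ((s - 1) * (1 * (N : ℂ) ^ (-s))) y :=
        ((hasDerivAt_id y).ofReal_comp.mul_const _).const_mul _
      have h3 := (h2.add h1).hasDerivWithinAt (s := Set.Icc N (N + 1))
      convert! h3 using 1
      rw [show (1 - s - 1 : ℂ) = -s by ring]; ring)
    (fun y hy => by
      rw [norm_mul]
      gcongr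
      exact norm_cpow_neg_sub_cpow_neg_le_rpow hs hN hθ0 hθ1 hy)
    (convex_Icc _ _) ⟨le_rfl, by linarith⟩ ⟨by linarith, le_rfl⟩
  have h2 : ‖N + 1 - N‖ = 1 := by simp
  rw [h2, mul_one] at h
  refine le_of_eq_of_le (congrArg norm ?_) h
  have : (n + 2 : ℝ) = N + 1 := by rw [hNdef]; ring
  rw [zetaTerm, this, ← hNdef]
  push_cast
  ring

lemma hasSum_zetaTerm {s : ℂ} (hs : 1 < s.re) :
    HasSum (fun n => zetaTerm n s) (riemannZeta₁ s - 1) := by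
  have hs1 : s ≠ 1 := by rintro rfl; simp at hs
  have h1 : HasSum (fun n : ℕ => (s - 1) * ((n + 1 : ℝ) : ℂ) ^ (-s)) (riemannZeta₁ s) := by
    have h2 : Summable (fun n : ℕ => 1 / ((n : ℂ) + 1) ^ s) := by
      have := (Complex.summable_one_div_nat_cpow (p := s)).2 hs
      have := (summable_nat_add_iff 1).2 this
      simpa using this
    have h3 := h2.hasSum
    rw [← zeta_eq_tsum_one_div_nat_add_one_cpow hs] at h3
    have h4 := h3.mul_left (s - 1)
    rw [riemannZeta_eq_inv_sub_mul hs1, ← mul_assoc, mul_inv_cancel₀ (sub_ne_zero.2 hs1), one_mul]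
      at h4
    refine h4.congr_fun ?_
    intro n
    rw [cpow_neg, one_div]; push_cast; rfl
  have h5 : Summable (fun n => ‖zetaTerm n s‖) := by
    refine Summable.of_nonneg_of_le (fun _ => norm_nonneg _)
      (fun n => norm_zetaTerm_le (by linarith) n le_rfl zero_le_one) ?_
    refine Summable.mul_left _ (Summable.mul_left _ ?_)
    have := (Real.summable_one_div_nat_add_rpow 1 (s.re)).2 hs
    refine this.congr fun n => ?_
    rw [abs_of_nonneg (by positivity), sub_zero, Real.rpow_neg (by positivity), one_div]
  rw [hasSum_iff_tendsto_nat_of_summable_norm h5]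
  have h6 := h1.tendsto_sum_nat
  have h7 : ∀ k : ℕ, ∑ i ∈ Finset.range k, zetaTerm i s =
      ∑ i ∈ Finset.range k, (s - 1) * ((i + 1 : ℝ) : ℂ) ^ (-s) - (1 - ((k + 1 : ℝ) : ℂ) ^ (1 - s)) := by
    intro k
    induction k with
    | zero => simp
    | succ k ih =>
      rw [Finset.sum_range_succ, Finset.sum_range_succ, ih, zetaTerm]
      push_cast
      rw [show (k : ℂ) + 1 + 1 = k + 2 by ring]; ring
  have h8 : Tendsto (fun k : ℕ => ((k + 1 : ℝ) : ℂ) ^ (1 - s)) atTop (𝓝 0) := by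
    rw [tendsto_zero_iff_norm_tendsto_zero]
    have h9 : Tendsto (fun k : ℕ => ((k : ℝ) + 1) ^ (-(s.re - 1))) atTop (𝓝 0) :=
      (tendsto_rpow_neg_atTop (by linarith)).comp
        (tendsto_atTop_add_const_right _ _ tendsto_natCast_atTop_atTop)
    refine h9.congr fun k => ?_
    rw [norm_cpow_eq_rpow_re_of_pos (by positivity)]
    simp
  have h10 := h6.sub (h8.const_sub 1)
  simp only [sub_zero] at h10
  exact h10.congr fun k => (h7 k).symm

lemma summable_nat_add_one_rpow {r : ℝ} (hr : 1 < r) :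
    Summable (fun n : ℕ => (n + 1 : ℝ) ^ (-r)) := by
  have := (Real.summable_one_div_nat_add_rpow 1 r).2 hr
  refine this.congr fun n => ?_
  rw [abs_of_nonneg (by positivity), Real.rpow_neg (by positivity), one_div]

lemma norm_zetaTerm_le' {s : ℂ} (hs : 59 / 60 < s.re) (n : ℕ) :
    ‖zetaTerm n s‖ ≤
      ‖s - 1‖ * (2 * ‖s‖ ^ (1 / 30 : ℝ) * (n + 1 : ℝ) ^ (-(61 / 60) : ℝ)) := by
  refine (norm_zetaTerm_le (by linarith) n (θ := 1 / 30) (by norm_num) (by norm_num)).trans ?_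
  gcongr
  · have : (0 : ℝ) ≤ n := by positivity
    linarith
  · linarith

lemma hasSum_zetaTerm' {s : ℂ} (hs : 59 / 60 < s.re) :
    HasSum (fun n => zetaTerm n s) (riemannZeta₁ s - 1) := by
  set R : ℝ := ‖s‖ + 3 with hR
  set V : Set ℂ := {z : ℂ | 59 / 60 < z.re} ∩ Metric.ball 0 R with hV
  have hVo : IsOpen V := (isOpen_lt continuous_const continuous_re).inter Metric.isOpen_ball
  have hVc : Convex ℝ V := (convex_halfSpace_re_gt _).inter (convex_ball _ _)
  have hsum : Summable (fun n : ℕ => (R + 1) * (2 * R ^ (1 / 30 : ℝ) * (n + 1 : ℝ) ^ (-(61 / 60) : ℝ))) :=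
    ((summable_nat_add_one_rpow (by norm_num)).mul_left _).mul_left _
  have hb : ∀ (n : ℕ) (z : ℂ), z ∈ V →
      ‖zetaTerm n z‖ ≤ (R + 1) * (2 * R ^ (1 / 30 : ℝ) * (n + 1 : ℝ) ^ (-(61 / 60) : ℝ)) := by
    intro n z hz
    have hz2 : ‖z‖ ≤ R := (mem_ball_zero_iff.1 hz.2).le
    refine (norm_zetaTerm_le' hz.1 n).trans ?_
    have : ‖z - 1‖ ≤ R + 1 := (norm_sub_le _ _).trans (by simpa using hz2)
    gcongr
  have hd := differentiableOn_tsum_of_summable_norm hsum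
    (fun n => (differentiable_zetaTerm n).differentiableOn) hVo hb
  have hsV : s ∈ V := ⟨hs, by simp [hR]⟩
  have h2V : (2 : ℂ) ∈ V := ⟨by norm_num, by simp [hR]; linarith [norm_nonneg s]⟩
  have heq := (hd.analyticOnNhd hVo).eqOn_of_preconnected_of_eventuallyEq
    (g := fun z => riemannZeta₁ z - 1)
    ((differentiable_riemannZeta₁.sub_const 1).differentiableOn.analyticOnNhd hVo)
    hVc.isPreconnected h2V (by
      have : {z : ℂ | 1 < z.re} ∈ 𝓝 (2 : ℂ) :=
        (isOpen_lt continuous_const continuous_re).mem_nhds (by simp)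
      filter_upwards [this] with z hz
      exact (hasSum_zetaTerm hz).tsum_eq)
  have hS : Summable (fun n => zetaTerm n s) :=
    Summable.of_norm_bounded hsum (fun n => hb n s hsV)
  have h := heq hsV
  simp only at h
  rw [← h]
  exact hS.hasSum

lemma exists_norm_riemannZeta₁_le : ∃ C : ℝ, 0 < C ∧ ∀ s : ℂ, 59 / 60 < s.re →
    ‖riemannZeta₁ s‖ ≤ 1 + C * ‖s - 1‖ * ‖s‖ ^ (1 / 30 : ℝ) := by
  have hsum := summable_nat_add_one_rpow (r := 61 / 60) (by norm_num)
  refine ⟨2 * ∑' n : ℕ, (n + 1 : ℝ) ^ (-(61 / 60) : ℝ), ?_, fun s hs => ?_⟩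
  · have := hsum.tsum_pos (fun n => by positivity) 0 (by norm_num)
    positivity
  · have h1 := hasSum_zetaTerm' hs
    have h2 : ‖riemannZeta₁ s - 1‖ ≤
        ‖s - 1‖ * (2 * ‖s‖ ^ (1 / 30 : ℝ) * ∑' n : ℕ, (n + 1 : ℝ) ^ (-(61 / 60) : ℝ)) := by
      rw [← h1.tsum_eq]
      exact tsum_of_norm_bounded ((hsum.hasSum.mul_left _).mul_left _) (norm_zetaTerm_le' hs)
    calc ‖riemannZeta₁ s‖ = ‖1 + (riemannZeta₁ s - 1)‖ := by ring_nf
      _ ≤ 1 + ‖riemannZeta₁ s - 1‖ := (norm_add_le _ _).trans (by simp)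
      _ ≤ _ := by linarith

end HarmanKumchev

namespace HarmanKumchev

open Complex Filter Topology

lemma exists_norm_riemannZeta_le : ∃ C : ℝ, 1 ≤ C ∧ ∀ s : ℂ, 59 / 60 < s.re → s.re ≤ 3 →
    1 / 2 ≤ |s.im| → ‖riemannZeta s‖ ≤ C * |s.im| ^ (1 / 30 : ℝ) := by
  obtain ⟨C, hC, h⟩ := exists_norm_riemannZeta₁_le
  refine ⟨4 + 7 * C, by linarith, fun s hs1 hs2 hs3 => ?_⟩
  have hne : s ≠ 1 := by rintro rfl; norm_num at hs3
  have h1 : 1 / 2 ≤ ‖s - 1‖ := hs3.trans (by simpa using abs_im_le_norm (s - 1))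
  have h2 : ‖s‖ ≤ 7 * |s.im| := by
    refine (norm_le_abs_re_add_abs_im s).trans ?_
    rw [abs_of_pos (by linarith)]; linarith
  have h3 : ‖riemannZeta s‖ ≤ 2 + C * ‖s‖ ^ (1 / 30 : ℝ) := by
    rw [riemannZeta_eq_inv_sub_mul hne, norm_mul, norm_inv]
    calc ‖s - 1‖⁻¹ * ‖riemannZeta₁ s‖
        ≤ ‖s - 1‖⁻¹ * (1 + C * ‖s - 1‖ * ‖s‖ ^ (1 / 30 : ℝ)) := by gcongr; exact h s hs1
      _ = ‖s - 1‖⁻¹ + C * ‖s‖ ^ (1 / 30 : ℝ) := by field_simp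
      _ ≤ _ := by
        gcongr
        rw [inv_le_comm₀ (by linarith) (by norm_num)]; linarith
  have h4 : ‖s‖ ^ (1 / 30 : ℝ) ≤ 7 * |s.im| ^ (1 / 30 : ℝ) := by
    calc ‖s‖ ^ (1 / 30 : ℝ) ≤ (7 * |s.im|) ^ (1 / 30 : ℝ) := by gcongr
      _ = (7 : ℝ) ^ (1 / 30 : ℝ) * |s.im| ^ (1 / 30 : ℝ) := by
        rw [Real.mul_rpow (by norm_num) (abs_nonneg _)]
      _ ≤ (7 : ℝ) ^ (1 : ℝ) * |s.im| ^ (1 / 30 : ℝ) := by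
        gcongr <;> norm_num
      _ = _ := by simp
  have h5 : 1 / 2 ≤ |s.im| ^ (1 / 30 : ℝ) := by
    calc (1 / 2 : ℝ) = (1 / 2 : ℝ) ^ (1 : ℝ) := by simp
      _ ≤ (1 / 2 : ℝ) ^ (1 / 30 : ℝ) :=
        Real.rpow_le_rpow_of_exponent_ge (by norm_num) (by norm_num) (by norm_num)
      _ ≤ _ := by gcongr
  nlinarith

lemma im_abs_le_of_mem_closedBall {c z : ℂ} {r : ℝ} (hz : ‖z - c‖ ≤ r) :
    |z.re - c.re| ≤ r ∧ |c.im| - r ≤ |z.im| ∧ |z.im| ≤ |c.im| + r := by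
  have h1 := (abs_re_le_norm (z - c)).trans hz
  have h2 := (abs_im_le_norm (z - c)).trans hz
  rw [sub_re] at h1
  rw [sub_im] at h2
  refine ⟨h1, ?_, ?_⟩
  · have := abs_sub_abs_le_abs_sub c.im z.im
    rw [abs_sub_comm] at this; linarith
  · have := abs_sub_abs_le_abs_sub z.im c.im
    linarith

lemma exists_norm_deriv_riemannZeta_le : ∃ C : ℝ, 1 ≤ C ∧ ∀ s : ℂ, 119 / 120 < s.re → s.re ≤ 2 →
    3 / 4 ≤ |s.im| → ‖deriv riemannZeta s‖ ≤ C * |s.im| ^ (1 / 30 : ℝ) := by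
  obtain ⟨C, hC, h⟩ := exists_norm_riemannZeta_le
  refine ⟨C * 2 / (1 / 120), by linarith, fun s hs1 hs2 hs3 => ?_⟩
  have h1 := norm_deriv_le_of_forall_mem_sphere_norm_le (f := riemannZeta) (c := s) (R := 1 / 120)
    (C := C * 2 * |s.im| ^ (1 / 30 : ℝ)) (by norm_num)
    (by
      refine DifferentiableOn.diffContOnCl ?_
      intro z hz
      rw [closure_ball _ (by norm_num), mem_closedBall_iff_norm] at hz
      obtain ⟨-, h2, -⟩ := im_abs_le_of_mem_closedBall hz
      refine (differentiableAt_riemannZeta ?_).differentiableWithinAt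
      rintro rfl
      norm_num at h2; linarith)
    (fun z hz => by
      rw [mem_sphere_iff_norm] at hz
      obtain ⟨h1, h2, h3⟩ := im_abs_le_of_mem_closedBall hz.le
      rw [abs_le] at h1
      refine (h z (by linarith) (by linarith) (by linarith)).trans ?_
      rw [mul_assoc]
      gcongr
      calc |z.im| ^ (1 / 30 : ℝ) ≤ (2 * |s.im|) ^ (1 / 30 : ℝ) := by gcongr; linarith
        _ = (2 : ℝ) ^ (1 / 30 : ℝ) * |s.im| ^ (1 / 30 : ℝ) := by
          rw [Real.mul_rpow (by norm_num) (abs_nonneg _)]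
        _ ≤ (2 : ℝ) ^ (1 : ℝ) * |s.im| ^ (1 / 30 : ℝ) := by
          gcongr <;> norm_num
        _ = _ := by simp)
  refine h1.trans (le_of_eq ?_)
  ring

lemma one_le_norm_riemannZeta_product {x : ℝ} (hx : 0 < x) (y : ℝ) :
    1 ≤ ‖riemannZeta (1 + x)‖ ^ 3 * ‖riemannZeta (1 + x + I * y)‖ ^ 4 *
      ‖riemannZeta (1 + x + 2 * I * y)‖ := by
  have h := DirichletCharacter.norm_LFunction_product_ge_one (N := 1) (1 : DirichletCharacter ℂ 1) hx y
  simpa [DirichletCharacter.LFunctionTrivChar, DirichletCharacter.LFunction_modOne_eq] using h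

lemma exists_norm_riemannZeta_one_add_le : ∃ C : ℝ, 1 ≤ C ∧ ∀ x : ℝ, 0 < x → x ≤ 1 →
    ‖riemannZeta (1 + x)‖ ≤ C / x := by
  obtain ⟨C, hC, h⟩ := exists_norm_riemannZeta₁_le
  refine ⟨1 + 2 * C, by linarith, fun x hx0 hx1 => ?_⟩
  have hne : (1 + x : ℂ) ≠ 1 := by
    have : (x : ℂ) ≠ 0 := by exact_mod_cast hx0.ne'
    simpa using this
  have h1 := h (1 + x) (by simp; linarith)
  have h2 : ‖(1 + x : ℂ)‖ ^ (1 / 30 : ℝ) ≤ 2 := by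
    have h3 : ‖(1 + x : ℂ)‖ = 1 + x := by
      have : (1 + x : ℂ) = ((1 + x : ℝ) : ℂ) := by push_cast; rfl
      rw [this, norm_real, Real.norm_of_nonneg (by linarith)]
    rw [h3]
    calc (1 + x) ^ (1 / 30 : ℝ) ≤ (1 + x) ^ (1 : ℝ) :=
          Real.rpow_le_rpow_of_exponent_le (by linarith) (by norm_num)
      _ ≤ 2 := by rw [Real.rpow_one]; linarith
  have h3 : ‖(1 + x : ℂ) - 1‖ = x := by
    rw [add_sub_cancel_left, norm_real, Real.norm_of_nonneg hx0.le]
  rw [riemannZeta_eq_inv_sub_mul hne, norm_mul, norm_inv, h3, div_eq_inv_mul]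
  rw [h3] at h1
  gcongr
  refine h1.trans ?_
  have : x * ‖(1 + x : ℂ)‖ ^ (1 / 30 : ℝ) ≤ 1 * 2 := by gcongr
  nlinarith

end HarmanKumchev

namespace HarmanKumchev

open Complex Filter Topology

lemma exists_le_norm_riemannZeta_right : ∃ C : ℝ, 1 ≤ C ∧ ∀ w q : ℝ, 0 < w → w ≤ 1 → ∀ t : ℝ,
    1 ≤ |t| → q = |t| ^ (1 / 120 : ℝ) →
    w ^ 3 / (C * q) ≤ ‖riemannZeta ((1 + w ^ 4 : ℝ) + t * I)‖ := by
  obtain ⟨C₁, hC₁, h₁⟩ := exists_norm_riemannZeta_one_add_le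
  obtain ⟨C₂, hC₂, h₂⟩ := exists_norm_riemannZeta_le
  refine ⟨2 * C₁ * C₂, by nlinarith, fun w q hw0 hw1 t ht hq => ?_⟩
  have hw4 : 0 < w ^ 4 := by positivity
  have hw41 : w ^ 4 ≤ 1 := pow_le_one₀ hw0.le hw1
  have hq1 : 1 ≤ q := by rw [hq]; exact Real.one_le_rpow ht (by norm_num)
  have hq4 : q ^ 4 = |t| ^ (1 / 30 : ℝ) := by
    rw [hq, ← Real.rpow_natCast, ← Real.rpow_mul (abs_nonneg _)]; norm_num
  have h := one_le_norm_riemannZeta_product hw4 t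
  have ha := h₁ (w ^ 4) hw4 hw41
  have hb := h₂ (1 + (w ^ 4 : ℝ) + 2 * I * t) (by simp; norm_cast; linarith)
    (by simp; norm_cast; linarith) (by simp; norm_cast; simp; linarith)
  have him : (1 + ((w ^ 4 : ℝ) : ℂ) + 2 * I * t).im = 2 * t := by simp; norm_cast
  rw [him, abs_mul, abs_two, Real.mul_rpow (by norm_num) (abs_nonneg _), ← hq4] at hb
  have h2 : (2 : ℝ) ^ (1 / 30 : ℝ) ≤ 2 := by
    conv_rhs => rw [← Real.rpow_one 2]
    exact Real.rpow_le_rpow_of_exponent_le (by norm_num) (by norm_num)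
  have heq : (((1 + w ^ 4 : ℝ) : ℂ) + t * I) = 1 + ((w ^ 4 : ℝ) : ℂ) + I * t := by push_cast; ring
  rw [heq]
  set N := ‖riemannZeta (1 + ((w ^ 4 : ℝ) : ℂ) + I * t)‖
  have hN : 0 ≤ N := norm_nonneg _
  have hb' : ‖riemannZeta (1 + ((w ^ 4 : ℝ) : ℂ) + 2 * I * t)‖ ≤ C₂ * (2 * q ^ 4) :=
    hb.trans (by gcongr)
  have h3 : 1 ≤ (C₁ / w ^ 4) ^ 3 * N ^ 4 * (C₂ * (2 * q ^ 4)) :=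
    h.trans (by gcongr)
  by_contra! hlt
  have h4 : N ^ 4 < (w ^ 3 / (2 * C₁ * C₂ * q)) ^ 4 := by gcongr
  have h5 : (C₁ / w ^ 4) ^ 3 * N ^ 4 * (C₂ * (2 * q ^ 4)) <
      (C₁ / w ^ 4) ^ 3 * (w ^ 3 / (2 * C₁ * C₂ * q)) ^ 4 * (C₂ * (2 * q ^ 4)) := by gcongr
  have h6 : (C₁ / w ^ 4) ^ 3 * (w ^ 3 / (2 * C₁ * C₂ * q)) ^ 4 * (C₂ * (2 * q ^ 4)) =
      1 / (8 * C₁ * C₂ ^ 3) := by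
    field_simp
    ring
  have h7 : 1 / (8 * C₁ * C₂ ^ 3) ≤ 1 := by
    rw [div_le_one (by positivity)]
    have : 1 ≤ C₂ ^ 3 := one_le_pow₀ hC₂
    nlinarith
  linarith

/-- A quantitative zero-free region: a lower bound for `ζ` slightly to the left of the line
`Re s = 1`. -/
lemma exists_le_norm_riemannZeta : ∃ κ c : ℝ, 0 < κ ∧ κ ≤ 1 / 240 ∧ 0 < c ∧ ∀ q : ℝ, ∀ s : ℂ,
    1 ≤ |s.im| → q = |s.im| ^ (1 / 120 : ℝ) → 1 - κ / q ^ 20 ≤ s.re → s.re ≤ 2 →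
    c / q ^ 16 ≤ ‖riemannZeta s‖ := by
  obtain ⟨C₁, hC₁, h₁⟩ := exists_le_norm_riemannZeta_right
  obtain ⟨C₂, hC₂, h₂⟩ := exists_norm_deriv_riemannZeta_le
  set k : ℝ := 1 / (4 * C₁ * C₂) with hk
  have hk0 : 0 < k := by positivity
  have hCC : 1 ≤ C₁ * C₂ := by nlinarith
  have hk1 : k ≤ 1 / 4 := by
    rw [hk]; gcongr; nlinarith
  have hk4 : k ^ 4 ≤ 1 / 240 := by
    calc k ^ 4 ≤ (1 / 4) ^ 4 := by gcongr
      _ ≤ _ := by norm_num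
  refine ⟨k ^ 4, k ^ 3 / (2 * C₁), by positivity, hk4, by positivity,
    fun q s ht hq hs1 hs2 => ?_⟩
  set t := s.im with htdef
  have hq1 : 1 ≤ q := by rw [hq]; exact Real.one_le_rpow ht (by norm_num)
  have hq0 : 0 < q := by linarith
  have hq4 : q ^ 4 = |t| ^ (1 / 30 : ℝ) := by
    rw [hq, ← Real.rpow_natCast, ← Real.rpow_mul (abs_nonneg _)]; norm_num
  set w := k / q ^ 5 with hw
  have hw0 : 0 < w := by positivity
  have hw1 : w ≤ 1 := by
    rw [hw, div_le_one (by positivity)]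
    have : 1 ≤ q ^ 5 := one_le_pow₀ hq1
    linarith
  have hw4 : k ^ 4 / q ^ 20 = w ^ 4 := by rw [hw, div_pow]; ring
  have hw3 : w ^ 3 / (C₁ * q) = k ^ 3 / C₁ / q ^ 16 := by rw [hw]; field_simp
  have hw4' : w ^ 4 ≤ 1 / 240 := by
    rw [← hw4]
    refine le_trans (div_le_self (by positivity) (one_le_pow₀ hq1)) hk4
  rw [hw4] at hs1
  rcases le_total (1 + w ^ 4) s.re with h | h
  · set v := (s.re - 1) ^ (1 / 4 : ℝ) with hv
    have hre : 0 ≤ s.re - 1 := by have := pow_pos hw0 4; linarith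
    have hv4 : v ^ 4 = s.re - 1 := by
      rw [hv, ← Real.rpow_natCast, ← Real.rpow_mul hre]; norm_num
    have hwv : w ≤ v := by
      refine le_of_pow_le_pow_left₀ (n := 4) (by norm_num) (by positivity) ?_
      rw [hv4]; linarith
    have hv1 : v ≤ 1 := Real.rpow_le_one hre (by linarith) (by norm_num)
    have h3 := h₁ v q (hw0.trans_le hwv) hv1 t ht hq
    have h4 : (((1 + v ^ 4 : ℝ) : ℂ) + t * I) = s := by
      rw [hv4]
      apply Complex.ext <;> simp [htdef]
    rw [h4] at h3
    refine le_trans ?_ h3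
    calc k ^ 3 / (2 * C₁) / q ^ 16 ≤ k ^ 3 / C₁ / q ^ 16 := by gcongr; linarith
      _ = w ^ 3 / (C₁ * q) := hw3.symm
      _ ≤ _ := by gcongr
  · have h3 := h₁ w q hw0 hw1 t ht hq
    set s₁ : ℂ := ((1 + w ^ 4 : ℝ) : ℂ) + t * I with hs₁
    have hre₁ : s₁.re = 1 + w ^ 4 := by simp [hs₁]; norm_cast
    have him₁ : s₁.im = t := by simp [hs₁]; norm_cast
    have hconv : Convex ℝ ((Complex.reLm ⁻¹' Set.Icc (1 - w ^ 4) (1 + w ^ 4)) ∩ (Complex.imLm ⁻¹' {t})) :=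
      ((convex_Icc _ _).linear_preimage _).inter ((convex_singleton _).linear_preimage _)
    have h4 := hconv.norm_image_sub_le_of_norm_deriv_le (f := riemannZeta) (C := C₂ * q ^ 4)
      (x := s) (y := s₁) ?_ ?_ ?_ ?_
    · have h5 : ‖s₁ - s‖ ≤ 2 * w ^ 4 := by
        have : s₁ - s = ((1 + w ^ 4 - s.re : ℝ) : ℂ) := by
          apply Complex.ext
          · rw [sub_re, hre₁, ofReal_re]
          · rw [sub_im, him₁, ofReal_im, sub_self]
        rw [this, norm_real, Real.norm_of_nonneg (by linarith)]
        linarith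
      have h6 : C₂ * q ^ 4 * ‖s₁ - s‖ ≤ k ^ 3 / (2 * C₁) / q ^ 16 := by
        calc C₂ * q ^ 4 * ‖s₁ - s‖ ≤ C₂ * q ^ 4 * (2 * w ^ 4) := by gcongr
          _ = C₂ * 2 * k ^ 4 / q ^ 16 := by rw [hw]; field_simp
          _ = k ^ 3 / (2 * C₁) / q ^ 16 := by
            rw [pow_succ k 3]
            nth_rewrite 2 [hk]
            field_simp
            norm_num
      have h7 : ‖riemannZeta s₁‖ ≤ ‖riemannZeta s₁ - riemannZeta s‖ + ‖riemannZeta s‖ := by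
        simpa using norm_add_le (riemannZeta s₁ - riemannZeta s) (riemannZeta s)
      have h8 : k ^ 3 / C₁ / q ^ 16 = 2 * (k ^ 3 / (2 * C₁) / q ^ 16) := by field_simp
      linarith
    · rintro z ⟨-, hz⟩
      refine differentiableAt_riemannZeta ?_
      rintro rfl
      have : (0 : ℝ) = t := by simpa using hz
      rw [← this] at ht; norm_num at ht
    · rintro z ⟨hz1, hz2⟩
      have hz1' : 1 - w ^ 4 ≤ z.re ∧ z.re ≤ 1 + w ^ 4 := by simpa using hz1
      have hz2' : z.im = t := by simpa using hz2
      have := h₂ z (by linarith) (by linarith) (by rw [hz2']; linarith)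
      rwa [hz2', ← hq4] at this
    · exact ⟨by simpa using ⟨by linarith, h⟩, by simp [htdef]⟩
    · refine ⟨?_, by simp [him₁]⟩
      have := pow_pos hw0 4
      simp only [Set.mem_preimage, reLm_coe, hre₁, Set.mem_Icc]
      constructor <;> linarith

end HarmanKumchev

namespace HarmanKumchev

open Complex Filter Topology

/-- The function `-(D + 1) / s ^ 2`, where `D` is the logarithmic derivative of `(s - 1) ζ s`. -/
def zetaKernel (s : ℂ) : ℂ := -(deriv riemannZeta₁ s / riemannZeta₁ s + 1) / s ^ 2

lemma riemannZeta₁_ne_zero {s : ℂ} (hs : riemannZeta s ≠ 0 ∨ s = 1) : riemannZeta₁ s ≠ 0 := by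
  by_cases h1 : s = 1
  · rw [h1, riemannZeta₁_one]; exact one_ne_zero
  · intro h
    rcases hs with hs | hs
    · exact hs (by rw [riemannZeta_eq_inv_sub_mul h1, h, mul_zero])
    · exact h1 hs

lemma logDeriv_riemannZeta₁ {s : ℂ} (h1 : s ≠ 1) (hs : riemannZeta s ≠ 0) :
    deriv riemannZeta₁ s / riemannZeta₁ s = deriv riemannZeta s / riemannZeta s + (s - 1)⁻¹ := by
  have h2 := riemannZeta₁_ne_zero (Or.inl hs)
  have h3 : s - 1 ≠ 0 := sub_ne_zero.2 h1
  rw [deriv_riemannZeta_eq_neg_inv_sub_sq_mul_add h1, riemannZeta_eq_inv_sub_mul h1]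
  field_simp
  ring

lemma analyticAt_zetaKernel {s : ℂ} (hs0 : s ≠ 0) (hs : riemannZeta s ≠ 0 ∨ s = 1) :
    AnalyticAt ℂ zetaKernel s := by
  have h : AnalyticAt ℂ riemannZeta₁ s := differentiable_riemannZeta₁.analyticAt s
  exact (((h.deriv.div h (riemannZeta₁_ne_zero hs)).add analyticAt_const).neg).div
    (analyticAt_id.pow 2) (pow_ne_zero _ hs0)

lemma exists_norm_zetaKernel_le : ∃ κ C : ℝ, 0 < κ ∧ κ ≤ 1 / 240 ∧ 0 < C ∧ ∀ q : ℝ, ∀ s : ℂ,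
    1 ≤ |s.im| → q = |s.im| ^ (1 / 120 : ℝ) → 1 - κ / q ^ 20 ≤ s.re → s.re ≤ 2 →
    riemannZeta s ≠ 0 ∧ ‖zetaKernel s‖ ≤ C * q ^ 20 / s.im ^ 2 := by
  obtain ⟨κ, c, hκ, hκ', hc, h⟩ := exists_le_norm_riemannZeta
  obtain ⟨C₂, hC₂, h₂⟩ := exists_norm_deriv_riemannZeta_le
  refine ⟨κ, C₂ / c + 2, hκ, hκ', by positivity, fun q s ht hq hs1 hs2 => ?_⟩
  have h3 := h q s ht hq hs1 hs2
  have hq1 : 1 ≤ q := by rw [hq]; exact Real.one_le_rpow ht (by norm_num)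
  have hq0 : 0 < q := by linarith
  have hq4 : q ^ 4 = |s.im| ^ (1 / 30 : ℝ) := by
    rw [hq, ← Real.rpow_natCast, ← Real.rpow_mul (abs_nonneg _)]; norm_num
  have hζ : riemannZeta s ≠ 0 := by
    rw [← norm_pos_iff]; exact lt_of_lt_of_le (by positivity) h3
  refine ⟨hζ, ?_⟩
  have h1 : s ≠ 1 := by rintro rfl; norm_num at ht
  have h4 : κ / q ^ 20 ≤ 1 / 240 := (div_le_self hκ.le (one_le_pow₀ hq1)).trans hκ'
  have h5 := h₂ s (by linarith) hs2 (by linarith)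
  rw [← hq4] at h5
  have h6 : 1 ≤ ‖s - 1‖ := ht.trans (by simpa using abs_im_le_norm (s - 1))
  have h7 : |s.im| ≤ ‖s‖ := abs_im_le_norm s
  rw [zetaKernel, logDeriv_riemannZeta₁ h1 hζ, norm_div, norm_neg, norm_pow, ← sq_abs s.im]
  have h8 : ‖deriv riemannZeta s / riemannZeta s + (s - 1)⁻¹ + 1‖ ≤ (C₂ / c + 2) * q ^ 20 := by
    calc ‖deriv riemannZeta s / riemannZeta s + (s - 1)⁻¹ + 1‖
        ≤ ‖deriv riemannZeta s / riemannZeta s‖ + ‖(s - 1)⁻¹‖ + ‖(1 : ℂ)‖ := norm_add₃_le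
      _ ≤ C₂ * q ^ 4 / (c / q ^ 16) + 1 + 1 := by
        gcongr
        · rw [norm_div]; gcongr
        · rw [norm_inv]; exact inv_le_one_of_one_le₀ h6
        · simp
      _ = C₂ / c * q ^ 20 + 2 := by field_simp; ring
      _ ≤ C₂ / c * q ^ 20 + 2 * q ^ 20 := by
        have : 1 ≤ q ^ 20 := one_le_pow₀ hq1
        linarith
      _ = _ := by ring
  gcongr

lemma exists_norm_iteratedDeriv_zetaKernel_le_of_two_le : ∃ C : ℝ, 0 < C ∧ ∀ s : ℂ,
    2 ≤ |s.im| → 1 ≤ s.re → s.re ≤ 5 / 4 →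
    ‖iteratedDeriv 2 zetaKernel s‖ ≤ C * |s.im| ^ (-(3 / 2) : ℝ) := by
  obtain ⟨κ, C, hκ, hκ', hC, h⟩ := exists_norm_zetaKernel_le
  refine ⟨64 * C / κ ^ 2, by positivity, fun s ht hs1 hs2 => ?_⟩
  set T := |s.im| with hT
  set q : ℝ := T ^ (1 / 120 : ℝ) with hq
  have hq1 : 1 ≤ q := by rw [hq]; exact Real.one_le_rpow (by linarith) (by norm_num)
  have hq0 : 0 < q := by linarith
  set R : ℝ := κ / (2 * q ^ 20) with hR
  have hR0 : 0 < R := by positivity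
  have hRκ : R ≤ κ := div_le_self hκ.le (by
    have : 1 ≤ q ^ 20 := one_le_pow₀ hq1
    linarith)
  have hball : ∀ z ∈ Metric.closedBall s R,
      riemannZeta z ≠ 0 ∧ ‖zetaKernel z‖ ≤ 8 * C * q ^ 20 / T ^ 2 ∧ z ≠ 0 := by
    intro z hz
    rw [Metric.mem_closedBall, dist_eq_norm] at hz
    obtain ⟨hz1, hz2, hz3⟩ := im_abs_le_of_mem_closedBall hz
    rw [← hT] at hz2 hz3
    have hz4 : T / 2 ≤ |z.im| := by linarith
    have hz5 : |z.im| ≤ 2 * T := by linarith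
    set p : ℝ := |z.im| ^ (1 / 120 : ℝ) with hp
    have hp0 : 0 < p := by
      have : 0 < |z.im| := by linarith
      positivity
    have hpq : p ^ 20 ≤ 2 * q ^ 20 := by
      have h1 : p ^ 20 = |z.im| ^ (1 / 6 : ℝ) := by
        rw [hp, ← Real.rpow_natCast, ← Real.rpow_mul (abs_nonneg _)]; norm_num
      have h2 : q ^ 20 = T ^ (1 / 6 : ℝ) := by
        rw [hq, ← Real.rpow_natCast, ← Real.rpow_mul (by linarith)]; norm_num
      rw [h1, h2]
      calc |z.im| ^ (1 / 6 : ℝ) ≤ (2 * T) ^ (1 / 6 : ℝ) := by gcongr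
        _ = 2 ^ (1 / 6 : ℝ) * T ^ (1 / 6 : ℝ) := Real.mul_rpow (by norm_num) (by linarith)
        _ ≤ 2 ^ (1 : ℝ) * T ^ (1 / 6 : ℝ) := by gcongr <;> norm_num
        _ = _ := by rw [Real.rpow_one]
    have hz6 := abs_le.1 hz1
    have h1 : R ≤ κ / p ^ 20 := by rw [hR]; gcongr
    obtain ⟨h2, h3⟩ := h p z (by linarith) hp (by linarith) (by linarith)
    refine ⟨h2, h3.trans ?_, ?_⟩
    · calc C * p ^ 20 / z.im ^ 2 ≤ C * (2 * q ^ 20) / (T / 2) ^ 2 := by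
            rw [← sq_abs z.im]
            gcongr
        _ = _ := by field_simp; ring
    · rintro rfl
      simp at hz4
      linarith
  have h1 := Complex.norm_iteratedDeriv_le_of_forall_mem_sphere_norm_le (f := zetaKernel) (c := s)
    (C := 8 * C * q ^ 20 / T ^ 2) 2 hR0
    (DifferentiableOn.diffContOnCl fun z hz =>
      ((analyticAt_zetaKernel (hball z (Metric.closure_ball_subset_closedBall hz)).2.2
        (Or.inl (hball z (Metric.closure_ball_subset_closedBall hz)).1)).differentiableAt).differentiableWithinAt)
    (fun z hz => (hball z (Metric.sphere_subset_closedBall hz)).2.1)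
  refine h1.trans (le_of_eq ?_)
  have h2 : T ^ (-(3 / 2) : ℝ) = q ^ 60 / T ^ 2 := by
    have h3 : q ^ 60 = T ^ (1 / 2 : ℝ) := by
      rw [hq, ← Real.rpow_natCast, ← Real.rpow_mul (by linarith)]; norm_num
    rw [h3, ← Real.rpow_natCast T 2, ← Real.rpow_sub (by linarith)]; norm_num
  rw [h2, hR]
  field_simp
  norm_num [Nat.factorial]

lemma exists_norm_iteratedDeriv_zetaKernel_le : ∃ C : ℝ, 0 < C ∧ ∀ s : ℂ,
    1 ≤ s.re → s.re ≤ 5 / 4 →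
    ‖iteratedDeriv 2 zetaKernel s‖ ≤ C * (1 + |s.im|) ^ (-(3 / 2) : ℝ) := by
  obtain ⟨C, hC, h⟩ := exists_norm_iteratedDeriv_zetaKernel_le_of_two_le
  have hcont : ContinuousOn (iteratedDeriv 2 zetaKernel) (Set.Icc 1 (5 / 4) ×ℂ Set.Icc (-2) 2) := by
    intro z hz
    have hz1 : 1 ≤ z.re := hz.1.1
    have h0 : z ≠ 0 := by rintro rfl; norm_num at hz1
    have := (analyticAt_zetaKernel h0 (Or.inl (riemannZeta_ne_zero_of_one_le_re hz1)))
    exact (this.iterated_deriv 2 |>.continuousAt |>.continuousWithinAt |> fun h => by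
      rwa [← iteratedDeriv_eq_iterate] at h)
  obtain ⟨M, hM⟩ := (isCompact_Icc.reProdIm isCompact_Icc).exists_bound_of_continuousOn hcont
  refine ⟨8 * C + 8 * |M|, by positivity, fun s hs1 hs2 => ?_⟩
  have hpos : 0 < 1 + |s.im| := by positivity
  have hX : 0 < (1 + |s.im|) ^ (-(3 / 2) : ℝ) := by positivity
  rcases le_total 2 |s.im| with ht | ht
  · have h1 := h s ht hs1 hs2
    have h2 : |s.im| ^ (-(3 / 2) : ℝ) ≤ 8 * (1 + |s.im|) ^ (-(3 / 2) : ℝ) := by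
      calc |s.im| ^ (-(3 / 2) : ℝ) ≤ (1 / 4 * (1 + |s.im|)) ^ (-(3 / 2) : ℝ) :=
            Real.rpow_le_rpow_of_nonpos (by positivity) (by linarith) (by norm_num)
        _ = (1 / 4) ^ (-(3 / 2) : ℝ) * (1 + |s.im|) ^ (-(3 / 2) : ℝ) :=
          Real.mul_rpow (by norm_num) hpos.le
        _ = _ := by
          congr 1
          rw [show (1 / 4 : ℝ) = 2 ^ (-2 : ℝ) by norm_num [Real.rpow_neg],
            ← Real.rpow_mul (by norm_num)]
          norm_num
    have h3 : 0 ≤ |M| * (1 + |s.im|) ^ (-(3 / 2) : ℝ) := by positivity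
    nlinarith
  · have h1 := hM s ⟨⟨hs1, hs2⟩, abs_le.1 ht⟩
    have h2 : 1 / 8 ≤ (1 + |s.im|) ^ (-(3 / 2) : ℝ) := by
      calc (1 / 8 : ℝ) = 4 ^ (-(3 / 2) : ℝ) := by
            rw [show (4 : ℝ) = 2 ^ (2 : ℝ) by norm_num, ← Real.rpow_mul (by norm_num)]
            norm_num [Real.rpow_neg]
        _ ≤ _ := Real.rpow_le_rpow_of_nonpos hpos (by linarith) (by norm_num)
    have h3 : 0 ≤ C * (1 + |s.im|) ^ (-(3 / 2) : ℝ) := by positivity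
    have h4 := le_abs_self M
    have h5 := abs_nonneg M
    nlinarith

end HarmanKumchev

namespace HarmanKumchev

open Complex Filter Topology

lemma integrableOn_mul_cexp {s : ℂ} (hs : 0 < s.re) :
    IntegrableOn (fun u : ℝ => (u : ℂ) * cexp (-s * u)) (Set.Ioi 0) := by
  have h := integrableOn_rpow_mul_exp_neg_mul_rpow (p := 1) (s := 1) (b := s.re)
    (by norm_num) one_pos hs
  refine Integrable.mono' h ?_ ?_
  · exact (by fun_prop : Continuous _).aestronglyMeasurable
  · filter_upwards [ae_restrict_mem measurableSet_Ioi] with u hu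
    rw [norm_mul, norm_real, Real.norm_of_nonneg (le_of_lt hu), Complex.norm_exp]
    simp

lemma integral_mul_cexp_Ioi {s : ℂ} (hs : 0 < s.re) :
    ∫ u : ℝ in Set.Ioi 0, (u : ℂ) * cexp (-s * u) = 1 / s ^ 2 := by
  have hs0 : s ≠ 0 := by rintro rfl; simp at hs
  have h1 := integrableOn_mul_cexp hs
  have h0 := integrableOn_exp_mul_complex_Ioi (a := -s) (by simpa using hs) 0
  set F : ℝ → ℂ := fun u => -(s⁻¹ * ((u : ℂ) * cexp (-s * u)) + (s ^ 2)⁻¹ * cexp (-s * u)) with hF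
  have hderiv : ∀ u : ℝ, HasDerivAt F ((u : ℂ) * cexp (-s * u)) u := by
    intro u
    have he : HasDerivAt (fun u : ℝ => cexp (-s * u)) (cexp (-s * u) * (-s)) u := by
      have := ((hasDerivAt_id u).ofReal_comp.const_mul (-s)).cexp
      simpa using this
    have hid : HasDerivAt (fun u : ℝ => (u : ℂ)) 1 u := by
      simpa using (hasDerivAt_id u).ofReal_comp
    have := (((hid.mul he).const_mul s⁻¹).add (he.const_mul (s ^ 2)⁻¹)).neg
    refine HasDerivAt.congr_deriv this ?_
    field_simp
    ring
  have hFint : IntegrableOn F (Set.Ioi 0) := ((h1.const_mul _).add (h0.const_mul _)).neg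
  have hlim := tendsto_zero_of_hasDerivAt_of_integrableOn_Ioi (fun u _ => hderiv u) h1 hFint
  rw [integral_Ioi_of_hasDerivAt_of_tendsto' (fun u _ => hderiv u) h1 hlim, hF]
  simp

lemma max_mul_cexp_eq_indicator (s : ℂ) : (fun u : ℝ => ((max u 0 : ℝ) : ℂ) * cexp (-(s * u))) =
    (Set.Ioi (0 : ℝ)).indicator (fun u : ℝ => (u : ℂ) * cexp (-s * u)) := by
  ext u
  by_cases hu : 0 < u
  · rw [Set.indicator_of_mem (Set.mem_Ioi.2 hu), max_eq_left hu.le, neg_mul]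
  · rw [Set.indicator_of_notMem (by simpa using hu), max_eq_right (not_lt.1 hu)]
    simp

lemma integral_max_mul_cexp_zero {s : ℂ} (hs : 0 < s.re) :
    ∫ u : ℝ, ((max u 0 : ℝ) : ℂ) * cexp (-(s * u)) = 1 / s ^ 2 := by
  rw [max_mul_cexp_eq_indicator, integral_indicator measurableSet_Ioi, integral_mul_cexp_Ioi hs]

lemma integrable_max_mul_cexp_zero {s : ℂ} (hs : 0 < s.re) :
    Integrable (fun u : ℝ => ((max u 0 : ℝ) : ℂ) * cexp (-(s * u))) := by
  rw [max_mul_cexp_eq_indicator, integrable_indicator_iff measurableSet_Ioi]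
  exact integrableOn_mul_cexp hs

lemma max_mul_cexp_eq (s : ℂ) (a u : ℝ) :
    ((max (u - a) 0 : ℝ) : ℂ) * cexp (-(s * u)) =
      cexp (-(s * a)) * (((max (u - a) 0 : ℝ) : ℂ) * cexp (-(s * (u - a : ℝ)))) := by
  rw [mul_left_comm, ← Complex.exp_add]
  congr 2
  push_cast; ring

lemma integrable_max_mul_cexp {s : ℂ} (hs : 0 < s.re) (a : ℝ) :
    Integrable (fun u : ℝ => ((max (u - a) 0 : ℝ) : ℂ) * cexp (-(s * u))) := by
  simp_rw [max_mul_cexp_eq s a]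
  exact ((integrable_max_mul_cexp_zero hs).comp_sub_right a).const_mul _

lemma integral_max_mul_cexp {s : ℂ} (hs : 0 < s.re) (a : ℝ) :
    ∫ u : ℝ, ((max (u - a) 0 : ℝ) : ℂ) * cexp (-(s * u)) = cexp (-(s * a)) / s ^ 2 := by
  simp_rw [max_mul_cexp_eq s a]
  rw [integral_const_mul]
  have := integral_sub_right_eq_self (μ := volume)
    (fun u : ℝ => ((max u 0 : ℝ) : ℂ) * cexp (-(s * u))) a
  rw [this, integral_max_mul_cexp_zero hs]
  ring

lemma norm_max_mul_cexp (s : ℂ) (a u : ℝ) :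
    ‖((max (u - a) 0 : ℝ) : ℂ) * cexp (-(s * u))‖ = max (u - a) 0 * Real.exp (-(s.re * u)) := by
  rw [norm_mul, norm_real, Real.norm_of_nonneg (le_max_right _ _), Complex.norm_exp]
  simp

lemma integral_norm_max_mul_cexp {s : ℂ} (hs : 0 < s.re) (a : ℝ) :
    ∫ u : ℝ, ‖((max (u - a) 0 : ℝ) : ℂ) * cexp (-(s * u))‖ = Real.exp (-(s.re * a)) / s.re ^ 2 := by
  simp_rw [norm_max_mul_cexp]
  have h := integral_max_mul_cexp (s := (s.re : ℂ)) (by simpa using hs) a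
  have h1 : ∀ u : ℝ, ((max (u - a) 0 : ℝ) : ℂ) * cexp (-((s.re : ℂ) * u)) =
      ((max (u - a) 0 * Real.exp (-(s.re * u)) : ℝ) : ℂ) := by intro u; push_cast; rfl
  simp_rw [h1] at h
  rw [integral_complex_ofReal] at h
  exact_mod_cast h

/-- The integral of `u ↦ ψ(e^u)`, as a sum. -/
def psiInt (u : ℝ) : ℝ :=
  ∑ n ∈ Finset.Ioc 0 ⌊Real.exp u⌋₊, ArithmeticFunction.vonMangoldt n * (u - Real.log n)

lemma psiInt_eq_sum {u : ℝ} {N : ℕ} (hN : ⌊Real.exp u⌋₊ ≤ N) :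
    psiInt u = ∑ n ∈ Finset.Ioc 0 N, ArithmeticFunction.vonMangoldt n * max (u - Real.log n) 0 := by
  have hsub : Finset.Ioc 0 ⌊Real.exp u⌋₊ ⊆ Finset.Ioc 0 N := Finset.Ioc_subset_Ioc_right hN
  rw [← Finset.sum_subset hsub, psiInt]
  · refine Finset.sum_congr rfl fun n hn => ?_
    rw [Finset.mem_Ioc, Nat.le_floor_iff (Real.exp_nonneg u)] at hn
    have : Real.log n ≤ u := by
      rw [Real.log_le_iff_le_exp (by exact_mod_cast hn.1)]; exact hn.2
    rw [max_eq_left (by linarith)]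
  · intro n hn hn'
    simp only [Finset.mem_Ioc, Nat.le_floor_iff (Real.exp_nonneg u)] at hn hn'
    have h1 : Real.exp u < n := by by_contra! h; exact hn' ⟨hn.1, h⟩
    have : u < Real.log n := by
      rw [Real.lt_log_iff_exp_lt (by exact_mod_cast hn.1)]; exact h1
    rw [max_eq_right (by linarith), mul_zero]

lemma hasSum_psiInt (u : ℝ) : HasSum
    (fun n : ℕ => ArithmeticFunction.vonMangoldt n * max (u - Real.log n) 0) (psiInt u) := by
  rw [psiInt_eq_sum le_rfl]
  refine hasSum_sum_of_ne_finset_zero fun n hn => ?_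
  simp only [Finset.mem_Ioc, Nat.le_floor_iff (Real.exp_nonneg u), not_and, not_le] at hn
  rcases Nat.eq_zero_or_pos n with rfl | h0
  · simp
  · have : u < Real.log n := by
      rw [Real.lt_log_iff_exp_lt (by exact_mod_cast h0)]; exact hn h0
    rw [max_eq_right (by linarith), mul_zero]

lemma continuous_psiInt : Continuous psiInt := by
  rw [continuous_iff_continuousAt]
  intro u₀
  have h : psiInt =ᶠ[𝓝 u₀] fun u => ∑ n ∈ Finset.Ioc 0 ⌊Real.exp (u₀ + 1)⌋₊,
      ArithmeticFunction.vonMangoldt n * max (u - Real.log n) 0 := by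
    filter_upwards [Iio_mem_nhds (lt_add_one u₀)] with u hu
    exact psiInt_eq_sum (Nat.floor_le_floor (Real.exp_le_exp.2 (le_of_lt hu)))
  refine ContinuousAt.congr ?_ h.symm
  fun_prop

lemma psiInt_of_nonpos {u : ℝ} (hu : u ≤ 0) : psiInt u = 0 := by
  have h1 : ⌊Real.exp u⌋₊ ≤ 1 := by
    have : Real.exp u ≤ 1 := Real.exp_le_one_iff.2 hu
    calc ⌊Real.exp u⌋₊ ≤ ⌊(1 : ℝ)⌋₊ := Nat.floor_le_floor this
      _ = 1 := by simp
  rw [psiInt_eq_sum h1]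
  simp

lemma psiInt_nonneg (u : ℝ) : 0 ≤ psiInt u :=
  (hasSum_psiInt u).nonneg fun _ =>
    mul_nonneg ArithmeticFunction.vonMangoldt_nonneg (le_max_right _ _)

lemma psiInt_le {u : ℝ} (hu : 0 ≤ u) : psiInt u ≤ 6 * u * Real.exp u := by
  calc psiInt u ≤ ∑ n ∈ Finset.Ioc 0 ⌊Real.exp u⌋₊, ArithmeticFunction.vonMangoldt n * u := by
        refine Finset.sum_le_sum fun n _ => ?_
        refine mul_le_mul_of_nonneg_left ?_ ArithmeticFunction.vonMangoldt_nonneg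
        linarith [Real.log_natCast_nonneg n]
    _ = Chebyshev.psi (Real.exp u) * u := by rw [← Finset.sum_mul]; rfl
    _ ≤ ((Real.log 4 + 4) * Real.exp u) * u := by
      gcongr; exact Chebyshev.psi_le_const_mul_self (Real.exp_nonneg u)
    _ ≤ (6 * Real.exp u) * u := by
      have : Real.log 4 ≤ 2 := by
        rw [show (4 : ℝ) = 2 ^ 2 by norm_num, Real.log_pow]
        have := Real.log_two_lt_d9
        push_cast; linarith
      gcongr; linarith
    _ = _ := by ring

/-- The difference between `psiInt` and its main term. -/
def psiErr (u : ℝ) : ℝ := psiInt u - max (Real.exp u - 1) 0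

lemma continuous_psiErr : Continuous psiErr := by
  unfold psiErr
  have := continuous_psiInt
  fun_prop

lemma psiErr_of_nonpos {u : ℝ} (hu : u ≤ 0) : psiErr u = 0 := by
  rw [psiErr, psiInt_of_nonpos hu, max_eq_right (by linarith [Real.exp_le_one_iff.2 hu]), sub_zero]

lemma abs_psiErr_le {u : ℝ} (hu : 0 ≤ u) : |psiErr u| ≤ 6 * (1 + u) * Real.exp u := by
  have h1 := psiInt_nonneg u
  have h2 := psiInt_le hu
  have h3 : 1 ≤ Real.exp u := Real.one_le_exp hu
  rw [psiErr, max_eq_left (by linarith), abs_le]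
  constructor <;> nlinarith

lemma exists_pow_mul_exp_le (m : ℕ) {ε : ℝ} (hε : 0 < ε) : ∃ K : ℝ, 0 < K ∧ ∀ u : ℝ, 0 ≤ u →
    (1 + u) ^ m ≤ K * Real.exp (ε * u) := by
  refine ⟨Real.exp ε * m.factorial / ε ^ m, by positivity, fun u hu => ?_⟩
  have h := Real.pow_div_factorial_le_exp (ε * (1 + u)) (by positivity) m
  rw [div_le_iff₀ (by positivity), mul_pow, mul_add, mul_one, Real.exp_add] at h
  rw [div_mul_eq_mul_div, le_div_iff₀ (by positivity)]
  linarith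

/-- The damped error term whose Fourier transform is `zetaKernel` on a vertical line. -/
def dampedErr (σ u : ℝ) : ℂ := ((psiErr u * Real.exp (-(σ * u)) : ℝ) : ℂ)

lemma continuous_dampedErr (σ : ℝ) : Continuous (dampedErr σ) := by
  have := continuous_psiErr
  unfold dampedErr
  fun_prop

lemma norm_dampedErr (σ u : ℝ) : ‖dampedErr σ u‖ = |psiErr u| * Real.exp (-(σ * u)) := by
  rw [dampedErr, norm_real, norm_mul, Real.norm_of_nonneg (Real.exp_nonneg _), Real.norm_eq_abs]

lemma integrable_pow_smul_dampedErr {σ : ℝ} (hσ : 1 < σ) (m : ℕ) :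
    Integrable (fun u : ℝ => u ^ m • dampedErr σ u) := by
  set ε := (σ - 1) / 2 with hε
  have hε0 : 0 < ε := by rw [hε]; linarith
  obtain ⟨K, hK, h⟩ := exists_pow_mul_exp_le (m + 1) hε0
  have hg : Integrable ((Set.Ioi (0 : ℝ)).indicator fun u => 6 * K * Real.exp (-ε * u)) := by
    rw [integrable_indicator_iff measurableSet_Ioi]
    exact (exp_neg_integrableOn_Ioi 0 hε0).const_mul _
  refine hg.mono' ?_ (Eventually.of_forall fun u => ?_)
  · have := continuous_dampedErr σ
    exact (by fun_prop : Continuous _).aestronglyMeasurable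
  · by_cases hu : 0 < u
    · rw [Set.indicator_of_mem (Set.mem_Ioi.2 hu), norm_smul, norm_dampedErr, norm_pow,
        Real.norm_of_nonneg hu.le]
      calc u ^ m * (|psiErr u| * Real.exp (-(σ * u)))
          ≤ (1 + u) ^ m * ((6 * (1 + u) * Real.exp u) * Real.exp (-(σ * u))) := by
            gcongr
            · linarith
            · exact abs_psiErr_le hu.le
        _ = 6 * (1 + u) ^ (m + 1) * (Real.exp u * Real.exp (-(σ * u))) := by ring
        _ ≤ 6 * (K * Real.exp (ε * u)) * (Real.exp u * Real.exp (-(σ * u))) := by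
            gcongr; exact h u hu.le
        _ = 6 * K * (Real.exp (ε * u) * (Real.exp u * Real.exp (-(σ * u)))) := by ring
        _ = 6 * K * Real.exp (-ε * u) := by
            rw [← Real.exp_add, ← Real.exp_add, hε]; congr 2; ring
    · rw [Set.indicator_of_notMem (by simpa using hu), norm_smul, norm_dampedErr,
        psiErr_of_nonpos (not_lt.1 hu)]
      simp

end HarmanKumchev

namespace HarmanKumchev

open Complex Filter Topology FourierTransform

lemma vonMangoldt_mul_cexp_log (s : ℂ) (n : ℕ) :
    (ArithmeticFunction.vonMangoldt n : ℂ) * cexp (-(s * Real.log n)) =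
      LSeries.term (fun n => (ArithmeticFunction.vonMangoldt n : ℂ)) s n := by
  rcases eq_or_ne n 0 with rfl | hn
  · simp
  · rw [LSeries.term_of_ne_zero hn, Complex.cpow_def_of_ne_zero (by exact_mod_cast hn),
      ← natCast_log, Complex.exp_neg, mul_comm s, div_eq_mul_inv]

lemma hasSum_ofReal_psiInt_mul_cexp (s : ℂ) (u : ℝ) : HasSum
    (fun n : ℕ => (ArithmeticFunction.vonMangoldt n : ℂ) *
      (((max (u - Real.log n) 0 : ℝ) : ℂ) * cexp (-(s * u))))
    ((psiInt u : ℂ) * cexp (-(s * u))) := by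
  have h := (Complex.hasSum_ofReal.2 (hasSum_psiInt u)).mul_right (cexp (-(s * u)))
  refine h.congr_fun fun n => ?_
  push_cast
  ring

lemma integral_psiInt_mul_cexp {s : ℂ} (hs : 1 < s.re) :
    ∫ u : ℝ, (psiInt u : ℂ) * cexp (-(s * u)) =
      -deriv riemannZeta s / riemannZeta s / s ^ 2 := by
  have hs0 : 0 < s.re := by linarith
  have hsum := ArithmeticFunction.LSeriesSummable_vonMangoldt hs
  have h := hasSum_integral_of_summable_integral_norm (μ := volume)
    (F := fun (n : ℕ) (u : ℝ) => (ArithmeticFunction.vonMangoldt n : ℂ) *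
      (((max (u - Real.log n) 0 : ℝ) : ℂ) * cexp (-(s * u))))
    (fun n => (integrable_max_mul_cexp hs0 _).const_mul _) ?_
  · simp_rw [(hasSum_ofReal_psiInt_mul_cexp s _).tsum_eq, integral_const_mul,
      integral_max_mul_cexp hs0, ← mul_div_assoc, vonMangoldt_mul_cexp_log] at h
    rw [← ArithmeticFunction.LSeries_vonMangoldt_eq_deriv_riemannZeta_div hs]
    exact h.unique (hsum.hasSum.div_const _)
  · refine (hsum.norm.div_const (s.re ^ 2)).congr fun n => ?_
    simp_rw [norm_mul (ArithmeticFunction.vonMangoldt n : ℂ)]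
    rw [integral_const_mul, integral_norm_max_mul_cexp hs0, ← vonMangoldt_mul_cexp_log, norm_mul,
      Complex.norm_exp, mul_div_assoc]
    rw [neg_re, re_mul_ofReal]

lemma max_exp_sub_one_mul_cexp_eq_indicator (s : ℂ) :
    (fun u : ℝ => ((max (Real.exp u - 1) 0 : ℝ) : ℂ) * cexp (-(s * u))) =
    (Set.Ioi (0 : ℝ)).indicator (fun u : ℝ => cexp ((1 - s) * u) - cexp (-s * u)) := by
  ext u
  by_cases hu : 0 < u
  · have : 1 ≤ Real.exp u := Real.one_le_exp hu.le
    rw [Set.indicator_of_mem (Set.mem_Ioi.2 hu), max_eq_left (by linarith)]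
    push_cast
    rw [sub_mul, ← Complex.exp_add]
    ring_nf
  · rw [Set.indicator_of_notMem (by simpa using hu),
      max_eq_right (by linarith [Real.exp_le_one_iff.2 (not_lt.1 hu)])]
    simp

lemma integrable_max_exp_sub_one_mul_cexp {s : ℂ} (hs : 1 < s.re) :
    Integrable fun u : ℝ => ((max (Real.exp u - 1) 0 : ℝ) : ℂ) * cexp (-(s * u)) := by
  rw [max_exp_sub_one_mul_cexp_eq_indicator, integrable_indicator_iff measurableSet_Ioi]
  exact (integrableOn_exp_mul_complex_Ioi (by simpa using hs) 0).sub
    (integrableOn_exp_mul_complex_Ioi (by simp; linarith) 0)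

lemma integral_max_exp_sub_one_mul_cexp {s : ℂ} (hs : 1 < s.re) :
    ∫ u : ℝ, ((max (Real.exp u - 1) 0 : ℝ) : ℂ) * cexp (-(s * u)) = 1 / (s * (s - 1)) := by
  have h1 : (1 - s).re < 0 := by simpa using hs
  have h2 : (-s).re < 0 := by simp; linarith
  have hs0 : s ≠ 0 := by rintro rfl; norm_num at hs
  have hs1 : s - 1 ≠ 0 := by
    intro h; rw [sub_eq_zero] at h; rw [h] at hs; norm_num at hs
  have hs2 : 1 - s ≠ 0 := by rw [← neg_sub]; exact neg_ne_zero.2 hs1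
  rw [max_exp_sub_one_mul_cexp_eq_indicator, integral_indicator measurableSet_Ioi,
    integral_sub (integrableOn_exp_mul_complex_Ioi h1 0) (integrableOn_exp_mul_complex_Ioi h2 0),
    integral_exp_mul_complex_Ioi h1, integral_exp_mul_complex_Ioi h2]
  simp only [ofReal_zero, mul_zero, Complex.exp_zero]
  rw [← neg_sub s 1]
  field_simp
  ring

lemma fourier_dampedErr {σ : ℝ} (hσ : 1 < σ) (ξ : ℝ) :
    𝓕 (dampedErr σ) ξ = zetaKernel (σ + 2 * Real.pi * I * ξ) := by
  set s : ℂ := σ + 2 * Real.pi * I * ξ with hs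
  have hre : s.re = σ := by simp [hs]
  have hs1 : 1 < s.re := by rw [hre]; exact hσ
  have hζ := riemannZeta_ne_zero_of_one_le_re hs1.le
  have hs0 : s ≠ 0 := by rintro h; rw [h] at hs1; norm_num at hs1
  have hne : s ≠ 1 := by rintro h; rw [h] at hs1; norm_num at hs1
  have hne' : s - 1 ≠ 0 := sub_ne_zero.2 hne
  have h1 : ∀ u : ℝ, cexp (↑(-2 * Real.pi * u * ξ) * I) • dampedErr σ u =
      (psiInt u : ℂ) * cexp (-(s * u)) -
        ((max (Real.exp u - 1) 0 : ℝ) : ℂ) * cexp (-(s * u)) := by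
    intro u
    rw [← sub_mul, ← ofReal_sub, ← psiErr, dampedErr, smul_eq_mul, ofReal_mul (psiErr u),
      ofReal_exp,       mul_left_comm, ← Complex.exp_add, hs]
    congr 2
    push_cast
    ring
  have hd : Integrable (dampedErr σ) := by simpa using integrable_pow_smul_dampedErr hσ 0
  have h2 := integrable_max_exp_sub_one_mul_cexp hs1
  have h3 : Integrable fun u : ℝ => (psiInt u : ℂ) * cexp (-(s * u)) := by
    have h4 : Integrable fun u : ℝ => cexp (↑(-2 * Real.pi * u * ξ) * I) • dampedErr σ u := by
      refine hd.norm.mono' ?_ (Eventually.of_forall fun u => ?_)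
      · have := continuous_dampedErr σ
        exact (by fun_prop : Continuous _).aestronglyMeasurable
      · rw [norm_smul, norm_exp_ofReal_mul_I, one_mul]
    have h5 := h4.add h2
    refine h5.congr (Eventually.of_forall fun u => ?_)
    simp only [Pi.add_apply, h1]
    ring
  rw [Real.fourier_real_eq_integral_exp_smul]
  simp_rw [h1]
  rw [integral_sub h3 h2, integral_psiInt_mul_cexp hs1, integral_max_exp_sub_one_mul_cexp hs1,
    zetaKernel, logDeriv_riemannZeta₁ hne hζ]
  field_simp
  ring

lemma hasDerivAt_comp_vertical {g : ℂ → ℂ} {σ ξ : ℝ}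
    (hg : DifferentiableAt ℂ g (σ + 2 * Real.pi * I * ξ)) :
    HasDerivAt (fun x : ℝ => g (σ + 2 * Real.pi * I * x))
      (deriv g (σ + 2 * Real.pi * I * ξ) * (2 * Real.pi * I)) ξ := by
  have h : HasDerivAt (fun x : ℝ => (σ + 2 * Real.pi * I * x : ℂ)) (2 * Real.pi * I) ξ := by
    have := (((hasDerivAt_id ξ).ofReal_comp).const_mul (2 * Real.pi * I : ℂ)).const_add (σ : ℂ)
    simpa using this
  exact hg.hasDerivAt.comp ξ h

lemma fourier_sq_smul_dampedErr {σ : ℝ} (hσ : 1 < σ) (ξ : ℝ) :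
    𝓕 (fun u : ℝ => u ^ 2 • dampedErr σ u) ξ =
      iteratedDeriv 2 zetaKernel (σ + 2 * Real.pi * I * ξ) := by
  have h0 : Integrable (dampedErr σ) := by simpa using integrable_pow_smul_dampedErr hσ 0
  have han : ∀ x : ℝ, AnalyticAt ℂ zetaKernel (σ + 2 * Real.pi * I * x) := by
    intro x
    have hre : (σ + 2 * Real.pi * I * x : ℂ).re = σ := by simp
    refine analyticAt_zetaKernel ?_ (Or.inl (riemannZeta_ne_zero_of_one_le_re ?_))
    · intro h; rw [h] at hre; simp at hre; linarith
    · rw [hre]; linarith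
  have h1 := Real.iteratedDeriv_fourier (f := dampedErr σ) (N := ⊤) (n := 2)
    (fun n _ => integrable_pow_smul_dampedErr hσ n) le_top
  have h2 : (fun x : ℝ => (-2 * (Real.pi : ℂ) * I * x) ^ 2 • dampedErr σ x) =
      fun x : ℝ => (2 * (Real.pi : ℂ) * I) ^ 2 • (x ^ 2 • dampedErr σ x) := by
    ext x
    simp only [smul_eq_mul, real_smul]
    push_cast
    ring
  rw [h2] at h1
  have h3 : 𝓕 (fun x : ℝ => (2 * (Real.pi : ℂ) * I) ^ 2 • (x ^ 2 • dampedErr σ x)) ξ =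
      (2 * (Real.pi : ℂ) * I) ^ 2 * 𝓕 (fun u : ℝ => u ^ 2 • dampedErr σ u) ξ := by
    rw [Real.fourier_real_eq_integral_exp_smul, Real.fourier_real_eq_integral_exp_smul,
      ← integral_const_mul]
    refine integral_congr_ae (Eventually.of_forall fun x => ?_)
    simp only [smul_eq_mul]
    ring
  have h4 : iteratedDeriv 2 (𝓕 (dampedErr σ)) ξ =
      (2 * (Real.pi : ℂ) * I) ^ 2 * iteratedDeriv 2 zetaKernel (σ + 2 * Real.pi * I * ξ) := by
    have h5 : 𝓕 (dampedErr σ) = fun ξ : ℝ => zetaKernel (σ + 2 * Real.pi * I * ξ) :=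
      funext (fourier_dampedErr hσ)
    have h6 : deriv (fun ξ : ℝ => zetaKernel (σ + 2 * Real.pi * I * ξ)) =
        fun ξ : ℝ => deriv zetaKernel (σ + 2 * Real.pi * I * ξ) * (2 * Real.pi * I) :=
      funext fun x => (hasDerivAt_comp_vertical (han x).differentiableAt).deriv
    rw [h5, iteratedDeriv_succ, iteratedDeriv_one, h6,
      ((hasDerivAt_comp_vertical (han ξ).deriv.differentiableAt).mul_const _).deriv,
      iteratedDeriv_succ, iteratedDeriv_one]
    ring
  rw [h1, h3] at h4
  have h7 : (2 * (Real.pi : ℂ) * I) ^ 2 ≠ 0 := by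
    have := Real.pi_ne_zero
    simp [this]
  exact mul_left_cancel₀ h7 h4

lemma exists_sq_mul_norm_dampedErr_le : ∃ C : ℝ, 0 < C ∧ ∀ σ : ℝ, 1 < σ → σ ≤ 5 / 4 → ∀ u : ℝ,
    u ^ 2 * ‖dampedErr σ u‖ ≤ C := by
  obtain ⟨C, hC, h⟩ := exists_norm_iteratedDeriv_zetaKernel_le
  set M : ℝ := ∫ ξ : ℝ, C * (1 + ‖ξ‖) ^ (-(3 / 2) : ℝ) with hM
  have hint : Integrable fun ξ : ℝ => C * (1 + ‖ξ‖) ^ (-(3 / 2) : ℝ) :=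
    (integrable_one_add_norm (E := ℝ) (r := 3 / 2) (by norm_num)).const_mul C
  have hM0 : 0 ≤ M := integral_nonneg fun ξ => by positivity
  refine ⟨M + 1, by linarith, fun σ hσ1 hσ2 u => ?_⟩
  set f : ℝ → ℂ := fun u : ℝ => u ^ 2 • dampedErr σ u with hf
  have hfint : Integrable f := integrable_pow_smul_dampedErr hσ1 2
  have hfcont : Continuous f := by
    have := continuous_dampedErr σ
    fun_prop
  have hbound : ∀ ξ : ℝ, ‖𝓕 f ξ‖ ≤ C * (1 + ‖ξ‖) ^ (-(3 / 2) : ℝ) := by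
    intro ξ
    rw [hf, fourier_sq_smul_dampedErr hσ1]
    have hre : (σ + 2 * Real.pi * I * ξ : ℂ).re = σ := by simp
    have him : (σ + 2 * Real.pi * I * ξ : ℂ).im = 2 * Real.pi * ξ := by simp
    refine (h _ (by rw [hre]; linarith) (by rw [hre]; exact hσ2)).trans ?_
    rw [him, Real.norm_eq_abs]
    refine mul_le_mul_of_nonneg_left (Real.rpow_le_rpow_of_nonpos (by positivity) ?_
      (by norm_num)) hC.le
    rw [abs_mul, abs_of_pos (by positivity : (0 : ℝ) < 2 * Real.pi)]
    have := Real.pi_gt_three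
    have := abs_nonneg ξ
    nlinarith
  have hFint : Integrable (𝓕 f) := by
    refine hint.mono' ?_ (Eventually.of_forall hbound)
    exact (VectorFourier.fourierIntegral_continuous Real.continuous_fourierChar
      (by exact continuous_inner) hfint).aestronglyMeasurable
  have hinv := congrFun (hfcont.fourierInv_fourier_eq hfint hFint) u
  have h1 : ‖f u‖ ≤ M := by
    rw [← hinv]
    calc ‖𝓕⁻ (𝓕 f) u‖ ≤ ∫ ξ : ℝ, ‖𝓕 f ξ‖ :=
          VectorFourier.norm_fourierIntegral_le_integral_norm _ _ _ _ _
      _ ≤ M := integral_mono hFint.norm hint hbound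
  have h2 : ‖f u‖ = u ^ 2 * ‖dampedErr σ u‖ := by
    rw [hf, norm_smul, norm_pow, Real.norm_eq_abs, sq_abs]
  linarith

lemma exists_abs_psiErr_le : ∃ C : ℝ, 0 < C ∧ ∀ u : ℝ, 4 ≤ u →
    |psiErr u| ≤ C * Real.exp u / u ^ 2 := by
  obtain ⟨C, hC, h⟩ := exists_sq_mul_norm_dampedErr_le
  refine ⟨C * Real.exp 1, by positivity, fun u hu => ?_⟩
  have hu0 : 0 < u := by linarith
  have h1 := h (1 + 1 / u) (by have : 0 < 1 / u := by positivity
                               linarith) (by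
    have : 1 / u ≤ 1 / 4 := by gcongr
    linarith) u
  have h2 : (1 + 1 / u) * u = u + 1 := by field_simp
  rw [norm_dampedErr, h2, Real.exp_neg, Real.exp_add] at h1
  rw [le_div_iff₀ (by positivity)]
  have h3 : u ^ 2 * (|psiErr u| * (Real.exp u * Real.exp 1)⁻¹) =
      |psiErr u| * u ^ 2 / (Real.exp u * Real.exp 1) := by ring
  rw [h3, div_le_iff₀ (by positivity)] at h1
  linarith

end HarmanKumchev

namespace HarmanKumchev

lemma psiInt_add_sub_le {u h : ℝ} (hh : 0 ≤ h) :
    psiInt (u + h) - psiInt u ≤ h * Chebyshev.psi (Real.exp (u + h)) := by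
  rw [psiInt_eq_sum (u := u + h) le_rfl,
    psiInt_eq_sum (u := u) (Nat.floor_le_floor (Real.exp_le_exp.2 (by linarith : u ≤ u + h))),
    ← Finset.sum_sub_distrib, Chebyshev.psi, Finset.mul_sum]
  refine Finset.sum_le_sum fun n _ => ?_
  have h1 : max (u + h - Real.log n) 0 ≤ max (u - Real.log n) 0 + h :=
    max_le (by linarith [le_max_left (u - Real.log n) 0]) (by linarith [le_max_right (u - Real.log n) 0])
  have h2 : 0 ≤ ArithmeticFunction.vonMangoldt n := ArithmeticFunction.vonMangoldt_nonneg
  nlinarith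

lemma le_psiInt_add_sub {u h : ℝ} (hh : 0 ≤ h) :
    h * Chebyshev.psi (Real.exp u) ≤ psiInt (u + h) - psiInt u := by
  have hsub : Finset.Ioc 0 ⌊Real.exp u⌋₊ ⊆ Finset.Ioc 0 ⌊Real.exp (u + h)⌋₊ :=
    Finset.Ioc_subset_Ioc_right (Nat.floor_le_floor (Real.exp_le_exp.2 (by linarith)))
  have h1 : ∑ n ∈ Finset.Ioc 0 ⌊Real.exp u⌋₊,
      ArithmeticFunction.vonMangoldt n * (u + h - Real.log n) ≤ psiInt (u + h) := by
    refine Finset.sum_le_sum_of_subset_of_nonneg hsub fun n hn _ => ?_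
    rw [Finset.mem_Ioc, Nat.le_floor_iff (Real.exp_nonneg _)] at hn
    have : Real.log n ≤ u + h := by
      rw [Real.log_le_iff_le_exp (by exact_mod_cast hn.1)]; exact hn.2
    exact mul_nonneg ArithmeticFunction.vonMangoldt_nonneg (by linarith)
  have h2 : h * Chebyshev.psi (Real.exp u) + psiInt u = ∑ n ∈ Finset.Ioc 0 ⌊Real.exp u⌋₊,
      ArithmeticFunction.vonMangoldt n * (u + h - Real.log n) := by
    rw [Chebyshev.psi, psiInt, Finset.mul_sum, ← Finset.sum_add_distrib]
    exact Finset.sum_congr rfl fun n _ => by ring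
  linarith

lemma exists_abs_psi_exp_sub_le : ∃ C : ℝ, 0 < C ∧ ∀ u : ℝ, 5 ≤ u →
    |Chebyshev.psi (Real.exp u) - Real.exp u| ≤ C * Real.exp u / u := by
  obtain ⟨C, hC, h⟩ := exists_abs_psiErr_le
  refine ⟨1 + 5 * C, by positivity, fun u hu => ?_⟩
  have hu0 : 0 < u := by linarith
  set k : ℝ := 1 / u with hk
  have hk0 : 0 < k := by positivity
  have hk1 : k ≤ 1 / 5 := by rw [hk]; gcongr
  have hku : k * u = 1 := by rw [hk]; field_simp
  have key : ∀ v : ℝ, 4 ≤ v → |psiInt v - (Real.exp v - 1)| ≤ C * Real.exp v / v ^ 2 := by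
    intro v hv
    have := h v hv
    rwa [psiErr, max_eq_left (by linarith [Real.one_le_exp (by linarith : 0 ≤ v)])] at this
  set E := Real.exp u with hE
  have hE0 : 0 < E := Real.exp_pos u
  have e1 := abs_le.1 (Real.abs_exp_sub_one_sub_id_le (x := k) (by rw [abs_of_pos hk0]; linarith))
  have e2 := abs_le.1 (Real.abs_exp_sub_one_sub_id_le (x := -k)
    (by rw [abs_neg, abs_of_pos hk0]; linarith))
  have b0 := abs_le.1 (key u (by linarith))
  have b1 := abs_le.1 (key (u + k) (by linarith))
  have b2 := abs_le.1 (key (u - k) (by linarith))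
  have u1 := le_psiInt_add_sub (u := u) hk0.le
  have u2 := psiInt_add_sub_le (u := u - k) hk0.le
  rw [sub_add_cancel] at u2
  rw [Real.exp_add] at b1
  rw [sub_eq_add_neg u k, Real.exp_add, ← sub_eq_add_neg] at b2
  have c0 : C * E / u ^ 2 = C * E * k ^ 2 := by rw [hk]; field_simp
  have c1 : C * (E * Real.exp k) / (u + k) ^ 2 ≤ 2 * (C * E * k ^ 2) := by
    rw [← c0]
    calc C * (E * Real.exp k) / (u + k) ^ 2 ≤ C * (E * 2) / u ^ 2 := by
          gcongr
          · nlinarith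
          · linarith
      _ = _ := by ring
  have c2 : C * (E * Real.exp (-k)) / (u - k) ^ 2 ≤ 4 * (C * E * k ^ 2) := by
    rw [← c0]
    calc C * (E * Real.exp (-k)) / (u - k) ^ 2 ≤ C * (E * 1) / (u / 2) ^ 2 := by
          gcongr
          · exact Real.exp_le_one_iff.2 (by linarith)
          · linarith
      _ = _ := by field_simp; ring
  rw [c0] at b0
  rw [← hE] at b1 b2
  have f1 : k * Chebyshev.psi E ≤ k * (E * (1 + (1 + 5 * C) * k)) := by nlinarith
  have f2 : k * (E * (1 - (1 + 5 * C) * k)) ≤ k * Chebyshev.psi E := by nlinarith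
  have g1 := le_of_mul_le_mul_left f1 hk0
  have g2 := le_of_mul_le_mul_left f2 hk0
  have g3 : (1 + 5 * C) * E / u = (1 + 5 * C) * E * k := by rw [hk]; ring
  rw [g3, abs_le]
  constructor <;> nlinarith

/-- The prime number theorem with a logarithmic saving. -/
theorem exists_abs_theta_sub_le : ∃ C : ℝ, 0 < C ∧ ∀ x : ℝ, 2 ≤ x →
    |Chebyshev.theta x - x| ≤ C * x / Real.log x := by
  obtain ⟨C, hC, h⟩ := exists_abs_psi_exp_sub_le
  refine ⟨C + 32 + 5, by positivity, fun x hx => ?_⟩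
  have hx0 : 0 < x := by linarith
  have hlog : 0 < Real.log x := Real.log_pos (by linarith)
  rw [le_div_iff₀ hlog]
  rcases le_total 5 (Real.log x) with hl | hl
  · have h1 := h (Real.log x) hl
    rw [Real.exp_log hx0, le_div_iff₀ hlog] at h1
    have h2 := Chebyshev.abs_psi_sub_theta_le_sqrt_mul_log (x := x) (by linarith)
    have h3 : Real.log x ≤ 4 * x ^ (1 / 4 : ℝ) := by
      have := Real.log_le_rpow_div hx0.le (ε := 1 / 4) (by norm_num)
      linarith
    have h4 : √x * (x ^ (1 / 4 : ℝ)) ^ 2 = x := by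
      rw [Real.sqrt_eq_rpow, ← Real.rpow_natCast, ← Real.rpow_mul hx0.le, ← Real.rpow_add hx0]
      norm_num
    have h5 : 2 * √x * Real.log x * Real.log x ≤ 32 * x := by
      calc 2 * √x * Real.log x * Real.log x
          ≤ 2 * √x * (4 * x ^ (1 / 4 : ℝ)) * (4 * x ^ (1 / 4 : ℝ)) := by gcongr
        _ = 32 * (√x * (x ^ (1 / 4 : ℝ)) ^ 2) := by ring
        _ = 32 * x := by rw [h4]
    have h6 : |Chebyshev.theta x - x| ≤
        |Chebyshev.psi x - x| + |Chebyshev.psi x - Chebyshev.theta x| := by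
      have := abs_sub (Chebyshev.psi x - x) (Chebyshev.psi x - Chebyshev.theta x)
      refine le_trans (le_of_eq ?_) this
      congr 1
      ring
    nlinarith
  · have h1 := Chebyshev.theta_le_log4_mul_x hx0.le
    have h2 := Chebyshev.theta_nonneg x
    have h3 : Real.log 4 ≤ 2 := by
      rw [show (4 : ℝ) = 2 ^ 2 by norm_num, Real.log_pow]
      have := Real.log_two_lt_d9
      push_cast; linarith
    have h4 : |Chebyshev.theta x - x| ≤ x := by
      rw [abs_le]; constructor <;> nlinarith
    calc |Chebyshev.theta x - x| * Real.log x ≤ x * 5 := by gcongr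
      _ ≤ _ := by nlinarith

end HarmanKumchev

namespace HarmanKumchev

/-- `G` is bounded by `K` and Lipschitz with constant `K`. -/
structure BddLip (K : ℝ) (G : ℝ → ℝ) : Prop where
  bdd : ∀ s, |G s| ≤ K
  lip : ∀ s t, |G s - G t| ≤ K * |s - t|

lemma BddLip.nonneg {K : ℝ} {G : ℝ → ℝ} (h : BddLip K G) : 0 ≤ K :=
  (abs_nonneg _).trans (h.bdd 0)

lemma BddLip.continuous {K : ℝ} {G : ℝ → ℝ} (h : BddLip K G) : Continuous G :=
  (LipschitzWith.of_dist_le_mul (K := ⟨K, h.nonneg⟩) fun s t => by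
    rw [Real.dist_eq, Real.dist_eq]; exact h.lip s t).continuous

lemma BddLip.mul {K₁ K₂ : ℝ} {G₁ G₂ : ℝ → ℝ} (h₁ : BddLip K₁ G₁) (h₂ : BddLip K₂ G₂) :
    BddLip (2 * K₁ * K₂) fun s => G₁ s * G₂ s where
  bdd s := by
    have h := mul_le_mul (h₁.bdd s) (h₂.bdd s) (abs_nonneg _) h₁.nonneg
    have := mul_nonneg h₁.nonneg h₂.nonneg
    rw [abs_mul]; nlinarith
  lip s t := by
    have e : G₁ s * G₂ s - G₁ t * G₂ t = G₁ s * (G₂ s - G₂ t) + (G₁ s - G₁ t) * G₂ t := by ring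
    rw [e]
    refine (abs_add_le _ _).trans ?_
    rw [abs_mul, abs_mul]
    have a := mul_le_mul (h₁.bdd s) (h₂.lip s t) (abs_nonneg _) h₁.nonneg
    have b := mul_le_mul (h₁.lip s t) (h₂.bdd t) (abs_nonneg _)
      (mul_nonneg h₁.nonneg (abs_nonneg _))
    linarith

lemma BddLip.sub {K₁ K₂ : ℝ} {G₁ G₂ : ℝ → ℝ} (h₁ : BddLip K₁ G₁) (h₂ : BddLip K₂ G₂) :
    BddLip (K₁ + K₂) fun s => G₁ s - G₂ s where
  bdd s := (abs_sub _ _).trans (add_le_add (h₁.bdd s) (h₂.bdd s))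
  lip s t := by
    have e : G₁ s - G₂ s - (G₁ t - G₂ t) = (G₁ s - G₁ t) - (G₂ s - G₂ t) := by ring
    rw [e, add_mul]
    exact (abs_sub _ _).trans (add_le_add (h₁.lip s t) (h₂.lip s t))

lemma BddLip.comp {K₁ K₂ : ℝ} {G₁ G₂ : ℝ → ℝ} (h₁ : BddLip K₁ G₁)
    (h₂ : ∀ s t, |G₂ s - G₂ t| ≤ K₂ * |s - t|) : BddLip (K₁ * (1 + K₂)) fun s => G₁ (G₂ s) where
  bdd s := by
    have h := h₂ 1 0
    norm_num at h
    have : 0 ≤ K₂ := (abs_nonneg _).trans h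
    have := mul_nonneg h₁.nonneg this
    linarith [h₁.bdd (G₂ s)]
  lip s t := by
    have h := mul_le_mul_of_nonneg_left (h₂ s t) h₁.nonneg
    have := mul_nonneg h₁.nonneg (abs_nonneg (s - t))
    linarith [h₁.lip (G₂ s) (G₂ t)]

lemma BddLip.one : BddLip 1 fun _ => 1 where
  bdd s := by simp
  lip s t := by simp

lemma BddLip.inv {c K : ℝ} (hc : 0 < c) {g : ℝ → ℝ} (hg : ∀ s, c ≤ g s)
    (hlip : ∀ s t, |g s - g t| ≤ K * |s - t|) : BddLip (1 / c + K / c ^ 2) fun s => 1 / g s where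
  bdd s := by
    have hK : 0 ≤ K := by
      have := hlip 1 0
      norm_num at this
      exact (abs_nonneg _).trans this
    have h0 : 0 < g s := hc.trans_le (hg s)
    rw [abs_of_pos (by positivity)]
    have : 1 / g s ≤ 1 / c := by gcongr; exact hg s
    have : 0 ≤ K / c ^ 2 := by positivity
    linarith
  lip s t := by
    have hs : 0 < g s := hc.trans_le (hg s)
    have ht : 0 < g t := hc.trans_le (hg t)
    have e : 1 / g s - 1 / g t = -(g s - g t) / (g s * g t) := by field_simp; ring
    have h1 : |g s - g t| / (g s * g t) ≤ K * |s - t| / c ^ 2 := by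
      rw [sq]
      gcongr
      · exact (abs_nonneg _).trans (hlip s t)
      · exact hlip s t
      · exact hg s
      · exact hg t
    rw [e, abs_div, abs_neg, abs_of_pos (mul_pos hs ht), add_mul]
    have : 0 ≤ 1 / c * |s - t| := by positivity
    calc |g s - g t| / (g s * g t) ≤ K * |s - t| / c ^ 2 := h1
      _ = K / c ^ 2 * |s - t| := by ring
      _ ≤ _ := by linarith

/-- The error term in the prime number theorem at an integer. -/
def thetaErr (n : ℕ) : ℝ := Chebyshev.theta n - n

lemma thetaErr_succ_sub (n : ℕ) :
    thetaErr (n + 1) - thetaErr n = (if (n + 1).Prime then Real.log (n + 1 : ℕ) else 0) - 1 := by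
  unfold thetaErr Chebyshev.theta
  rw [Nat.floor_natCast, Nat.floor_natCast, Finset.sum_filter, Finset.sum_filter,
    Finset.sum_Ioc_succ_top (Nat.zero_le n)]
  push_cast
  ring

lemma exists_abs_thetaErr_le : ∃ C : ℝ, 1 ≤ C ∧ ∀ n : ℕ, 1 ≤ n →
    |thetaErr (n + 1)| ≤ C * (n + 1 : ℕ) / Real.log (n + 1 : ℕ) ∧
    |thetaErr n| ≤ C * (n + 1 : ℕ) / Real.log (n + 1 : ℕ) := by
  obtain ⟨C, hC, h⟩ := exists_abs_theta_sub_le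
  refine ⟨2 * C + 1, by linarith, fun n hn => ?_⟩
  have hn' : (1 : ℝ) ≤ n := by exact_mod_cast hn
  have hlog : 0 < Real.log (n + 1 : ℕ) := Real.log_pos (by push_cast; linarith)
  have key : C * (n + 1 : ℕ) / Real.log (n + 1 : ℕ) ≤
      (2 * C + 1) * (n + 1 : ℕ) / Real.log (n + 1 : ℕ) := by gcongr; linarith
  refine ⟨(h (n + 1 : ℕ) (by push_cast; linarith)).trans key, ?_⟩
  rcases hn.eq_or_lt with rfl | hn2
  · have h1 : Chebyshev.theta ((1 : ℕ) : ℝ) = 0 :=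
      Chebyshev.theta_eq_zero_of_lt_two (by norm_num)
    rw [thetaErr, h1, le_div_iff₀ hlog]
    have := Real.log_two_lt_d9
    norm_num
    nlinarith
  · have hn2' : (2 : ℝ) ≤ n := by exact_mod_cast hn2
    have hlogn : 0 < Real.log n := Real.log_pos (by linarith)
    have h1 := h n hn2'
    have h2 : Real.log (n + 1 : ℕ) ≤ 2 * Real.log n := by
      rw [← Real.log_rpow (by linarith)]
      refine Real.log_le_log (by positivity) ?_
      push_cast
      rw [Real.rpow_two]
      nlinarith
    have h3 : C * n / Real.log n ≤ 2 * C * (n + 1 : ℕ) / Real.log (n + 1 : ℕ) := by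
      rw [div_le_div_iff₀ hlogn hlog]
      calc C * n * Real.log (n + 1 : ℕ) ≤ C * (n + 1 : ℕ) * (2 * Real.log n) := by
            gcongr; linarith
        _ = _ := by ring
    refine (h1.trans h3).trans ?_
    gcongr; linarith

lemma log_succ_sub_log_le {n : ℕ} (hn : 0 < n) : Real.log (n + 1 : ℕ) - Real.log n ≤ 1 / n := by
  have h0 : (0 : ℝ) < n := by exact_mod_cast hn
  rw [← Real.log_div (by positivity) h0.ne']
  refine (Real.log_le_sub_one_of_pos (by positivity)).trans (le_of_eq ?_)
  push_cast
  field_simp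
  ring

lemma le_log_succ_sub_log {n : ℕ} (hn : 0 < n) :
    1 / ((n : ℝ) + 1) ≤ Real.log (n + 1 : ℕ) - Real.log n := by
  have h0 : (0 : ℝ) < n := by exact_mod_cast hn
  rw [← Real.log_div (by positivity) h0.ne']
  refine le_trans (le_of_eq ?_) (Real.one_sub_inv_le_log_of_pos (by positivity))
  push_cast
  field_simp
  ring

lemma sum_Ico_one_div_le {A B : ℕ} (hA : 2 ≤ A) (hAB : A ≤ B) :
    ∑ n ∈ Finset.Ico A B, (1 : ℝ) / n ≤ 1 + Real.log B := by
  have h : ∑ n ∈ Finset.Ico A B, (1 : ℝ) / n ≤ 1 + Real.log B - 1 / (B : ℝ) := by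
    induction B, hAB using Nat.le_induction with
    | base =>
      have h1 : (2 : ℝ) ≤ A := by exact_mod_cast hA
      have h2 : 1 / (A : ℝ) ≤ 1 := by rw [div_le_one (by linarith)]; linarith
      have := Real.log_nonneg (by linarith : (1 : ℝ) ≤ A)
      simp only [Finset.Ico_self, Finset.sum_empty]
      linarith
    | succ B hB ih =>
      rw [Finset.sum_Ico_succ_top hB]
      have := le_log_succ_sub_log (n := B) (by omega)
      push_cast at this ⊢
      linarith
  have : 0 ≤ 1 / (B : ℝ) := by positivity
  linarith

lemma abs_sub_integral_le {K L : ℝ} {G : ℝ → ℝ} (hG : BddLip K G) (hL : 0 < L) {n : ℕ}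
    (hn : 1 ≤ n) :
    |G (Real.log n / L) / n - L * ∫ t in (Real.log n / L)..(Real.log (n + 1 : ℕ) / L), G t| ≤
      K * (1 + 1 / L) / (n : ℝ) ^ 2 := by
  have hn0 : (0 : ℝ) < n := by exact_mod_cast hn
  set a := Real.log n / L with ha
  set b := Real.log (n + 1 : ℕ) / L with hb
  have h1 := log_succ_sub_log_le hn
  have h2 := le_log_succ_sub_log hn
  have hba : b - a = (Real.log (n + 1 : ℕ) - Real.log n) / L := by rw [ha, hb]; ring
  have hab : a ≤ b := by
    have : 0 ≤ b - a := by
      rw [hba]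
      refine div_nonneg (le_trans (by positivity) h2) hL.le
    linarith
  have hba' : b - a ≤ 1 / n / L := by rw [hba]; gcongr
  have hK := hG.nonneg
  have h3 : |∫ t in a..b, (G t - G a)| ≤ K * (1 / n / L) * |b - a| := by
    rw [← Real.norm_eq_abs]
    refine intervalIntegral.norm_integral_le_of_norm_le_const fun t ht => ?_
    rw [Set.uIoc_of_le hab] at ht
    rw [Real.norm_eq_abs]
    refine (hG.lip t a).trans ?_
    gcongr
    rw [abs_of_nonneg (by linarith [ht.1])]
    linarith [ht.2]
  have h4 : ∫ t in a..b, (G t - G a) = (∫ t in a..b, G t) - (b - a) * G a := by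
    rw [intervalIntegral.integral_sub (hG.continuous.intervalIntegrable _ _)
      (continuous_const.intervalIntegrable _ _), intervalIntegral.integral_const, smul_eq_mul]
  have h5 : G a / n - L * ∫ t in a..b, G t =
      G a * (1 / n - (Real.log (n + 1 : ℕ) - Real.log n)) - L * ∫ t in a..b, (G t - G a) := by
    rw [h4, hba]; field_simp; ring
  have h6 : |1 / (n : ℝ) - (Real.log (n + 1 : ℕ) - Real.log n)| ≤ 1 / (n : ℝ) ^ 2 := by
    rw [abs_of_nonneg (by linarith)]
    have : 1 / (n : ℝ) - 1 / ((n : ℝ) + 1) ≤ 1 / (n : ℝ) ^ 2 := by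
      rw [div_sub_div _ _ hn0.ne' (by positivity), div_le_div_iff₀ (by positivity) (by positivity)]
      nlinarith
    linarith
  rw [h5]
  calc _ ≤ |G a * (1 / n - (Real.log (n + 1 : ℕ) - Real.log n))| +
        |L * ∫ t in a..b, (G t - G a)| := abs_sub _ _
    _ ≤ K * (1 / (n : ℝ) ^ 2) + L * (K * (1 / n / L) * (1 / n / L)) := by
      rw [abs_mul, abs_mul, abs_of_pos hL]
      gcongr
      · exact hG.bdd a
      · refine h3.trans ?_
        rw [abs_of_nonneg (by linarith)]
        gcongr
    _ = _ := by field_simp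

lemma abs_sub_succ_le {K L : ℝ} {G : ℝ → ℝ} (hG : BddLip K G) (hL : 0 < L) {n : ℕ}
    (hn : 1 ≤ n) :
    |G (Real.log n / L) / n - G (Real.log (n + 1 : ℕ) / L) / (n + 1 : ℕ)| ≤
      K * (1 + 1 / L) / (n : ℝ) ^ 2 := by
  have hn0 : (0 : ℝ) < n := by exact_mod_cast hn
  set a := Real.log n / L with ha
  set b := Real.log (n + 1 : ℕ) / L with hb
  have h1 := log_succ_sub_log_le hn
  have h2 := le_log_succ_sub_log hn
  have hab : |a - b| ≤ 1 / n / L := by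
    rw [abs_sub_comm, ha, hb, ← sub_div, abs_div, abs_of_pos hL]
    gcongr
    rw [abs_of_nonneg (le_trans (by positivity) h2)]
    exact h1
  have hK := hG.nonneg
  have h5 : G a / n - G b / (n + 1 : ℕ) = (G a - G b) / n + G b * (1 / (n * (n + 1))) := by
    push_cast; field_simp; ring
  rw [h5]
  calc _ ≤ |(G a - G b) / n| + |G b * (1 / (n * (n + 1)))| := abs_add_le _ _
    _ ≤ K * (1 / n / L) / n + K * (1 / (n * n)) := by
      rw [abs_div, abs_of_pos hn0, abs_mul, abs_of_pos (by positivity : 0 < 1 / ((n : ℝ) * (n + 1)))]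
      gcongr
      · exact (hG.lip a b).trans (by gcongr)
      · exact hG.bdd b
      · linarith
    _ = _ := by field_simp; ring

end HarmanKumchev

namespace HarmanKumchev

lemma sum_prime_sub_integral_eq {K L : ℝ} {G : ℝ → ℝ} (hG : BddLip K G) {A B : ℕ} (hA : 2 ≤ A)
    (hAB : A ≤ B) :
    ∑ n ∈ Finset.Ico A B, G (Real.log n / L) / n * (if n.Prime then Real.log n else 0) -
        L * ∫ t in (Real.log A / L)..(Real.log B / L), G t =
      G (Real.log B / L) / B * thetaErr (B - 1) - G (Real.log A / L) / A * thetaErr (A - 1) +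
      ∑ n ∈ Finset.Ico A B,
        ((G (Real.log n / L) / n - G (Real.log (n + 1 : ℕ) / L) / (n + 1 : ℕ)) * thetaErr n +
        (G (Real.log n / L) / n -
          L * ∫ t in (Real.log n / L)..(Real.log (n + 1 : ℕ) / L), G t)) := by
  induction B, hAB using Nat.le_induction with
  | base => simp
  | succ B hB ih =>
    rw [Finset.sum_Ico_succ_top hB, Finset.sum_Ico_succ_top hB,
      ← intervalIntegral.integral_add_adjacent_intervals
        (hG.continuous.intervalIntegrable _ (Real.log B / L)) (hG.continuous.intervalIntegrable _ _)]
    have h := thetaErr_succ_sub (B - 1)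
    rw [Nat.sub_add_cancel (by omega)] at h
    have h' : (if B.Prime then Real.log B else 0) = 1 + thetaErr B - thetaErr (B - 1) := by linarith
    rw [Nat.add_sub_cancel, h']
    linear_combination ih

lemma exists_sum_prime_sub_integral_le : ∃ C : ℝ, 1 ≤ C ∧ ∀ (K L : ℝ) (G : ℝ → ℝ) (A B : ℕ),
    BddLip K G → 0 < L → 2 ≤ A → A ≤ B →
    |∑ n ∈ Finset.Ico A B, G (Real.log n / L) / n * (if n.Prime then Real.log n else 0) -
        L * ∫ t in (Real.log A / L)..(Real.log B / L), G t| ≤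
      4 * K * C + K * (1 + 1 / L) * (C + 1) * ((1 + Real.log B) / Real.log A) := by
  obtain ⟨C, hC, h⟩ := exists_abs_thetaErr_le
  refine ⟨C, hC, fun K L G A B hG hL hA hAB => ?_⟩
  have hK := hG.nonneg
  have hlog2 := Real.log_two_gt_d9
  have hlog : ∀ n : ℕ, 2 ≤ n → 1 / 2 ≤ Real.log n := fun n hn => by
    have : Real.log 2 ≤ Real.log n := Real.log_le_log (by norm_num) (by exact_mod_cast hn)
    linarith
  have hend : ∀ n : ℕ, 2 ≤ n → |G (Real.log n / L) / n * thetaErr (n - 1)| ≤ 2 * K * C := by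
    intro n hn
    have h1 := (h (n - 1) (by omega)).2
    rw [Nat.sub_add_cancel (by omega)] at h1
    have hn0 : (0 : ℝ) < n := by positivity
    have hl := hlog n hn
    calc _ ≤ K / n * (C * n / Real.log n) := by
          rw [abs_mul, abs_div, abs_of_pos hn0]
          gcongr
          exact hG.bdd _
      _ = K * C / Real.log n := by field_simp
      _ ≤ K * C / (1 / 2) := by gcongr
      _ = _ := by ring
  have hlogA : 0 < Real.log A := by linarith [hlog A hA]
  have hterm : ∀ n ∈ Finset.Ico A B,
      |(G (Real.log n / L) / n - G (Real.log (n + 1 : ℕ) / L) / (n + 1 : ℕ)) * thetaErr n +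
        (G (Real.log n / L) / n -
          L * ∫ t in (Real.log n / L)..(Real.log (n + 1 : ℕ) / L), G t)| ≤
      K * (1 + 1 / L) * (C + 1) / Real.log A * (1 / n) := by
    intro n hn
    rw [Finset.mem_Ico] at hn
    have h1 := (h (n - 1) (by omega)).1
    rw [Nat.sub_add_cancel (by omega)] at h1
    have hn0 : (0 : ℝ) < n := by have : 0 < n := by omega
                                 exact_mod_cast this
    have hAn : Real.log A ≤ Real.log n :=
      Real.log_le_log (by positivity) (by exact_mod_cast hn.1)
    have hln : 0 < Real.log n := by linarith
    have h2 : 1 ≤ (n : ℝ) / Real.log n := by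
      rw [one_le_div hln]; exact (Real.log_le_sub_one_of_pos hn0).trans (by linarith)
    refine (abs_add_le _ _).trans ?_
    rw [abs_mul]
    calc _ ≤ K * (1 + 1 / L) / (n : ℝ) ^ 2 * (C * n / Real.log n) +
          K * (1 + 1 / L) / (n : ℝ) ^ 2 * (n / Real.log n) := by
          refine add_le_add (mul_le_mul (abs_sub_succ_le hG hL (by omega)) h1 (abs_nonneg _)
            (by positivity)) ((abs_sub_integral_le hG hL (by omega)).trans ?_)
          exact le_mul_of_one_le_right (by positivity) h2
      _ = K * (1 + 1 / L) * (C + 1) / Real.log n * (1 / n) := by field_simp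
      _ ≤ _ := by gcongr
  rw [sum_prime_sub_integral_eq hG hA hAB]
  have hs := (Finset.abs_sum_le_sum_abs _ _).trans (Finset.sum_le_sum hterm)
  rw [← Finset.mul_sum] at hs
  have hs2 := hs.trans (mul_le_mul_of_nonneg_left (sum_Ico_one_div_le hA hAB) (by positivity))
  have e : K * (1 + 1 / L) * (C + 1) / Real.log A * (1 + Real.log B) =
    K * (1 + 1 / L) * (C + 1) * ((1 + Real.log B) / Real.log A) := by ring
  rw [e] at hs2
  have hA' := abs_le.1 (hend A hA)
  have hB' := abs_le.1 (hend B (by omega))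
  have hs3 := abs_le.1 hs2
  rw [abs_le]
  constructor <;> linarith [hA'.1, hA'.2, hB'.1, hB'.2, hs3.1, hs3.2]

/-- Partial summation over primes against the prime number theorem. -/
theorem exists_sum_prime_log_div_sub_le {c : ℝ} (hc : 0 < c) : ∃ C : ℝ, 0 < C ∧
    ∀ (K L α β : ℝ) (G : ℝ → ℝ) (A B : ℕ), BddLip K G → 1 / 2 ≤ L → 2 ≤ A → A ≤ B → β ≤ 1 →
    c * L ≤ Real.log A → |Real.log A - α * L| ≤ 1 → |Real.log B - β * L| ≤ 1 →
    |∑ p ∈ (Finset.Ico A B).filter Nat.Prime, G (Real.log p / L) * (Real.log p / p) -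
        L * ∫ t in α..β, G t| ≤ C * K := by
  obtain ⟨C, hC, h⟩ := exists_sum_prime_sub_integral_le
  refine ⟨4 * C + 3 * (C + 1) * (7 / c) + 2, by positivity,
    fun K L α β G A B hG hL hA hAB hβ hcA hlA hlB => ?_⟩
  have hL0 : 0 < L := by linarith
  have hK := hG.nonneg
  have h1 := h K L G A B hG hL0 hA hAB
  have hsum : ∑ p ∈ (Finset.Ico A B).filter Nat.Prime, G (Real.log p / L) * (Real.log p / p) =
      ∑ n ∈ Finset.Ico A B, G (Real.log n / L) / n * (if n.Prime then Real.log n else 0) := by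
    rw [Finset.sum_filter]
    refine Finset.sum_congr rfl fun n _ => ?_
    split_ifs
    · ring
    · simp
  have hint : ∀ (γ : ℝ) (D : ℕ), |Real.log D - γ * L| ≤ 1 →
      |L * ∫ t in γ..(Real.log D / L), G t| ≤ K := by
    intro γ D hD
    have hb : |∫ t in γ..(Real.log D / L), G t| ≤ K * |Real.log D / L - γ| := by
      rw [← Real.norm_eq_abs]
      exact intervalIntegral.norm_integral_le_of_norm_le_const fun t _ => hG.bdd t
    rw [abs_mul, abs_of_pos hL0]
    have e : |Real.log D / L - γ| = |Real.log D - γ * L| / L := by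
      rw [← abs_of_pos hL0, ← abs_div, abs_of_pos hL0]
      congr 1; field_simp
    rw [e] at hb
    calc _ ≤ L * (K * (|Real.log D - γ * L| / L)) := by gcongr
      _ = K * |Real.log D - γ * L| := by field_simp
      _ ≤ K * 1 := by gcongr
      _ = K := mul_one K
  have hii : ∀ a b : ℝ, IntervalIntegrable G volume a b :=
    fun a b => hG.continuous.intervalIntegrable a b
  have hsplit : ∫ t in α..β, G t = (∫ t in α..(Real.log A / L), G t) +
      (∫ t in (Real.log A / L)..(Real.log B / L), G t) - ∫ t in β..(Real.log B / L), G t := by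
    have h₁ := intervalIntegral.integral_add_adjacent_intervals (hii α (Real.log A / L))
      (hii (Real.log A / L) (Real.log B / L))
    have h₂ := intervalIntegral.integral_add_adjacent_intervals (hii α β) (hii β (Real.log B / L))
    linarith
  have hratio : (1 + Real.log B) / Real.log A ≤ 7 / c := by
    have hlA0 : 0 < Real.log A := lt_of_lt_of_le (by positivity) hcA
    rw [div_le_div_iff₀ hlA0 hc]
    have h₁ := (abs_le.1 hlB).2
    have h₂ : β * L ≤ 1 * L := by gcongr
    have h₃ : 1 + Real.log B ≤ 5 * L := by linarith
    have h₄ := mul_le_mul_of_nonneg_right h₃ hc.le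
    linarith
  have h2 : 1 + 1 / L ≤ 3 := by
    have : 1 / L ≤ 2 := by rw [div_le_iff₀ hL0]; linarith
    linarith
  have h3 : K * (1 + 1 / L) * (C + 1) * ((1 + Real.log B) / Real.log A) ≤
      K * 3 * (C + 1) * (7 / c) := by
    have : 0 ≤ 1 + 1 / L := by positivity
    gcongr
  have hA' := abs_le.1 (hint α A hlA)
  have hB' := abs_le.1 (hint β B hlB)
  have h1' := abs_le.1 h1
  rw [hsum, hsplit, mul_sub, mul_add, abs_le]
  constructor <;> linarith [h1'.1, h1'.2, hA'.1, hA'.2, hB'.1, hB'.2]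

end HarmanKumchev

namespace HarmanKumchev

lemma log_sq_le_mul_sqrt {Y : ℝ} (hY : 1 ≤ Y) : Real.log Y ^ 2 ≤ 16 * √Y := by
  have hl := Real.log_nonneg hY
  have h0 : 0 < √(√Y) := by positivity
  have h := (Real.log_le_sub_one_of_pos h0).trans (by linarith : _ ≤ √(√Y))
  rw [Real.log_sqrt (Real.sqrt_nonneg _), Real.log_sqrt (by linarith)] at h
  have h2 : Real.log Y ≤ 4 * √(√Y) := by linarith
  calc Real.log Y ^ 2 ≤ (4 * √(√Y)) ^ 2 := by gcongr
    _ = 16 * √Y := by rw [mul_pow, Real.sq_sqrt (Real.sqrt_nonneg _)]; norm_num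

lemma primeCounting_floor_le {x : ℝ} (hx : 0 ≤ x) : (Nat.primeCounting ⌊x⌋₊ : ℝ) ≤ x := by
  have h : Nat.primeCounting ⌊x⌋₊ ≤ ⌊x⌋₊ := by
    induction ⌊x⌋₊ with
    | zero => simp
    | succ n ih =>
      rw [Nat.primeCounting, Nat.primeCounting'] at ih ⊢
      rw [Nat.count_succ]
      split_ifs <;> omega
  exact le_trans (by exact_mod_cast h) (Nat.floor_le hx)

lemma exists_abs_primeCounting_sub_le : ∃ C : ℝ, 0 < C ∧ ∀ x : ℝ, 2 ≤ x →
    |(Nat.primeCounting ⌊x⌋₊ : ℝ) - x / Real.log x| ≤ C * x / Real.log x ^ 2 := by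
  obtain ⟨C₁, hC₁, h₁⟩ := exists_abs_theta_sub_le
  obtain ⟨C₂, hC₂, h₂⟩ := Chebyshev.primeCounting_sub_theta_div_log_isBigO.exists_pos
  obtain ⟨x₀, hx₀⟩ := Filter.eventually_atTop.1 h₂.bound
  set M := max x₀ 2 with hM
  have hlogM : 0 < Real.log M := Real.log_pos (by linarith [le_max_right x₀ 2])
  refine ⟨C₁ + C₂ + Real.log M ^ 2 + Real.log M, by positivity, fun x hx => ?_⟩
  have hlog : 0 < Real.log x := Real.log_pos (by linarith)
  have hx0 : 0 < x := by linarith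
  rcases le_total x₀ x with h | h
  · have h3 := hx₀ x h
    rw [Real.norm_eq_abs, Real.norm_eq_abs, abs_of_pos (by positivity : 0 < x / Real.log x ^ 2)] at h3
    have h4 := h₁ x hx
    have h5 : |Chebyshev.theta x / Real.log x - x / Real.log x| ≤ C₁ * (x / Real.log x ^ 2) := by
      rw [← sub_div, abs_div, abs_of_pos hlog, div_le_iff₀ hlog]
      refine h4.trans (le_of_eq ?_)
      field_simp
    have h6 := abs_add_le (Nat.primeCounting ⌊x⌋₊ - Chebyshev.theta x / Real.log x)
      (Chebyshev.theta x / Real.log x - x / Real.log x)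
    rw [sub_add_sub_cancel] at h6
    have h7 : 0 ≤ (Real.log M ^ 2 + Real.log M) * (x / Real.log x ^ 2) := by positivity
    calc _ ≤ (C₁ + C₂ + Real.log M ^ 2 + Real.log M) * (x / Real.log x ^ 2) := by linarith
      _ = _ := by ring
  · have hxM : Real.log x ≤ Real.log M := Real.log_le_log hx0 (h.trans (le_max_left _ _))
    have h1 := primeCounting_floor_le hx0.le
    have h2 : (0 : ℝ) ≤ Nat.primeCounting ⌊x⌋₊ := by positivity
    have h3 : x ≤ Real.log M ^ 2 * x / Real.log x ^ 2 := by
      rw [le_div_iff₀ (by positivity)]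
      nlinarith [mul_le_mul hxM hxM hlog.le hlogM.le]
    have h4 : x / Real.log x ≤ Real.log M * x / Real.log x ^ 2 := by
      rw [div_le_div_iff₀ hlog (by positivity)]
      calc x * Real.log x ^ 2 = x * Real.log x * Real.log x := by ring
        _ ≤ x * Real.log M * Real.log x := by gcongr
        _ = _ := by ring
    have h5 : 0 ≤ x / Real.log x := by positivity
    have h6 : 0 ≤ (C₁ + C₂) * (x / Real.log x ^ 2) := by positivity
    have e : (C₁ + C₂ + Real.log M ^ 2 + Real.log M) * x / Real.log x ^ 2 =
      (C₁ + C₂) * (x / Real.log x ^ 2) + Real.log M ^ 2 * x / Real.log x ^ 2 +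
        Real.log M * x / Real.log x ^ 2 := by ring
    rw [e, abs_le]
    constructor <;> linarith

/-- The prime number theorem, uniformly for `x ≤ Y`, with the density `1 / log Y`. -/
theorem exists_abs_primeCounting_sub_div_log_le : ∃ C : ℝ, 0 < C ∧ ∀ x Y : ℝ, 2 ≤ Y → 0 ≤ x →
    x ≤ Y → |(Nat.primeCounting ⌊x⌋₊ : ℝ) - x / Real.log Y| ≤ C * Y / Real.log Y ^ 2 := by
  obtain ⟨C, hC, h⟩ := exists_abs_primeCounting_sub_le
  refine ⟨4 * C + 2 + 64, by positivity, fun x Y hY hx hxY => ?_⟩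
  have hY0 : 0 < Y := by linarith
  have hlogY : 0 < Real.log Y := Real.log_pos (by linarith)
  have hlogY' : 1 / 2 ≤ Real.log Y := by
    have := Real.log_le_log (by norm_num) hY
    linarith [Real.log_two_gt_d9]
  have e : (4 * C + 2 + 64) * Y / Real.log Y ^ 2 =
    (4 * C + 2) * Y / Real.log Y ^ 2 + 64 * Y / Real.log Y ^ 2 := by ring
  by_cases hc : √Y ≤ x ∧ 2 ≤ x
  · have hx0 : 0 < x := by linarith
    have hl : Real.log Y / 2 ≤ Real.log x := by
      rw [← Real.log_sqrt hY0.le]; exact Real.log_le_log (by positivity) hc.1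
    have hlx : 0 < Real.log x := by linarith
    have h1 := h x hc.2
    have h2 : C * x / Real.log x ^ 2 ≤ 4 * C * Y / Real.log Y ^ 2 := by
      calc C * x / Real.log x ^ 2 ≤ C * Y / (Real.log Y / 2) ^ 2 := by gcongr
        _ = _ := by ring
    have h3 : |x / Real.log x - x / Real.log Y| ≤ 2 * Y / Real.log Y ^ 2 := by
      have hle : Real.log x ≤ Real.log Y := Real.log_le_log hx0 hxY
      have h4 : x * (Real.log Y - Real.log x) ≤ Y := by
        rw [← Real.log_div hY0.ne' hx0.ne']
        have := Real.log_le_sub_one_of_pos (div_pos hY0 hx0)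
        calc x * Real.log (Y / x) ≤ x * (Y / x) := by gcongr; linarith
          _ = Y := by field_simp
      have e2 : x / Real.log x - x / Real.log Y =
        x * (Real.log Y - Real.log x) / (Real.log x * Real.log Y) := by field_simp
      have h5 : 0 ≤ x * (Real.log Y - Real.log x) := mul_nonneg hx (by linarith)
      rw [e2, abs_of_nonneg (by positivity)]
      calc _ ≤ Y / (Real.log Y / 2 * Real.log Y) := by gcongr
        _ = _ := by ring
    have h6 := abs_add_le ((Nat.primeCounting ⌊x⌋₊ : ℝ) - x / Real.log x)
      (x / Real.log x - x / Real.log Y)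
    rw [sub_add_sub_cancel] at h6
    have h7 : 0 ≤ 64 * Y / Real.log Y ^ 2 := by positivity
    have e3 : (4 * C + 2) * Y / Real.log Y ^ 2 =
      4 * C * Y / Real.log Y ^ 2 + 2 * Y / Real.log Y ^ 2 := by ring
    linarith
  · have hs : 1 ≤ √Y := by rw [Real.one_le_sqrt]; linarith
    have hx2 : x ≤ 2 * √Y := by
      rw [not_and_or, not_le, not_le] at hc
      rcases hc with hc | hc <;> linarith
    have h1 := primeCounting_floor_le hx
    have h2 : (0 : ℝ) ≤ Nat.primeCounting ⌊x⌋₊ := by positivity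
    have h3 : x / Real.log Y ≤ 2 * x := by
      rw [div_le_iff₀ hlogY]; nlinarith
    have h5 : 0 ≤ x / Real.log Y := by positivity
    have h4 : 4 * √Y ≤ 64 * Y / Real.log Y ^ 2 := by
      rw [le_div_iff₀ (by positivity)]
      have := log_sq_le_mul_sqrt (by linarith : 1 ≤ Y)
      calc 4 * √Y * Real.log Y ^ 2 ≤ 4 * √Y * (16 * √Y) := by gcongr
        _ = 64 * (√Y * √Y) := by ring
        _ = _ := by rw [Real.mul_self_sqrt hY0.le]
    have h6 : 0 ≤ (4 * C + 2) * Y / Real.log Y ^ 2 := by positivity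
    rw [e, abs_le]
    constructor <;> linarith

end HarmanKumchev

namespace HarmanKumchev

/-- The functions `u ↦ u ω(u)`, where `ω` is the Buchstab function, truncated after `k` steps of the
delay equation. -/
def buchW : ℕ → ℝ → ℝ
  | 0, _ => 1
  | k + 1, u => 1 + ∫ t in (1 : ℝ)..(max (u - 1) 1), buchW k t / max t 1

/-- The `k`-th approximation of the Buchstab function; it agrees with it on `[1, k + 2]`. -/
def buch (k : ℕ) (u : ℝ) : ℝ := buchW k u / max u 1

lemma buchW_succ (k : ℕ) (u : ℝ) : buchW (k + 1) u = 1 + ∫ t in (1 : ℝ)..(max (u - 1) 1), buch k t :=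
  rfl

lemma buch_bounds_of_buchW {k : ℕ} (hl : ∀ u v, |buchW k u - buchW k v| ≤ |u - v|)
    (hb : ∀ u, 1 ≤ buchW k u ∧ buchW k u ≤ max u 1) :
    (∀ u, 0 < buch k u ∧ buch k u ≤ 1) ∧ ∀ u v, |buch k u - buch k v| ≤ 2 * |u - v| := by
  have hm : ∀ u : ℝ, 1 ≤ max u 1 := fun u => le_max_right _ _
  have h01 : ∀ u, 0 < buch k u ∧ buch k u ≤ 1 := fun u => by
    have := hm u
    have := hb u
    exact ⟨div_pos (by linarith) (by linarith), (div_le_one (by linarith)).2 (hb u).2⟩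
  refine ⟨h01, fun u v => ?_⟩
  have hu := hm u
  have hv := hm v
  have e : buch k u - buch k v =
      (buchW k u - buchW k v) / max u 1 + buch k v * (max v 1 - max u 1) / max u 1 := by
    unfold buch
    field_simp
    ring
  have h1 : |max v 1 - max u 1| ≤ |v - u| := by simpa using abs_max_sub_max_le_abs v u 1
  rw [e]
  refine (abs_add_le _ _).trans ?_
  rw [abs_div, abs_div, abs_mul, abs_of_pos (by linarith : 0 < max u 1), abs_of_pos (h01 v).1]
  have h2 : |buchW k u - buchW k v| / max u 1 ≤ |u - v| :=
    (div_le_self (abs_nonneg _) hu).trans (hl u v)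
  have h3 : buch k v * |max v 1 - max u 1| / max u 1 ≤ |u - v| := by
    refine (div_le_self (mul_nonneg (h01 v).1.le (abs_nonneg _)) hu).trans ?_
    rw [abs_sub_comm u v]
    calc _ ≤ 1 * |v - u| := by gcongr; exact (h01 v).2
      _ = _ := one_mul _
  linarith

lemma buchW_bounds (k : ℕ) : (∀ u v, |buchW k u - buchW k v| ≤ |u - v|) ∧
    ∀ u, 1 ≤ buchW k u ∧ buchW k u ≤ max u 1 := by
  induction k with
  | zero => exact ⟨fun u v => by simp [buchW], fun u => ⟨le_rfl, le_max_right _ _⟩⟩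
  | succ k ih =>
    obtain ⟨h01, hlip⟩ := buch_bounds_of_buchW ih.1 ih.2
    have hcont : Continuous (buch k) := BddLip.continuous (K := 2)
      ⟨fun s => by rw [abs_of_pos (h01 s).1]; linarith [(h01 s).2], hlip⟩
    have hii : ∀ a b : ℝ, IntervalIntegrable (buch k) volume a b :=
      fun a b => hcont.intervalIntegrable a b
    refine ⟨fun u v => ?_, fun u => ?_⟩
    · rw [buchW_succ, buchW_succ, add_sub_add_left_eq_sub,
        intervalIntegral.integral_interval_sub_left (hii _ _) (hii _ _)]
      have h1 : |∫ t in (max (v - 1) 1)..(max (u - 1) 1), buch k t| ≤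
          1 * |max (u - 1) 1 - max (v - 1) 1| := by
        rw [← Real.norm_eq_abs]
        refine intervalIntegral.norm_integral_le_of_norm_le_const fun t _ => ?_
        rw [Real.norm_eq_abs, abs_of_pos (h01 t).1]
        exact (h01 t).2
      have h2 : |max (u - 1) 1 - max (v - 1) 1| ≤ |(u - 1) - (v - 1)| := by
        simpa using abs_max_sub_max_le_abs (u - 1) (v - 1) 1
      rw [sub_sub_sub_cancel_right] at h2
      linarith
    · have hm : (1 : ℝ) ≤ max (u - 1) 1 := le_max_right _ _
      rw [buchW_succ]
      have h1 : 0 ≤ ∫ t in (1 : ℝ)..(max (u - 1) 1), buch k t :=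
        intervalIntegral.integral_nonneg hm fun t _ => (h01 t).1.le
      have h2 : ∫ t in (1 : ℝ)..(max (u - 1) 1), buch k t ≤
          ∫ t in (1 : ℝ)..(max (u - 1) 1), (1 : ℝ) :=
        intervalIntegral.integral_mono_on hm (hii _ _) (continuous_const.intervalIntegrable _ _)
          fun t _ => (h01 t).2
      rw [intervalIntegral.integral_const, smul_eq_mul, mul_one] at h2
      have h3 : max (u - 1) 1 ≤ max u 1 := max_le_max (by linarith) le_rfl
      constructor <;> linarith

lemma buch_pos (k : ℕ) (u : ℝ) : 0 < buch k u :=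
  ((buch_bounds_of_buchW (buchW_bounds k).1 (buchW_bounds k).2).1 u).1

lemma buch_le_one (k : ℕ) (u : ℝ) : buch k u ≤ 1 :=
  ((buch_bounds_of_buchW (buchW_bounds k).1 (buchW_bounds k).2).1 u).2

lemma bddLip_buch (k : ℕ) : BddLip 2 (buch k) where
  bdd s := by rw [abs_of_pos (buch_pos k s)]; linarith [buch_le_one k s]
  lip := (buch_bounds_of_buchW (buchW_bounds k).1 (buchW_bounds k).2).2

lemma buch_intervalIntegrable (k : ℕ) (a b : ℝ) : IntervalIntegrable (buch k) volume a b :=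
  (bddLip_buch k).continuous.intervalIntegrable a b

lemma buch_eq_one_div (k : ℕ) {u : ℝ} (h1 : 1 ≤ u) (h2 : u ≤ 2) : buch k u = 1 / u := by
  have h : buchW k u = 1 := by
    cases k with
    | zero => rfl
    | succ k => rw [buchW_succ, max_eq_right (by linarith), intervalIntegral.integral_same, add_zero]
  rw [buch, h, max_eq_left h1]

lemma buch_succ_eq (k : ℕ) {u : ℝ} (h : 2 ≤ u) :
    buch (k + 1) u = (1 + ∫ t in (1 : ℝ)..(u - 1), buch k t) / u := by
  rw [buch, buchW_succ, max_eq_left (by linarith : 1 ≤ u - 1), max_eq_left (by linarith : 1 ≤ u)]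

lemma buch_succ_le (k : ℕ) {u : ℝ} (h : 2 ≤ u) : buch (k + 1) u ≤ 1 - 1 / u := by
  have h2 : ∫ t in (1 : ℝ)..(u - 1), buch k t ≤ ∫ t in (1 : ℝ)..(u - 1), (1 : ℝ) :=
    intervalIntegral.integral_mono_on (by linarith) (buch_intervalIntegrable k _ _)
      (continuous_const.intervalIntegrable _ _) fun t _ => buch_le_one k t
  rw [intervalIntegral.integral_const, smul_eq_mul, mul_one] at h2
  rw [buch_succ_eq k h, div_le_iff₀ (by linarith), sub_mul, one_div_mul_cancel (by linarith)]
  linarith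

lemma half_le_buch (k : ℕ) {u : ℝ} (h1 : 1 ≤ u) (h2 : u ≤ k + 2) : 1 / 2 ≤ buch k u := by
  induction k generalizing u with
  | zero =>
    norm_num at h2
    rw [buch_eq_one_div 0 h1 h2]
    exact one_div_le_one_div_of_le (by linarith) h2
  | succ k ih =>
    rcases le_total u 2 with h | h
    · rw [buch_eq_one_div _ h1 h]
      exact one_div_le_one_div_of_le (by linarith) h
    · push_cast at h2
      have h3 : ∫ t in (1 : ℝ)..(u - 1), (1 / 2 : ℝ) ≤ ∫ t in (1 : ℝ)..(u - 1), buch k t :=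
        intervalIntegral.integral_mono_on (by linarith)
          (continuous_const.intervalIntegrable _ _) (buch_intervalIntegrable k _ _)
          fun t ht => ih ht.1 (by linarith [ht.2])
      rw [intervalIntegral.integral_const, smul_eq_mul] at h3
      rw [buch_succ_eq k h, le_div_iff₀ (by linarith)]
      linarith

/-- The kernel of the Buchstab recursion in the variable `log p / log Y`. -/
def buchKer (k : ℕ) (c s : ℝ) : ℝ := buch k (1 / max s c - 1) * (1 / max s c * (1 / max s c))

lemma exists_bddLip_buchKer (k : ℕ) {c : ℝ} (hc : 0 < c) : ∃ K, BddLip K (buchKer k c) := by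
  have h1 : BddLip (1 / c + 1 / c ^ 2) fun s => 1 / max s c :=
    BddLip.inv hc (fun s => le_max_right _ _) fun s t => by
      simpa using abs_max_sub_max_le_abs s t c
  have h2 : BddLip _ fun s => buch k (1 / max s c - 1) :=
    (bddLip_buch k).comp (G₂ := fun s => 1 / max s c - 1) (K₂ := 1 / c + 1 / c ^ 2) fun s t => by
      rw [sub_sub_sub_cancel_right]; exact h1.lip s t
  exact ⟨_, h2.mul (h1.mul h1)⟩

lemma integral_buchKer (k : ℕ) {c u : ℝ} (hc : 0 < c) (hcu : c ≤ 1 / u) (hu : 2 ≤ u) :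
    ∫ s in (1 / u)..(1 / 2), buchKer k c s = ∫ t in (1 : ℝ)..(u - 1), buch k t := by
  have hle : 1 / u ≤ 1 / 2 := one_div_le_one_div_of_le (by norm_num) hu
  have hu0 : 0 < 1 / u := by positivity
  have hcv := intervalIntegral.integral_comp_mul_deriv (a := 1 / u) (b := 1 / 2)
    (f := fun s => 1 / s - 1) (f' := fun s => -(1 / s * (1 / s))) (g := buch k)
    (fun s hs => by
      rw [Set.uIcc_of_le hle] at hs
      have hs0 : s ≠ 0 := by linarith [hs.1]
      have h := (hasDerivAt_inv hs0).sub_const 1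
      simp only [one_div]
      rw [pow_two, mul_inv] at h
      exact h)
    (by
      rw [Set.uIcc_of_le hle]
      refine ContinuousOn.neg (ContinuousOn.mul ?_ ?_) <;>
      · exact continuousOn_const.div continuousOn_id fun s hs => by
          have := hs.1
          exact (by linarith : s ≠ 0))
    (bddLip_buch k).continuous
  have e1 : 1 / (1 / u) - 1 = u - 1 := by rw [one_div_one_div]
  have e2 : (1 : ℝ) / (1 / 2) - 1 = 1 := by norm_num
  simp only [e1, e2] at hcv
  rw [intervalIntegral.integral_symm 1 (u - 1)] at hcv
  have hcongr : ∫ s in (1 / u)..(1 / 2), buchKer k c s = ∫ s in (1 / u)..(1 / 2),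
      -((buch k ∘ fun s => 1 / s - 1) s * -(1 / s * (1 / s))) := by
    refine intervalIntegral.integral_congr fun s hs => ?_
    rw [Set.uIcc_of_le hle] at hs
    simp only [buchKer, Function.comp, max_eq_left (hcu.trans hs.1)]
    ring
  rw [hcongr, intervalIntegral.integral_neg, hcv, neg_neg]

end HarmanKumchev

namespace HarmanKumchev

/-- The number of `m ≤ x` all of whose prime factors are at least `y`. -/
def roughCount (x y : ℝ) : ℝ := ∑ m ∈ Finset.Ioc 0 ⌊x⌋₊, psi m y

lemma psi_eq_minFac {m : ℕ} (hm : m ≠ 1) (y : ℝ) :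
    psi m y = if y ≤ m.minFac then 1 else 0 := by
  unfold psi
  refine if_congr ⟨fun h => h _ (Nat.minFac_prime hm) (Nat.minFac_dvd m), fun h p hp hpm => ?_⟩
    rfl rfl
  exact h.trans (by exact_mod_cast Nat.minFac_le_of_dvd hp.two_le hpm)

lemma psi_div_eq {m p : ℕ} (hp : p.Prime) (hpm : p ∣ m) :
    psi (m / p) p = if p = m.minFac then 1 else 0 := by
  unfold psi
  refine if_congr ⟨fun h => ?_, fun h q hq hqm => ?_⟩ rfl rfl
  · have hm1 : m ≠ 1 := by rintro rfl; exact hp.one_lt.ne' (Nat.dvd_one.1 hpm)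
    have hq := Nat.minFac_prime hm1
    by_contra hne
    have hdvd : m.minFac ∣ m / p := by
      have h1 : m.minFac ∣ p * (m / p) := by
        rw [Nat.mul_div_cancel' hpm]; exact Nat.minFac_dvd m
      exact ((Nat.coprime_primes hq hp).2 (Ne.symm hne)).dvd_of_dvd_mul_left h1
    have h2 := h _ hq hdvd
    have h3 : p ≤ m.minFac := by exact_mod_cast h2
    exact hne (le_antisymm h3 (Nat.minFac_le_of_dvd hp.two_le hpm))
  · rw [h]
    exact_mod_cast Nat.minFac_le_of_dvd hq.two_le (hqm.trans (Nat.div_dvd_of_dvd hpm))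

lemma psi_sub_psi {m : ℕ} (hm0 : m ≠ 0) {y w : ℝ} (hyw : y ≤ w) :
    psi m y - psi m w =
      ∑ p ∈ (Finset.Ico ⌈y⌉₊ ⌈w⌉₊).filter fun p => p.Prime ∧ p ∣ m, psi (m / p) p := by
  by_cases hm1 : m = 1
  · subst hm1
    have h : ∀ t, psi 1 t = 1 := fun t => if_pos fun p hp hp1 =>
      absurd (Nat.dvd_one.1 hp1) hp.one_lt.ne'
    rw [h, h, sub_self, eq_comm]
    refine Finset.sum_eq_zero fun p hp => ?_
    rw [Finset.mem_filter] at hp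
    exact absurd (Nat.dvd_one.1 hp.2.2) hp.2.1.one_lt.ne'
  · have hs : ∑ p ∈ (Finset.Ico ⌈y⌉₊ ⌈w⌉₊).filter (fun p => p.Prime ∧ p ∣ m), psi (m / p) p =
        ∑ p ∈ (Finset.Ico ⌈y⌉₊ ⌈w⌉₊).filter (fun p => p.Prime ∧ p ∣ m),
          if p = m.minFac then (1 : ℝ) else 0 := by
      refine Finset.sum_congr rfl fun p hp => ?_
      rw [Finset.mem_filter] at hp
      exact psi_div_eq hp.2.1 hp.2.2
    rw [hs, Finset.sum_ite_eq', psi_eq_minFac hm1, psi_eq_minFac hm1]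
    have hmem : m.minFac ∈ (Finset.Ico ⌈y⌉₊ ⌈w⌉₊).filter (fun p => p.Prime ∧ p ∣ m) ↔
        y ≤ m.minFac ∧ ¬ w ≤ m.minFac := by
      rw [Finset.mem_filter, Finset.mem_Ico, Nat.ceil_le, Nat.lt_ceil, not_le]
      exact ⟨fun h => h.1, fun h => ⟨h, Nat.minFac_prime hm1, Nat.minFac_dvd m⟩⟩
    by_cases h1 : w ≤ m.minFac
    · have h2 := hyw.trans h1
      simp only [hmem, h1, h2]
      simp
    · simp only [hmem, h1]
      simp

lemma sum_sum_dvd_prime (S : Finset ℕ) (N : ℕ) (g : ℕ → ℕ → ℝ) :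
    ∑ m ∈ Finset.Ioc 0 N, ∑ p ∈ S.filter (fun p => p.Prime ∧ p ∣ m), g p (m / p) =
      ∑ p ∈ S.filter Nat.Prime, ∑ k ∈ Finset.Ioc 0 (N / p), g p k := by
  have h1 : ∀ m ∈ Finset.Ioc 0 N, ∑ p ∈ S.filter (fun p => p.Prime ∧ p ∣ m), g p (m / p) =
      ∑ p ∈ S.filter Nat.Prime, if p ∣ m then g p (m / p) else 0 := fun m _ => by
    rw [← Finset.sum_filter, Finset.filter_filter]
  rw [Finset.sum_congr rfl h1, Finset.sum_comm]
  refine Finset.sum_congr rfl fun p hp => ?_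
  have hp0 : 0 < p := (Finset.mem_filter.1 hp).2.pos
  rw [← Finset.sum_filter]
  refine Finset.sum_nbij' (fun m => m / p) (fun k => k * p) ?_ ?_ ?_ ?_ ?_
  · intro m hm
    rw [Finset.mem_filter, Finset.mem_Ioc] at hm
    rw [Finset.mem_Ioc]
    exact ⟨Nat.div_pos (Nat.le_of_dvd hm.1.1 hm.2) hp0, Nat.div_le_div_right hm.1.2⟩
  · intro k hk
    rw [Finset.mem_Ioc] at hk
    rw [Finset.mem_filter, Finset.mem_Ioc]
    exact ⟨⟨Nat.mul_pos hk.1 hp0, (Nat.le_div_iff_mul_le hp0).1 hk.2⟩, dvd_mul_left _ _⟩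
  · intro m hm
    exact Nat.div_mul_cancel (Finset.mem_filter.1 hm).2
  · intro k _
    exact Nat.mul_div_cancel _ hp0
  · intro m _
    rfl

lemma sum_psi_div_eq_roughCount (S : Finset ℕ) (x : ℝ) (z : ℕ → ℝ) :
    ∑ m ∈ Finset.Ioc 0 ⌊x⌋₊, ∑ p ∈ S.filter (fun p => p.Prime ∧ p ∣ m), psi (m / p) (z p) =
      ∑ p ∈ S.filter Nat.Prime, roughCount (x / p) (z p) := by
  rw [sum_sum_dvd_prime S _ fun p k => psi k (z p)]
  refine Finset.sum_congr rfl fun p _ => ?_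
  rw [roughCount, Nat.floor_div_natCast]

/-- Buchstab's identity. -/
lemma roughCount_eq_add (x : ℝ) {y w : ℝ} (hyw : y ≤ w) :
    roughCount x y = roughCount x w +
      ∑ p ∈ (Finset.Ico ⌈y⌉₊ ⌈w⌉₊).filter Nat.Prime, roughCount (x / p) p := by
  rw [← sum_psi_div_eq_roughCount _ x fun p => (p : ℝ), roughCount, roughCount,
    ← Finset.sum_add_distrib]
  refine Finset.sum_congr rfl fun m hm => ?_
  have := psi_sub_psi (m := m) (by have := (Finset.mem_Ioc.1 hm).1; omega) hyw
  linarith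

lemma sum_rho_eq {X : ℝ} (hX : 1 ≤ X) (x : ℝ) :
    ∑ m ∈ Finset.Ioc 0 ⌊x⌋₊, rho X m = roughCount x (X ^ ((1 : ℝ) / 4)) -
      ∑ p ∈ (Finset.Ico ⌈X ^ ((5 : ℝ) / 42)⌉₊ ⌈X ^ ((1 : ℝ) / 4)⌉₊).filter Nat.Prime,
        (roughCount (x / p) (zfun X p) - roughCount (x / p) p) := by
  have hle : X ^ ((5 : ℝ) / 42) ≤ X ^ ((1 : ℝ) / 4) :=
    Real.rpow_le_rpow_of_exponent_le hX (by norm_num)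
  have h1 := roughCount_eq_add x hle
  have h2 : ∀ m ∈ Finset.Ioc 0 ⌊x⌋₊, rho X m = psi m (X ^ ((5 : ℝ) / 42)) -
      ∑ p ∈ (Finset.Ico ⌈X ^ ((5 : ℝ) / 42)⌉₊ ⌈X ^ ((1 : ℝ) / 4)⌉₊).filter
        (fun p => p.Prime ∧ p ∣ m), psi (m / p) (zfun X p) := by
    intro m _
    unfold rho
    congr 1
    refine Finset.sum_congr ?_ fun _ _ => rfl
    ext p
    simp only [Finset.mem_filter, Finset.mem_range, Finset.mem_Ico, Nat.ceil_le, Nat.lt_ceil]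
    constructor
    · rintro ⟨-, h₁, h₂, h₃, h₄⟩
      exact ⟨⟨h₂, h₃⟩, h₁, h₄⟩
    · rintro ⟨⟨h₂, h₃⟩, h₁, h₄⟩
      exact ⟨by have := Nat.lt_ceil.2 h₃; omega, h₁, h₂, h₃, h₄⟩
  rw [Finset.sum_congr rfl h2, Finset.sum_sub_distrib, sum_psi_div_eq_roughCount,
    Finset.sum_sub_distrib]
  rw [roughCount] at h1
  linarith

end HarmanKumchev

namespace HarmanKumchev

lemma primeCounting_eq_sum (n : ℕ) :
    (Nat.primeCounting n : ℝ) = ∑ m ∈ Finset.Ioc 0 n, if m.Prime then (1 : ℝ) else 0 := by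
  induction n with
  | zero => simp
  | succ n ih =>
    rw [Finset.sum_Ioc_succ_top (Nat.zero_le n), ← ih, Nat.primeCounting, Nat.primeCounting',
      Nat.count_succ]
    push_cast
    rfl

lemma exists_primeCounting_le : ∃ C : ℝ, 1 ≤ C ∧ ∀ w : ℝ, 1 < w →
    (Nat.primeCounting ⌊w⌋₊ : ℝ) ≤ C * (w / Real.log w) := by
  obtain ⟨C, hC, h⟩ := exists_abs_primeCounting_sub_le
  refine ⟨1 + 2 * C, by linarith, fun w hw => ?_⟩
  have hlog : 0 < Real.log w := Real.log_pos hw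
  rcases le_total 2 w with h2 | h2
  · have h1 := (abs_le.1 (h w h2)).2
    have hl : 1 / 2 ≤ Real.log w := by
      have := Real.log_le_log (by norm_num) h2
      linarith [Real.log_two_gt_d9]
    have h3 : C * w / Real.log w ^ 2 ≤ 2 * C * (w / Real.log w) := by
      rw [← mul_div_assoc, div_le_div_iff₀ (by positivity) hlog]
      have : 0 ≤ C * w * Real.log w := by positivity
      nlinarith
    linarith
  · have h1 := primeCounting_floor_le (by linarith : 0 ≤ w)
    have hl : Real.log w ≤ 1 := (Real.log_le_sub_one_of_pos (by linarith)).trans (by linarith)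
    have h3 : w ≤ w / Real.log w := by
      rw [le_div_iff₀ hlog]; nlinarith
    nlinarith

lemma card_primes_Ico_le (A : ℕ) (w : ℝ) :
    (((Finset.Ico A ⌈w⌉₊).filter Nat.Prime).card : ℝ) ≤ Nat.primeCounting ⌊w⌋₊ := by
  rw [primeCounting_eq_sum, ← Finset.sum_filter, Finset.sum_const, nsmul_eq_mul, mul_one]
  refine Nat.cast_le.2 (Finset.card_le_card fun p hp => ?_)
  simp only [Finset.mem_filter, Finset.mem_Ico, Nat.lt_ceil, Finset.mem_Ioc] at hp ⊢
  exact ⟨⟨hp.2.pos, Nat.le_floor hp.1.2.le⟩, hp.2⟩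

lemma exists_sum_prime_one_div_le {c : ℝ} (hc : 0 < c) : ∃ C : ℝ, 0 < C ∧
    ∀ (L α β : ℝ) (A B : ℕ), 1 / 2 ≤ L → 2 ≤ A → A ≤ B → 0 ≤ α → β ≤ 1 → α ≤ β →
    c * L ≤ Real.log A → |Real.log A - α * L| ≤ 1 → |Real.log B - β * L| ≤ 1 →
    ∑ p ∈ (Finset.Ico A B).filter Nat.Prime, (1 : ℝ) / p ≤ C := by
  obtain ⟨C, hC, h⟩ := exists_sum_prime_log_div_sub_le hc
  refine ⟨(1 + 2 * C) / c, by positivity, fun L α β A B hL hA hAB hα hβ hαβ hcA hlA hlB => ?_⟩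
  have h1 := (abs_le.1 (h 1 L α β (fun _ => 1) A B BddLip.one hL hA hAB hβ hcA hlA hlB)).2
  rw [intervalIntegral.integral_const, smul_eq_mul] at h1
  have h2 : ∑ p ∈ (Finset.Ico A B).filter Nat.Prime, (1 : ℝ) / p * (c * L) ≤
      ∑ p ∈ (Finset.Ico A B).filter Nat.Prime, 1 * (Real.log p / p) := by
    refine Finset.sum_le_sum fun p hp => ?_
    rw [Finset.mem_filter, Finset.mem_Ico] at hp
    have hle : Real.log A ≤ Real.log p :=
      Real.log_le_log (by positivity) (by exact_mod_cast hp.1.1)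
    calc (1 : ℝ) / p * (c * L) ≤ 1 / p * Real.log p := by gcongr; linarith
      _ = _ := by ring
  rw [← Finset.sum_mul] at h2
  rw [le_div_iff₀ hc]
  have hL0 : 0 < L := by linarith
  have h3 : (β - α) * 1 * L ≤ 1 * 1 * L := by gcongr; linarith
  refine le_of_mul_le_mul_right ?_ hL0
  nlinarith

lemma psi_nonneg (m : ℕ) (y : ℝ) : 0 ≤ psi m y := by unfold psi; split_ifs <;> norm_num

lemma psi_le_one (m : ℕ) (y : ℝ) : psi m y ≤ 1 := by unfold psi; split_ifs <;> norm_num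

lemma roughCount_nonneg (x y : ℝ) : 0 ≤ roughCount x y :=
  Finset.sum_nonneg fun m _ => psi_nonneg m y

lemma roughCount_le {x : ℝ} (hx : 0 ≤ x) (y : ℝ) : roughCount x y ≤ x := by
  calc roughCount x y ≤ ∑ m ∈ Finset.Ioc 0 ⌊x⌋₊, (1 : ℝ) :=
        Finset.sum_le_sum fun m _ => psi_le_one m y
    _ = ⌊x⌋₊ := by simp
    _ ≤ x := Nat.floor_le hx

lemma roughCount_le_primeCounting_add {x y : ℝ} (hx : 0 ≤ x) (hy : 0 ≤ y) (hxy : x ≤ y ^ 2) :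
    roughCount x y ≤ Nat.primeCounting ⌊x⌋₊ + 2 := by
  have hterm : ∀ m ∈ Finset.Ioc 0 ⌊x⌋₊, psi m y ≤ (if m.Prime then (1 : ℝ) else 0) +
      (if m = 1 then 1 else 0) + (if m = ⌊y ^ 2⌋₊ then 1 else 0) := by
    intro m hm
    rw [Finset.mem_Ioc] at hm
    have hle := psi_le_one m y
    by_cases hm1 : m = 1
    · rw [if_pos hm1]
      split_ifs <;> linarith
    by_cases hp : m.Prime
    · rw [if_pos hp]
      split_ifs <;> linarith
    by_cases hy2 : m = ⌊y ^ 2⌋₊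
    · rw [if_neg hm1, if_neg hp, if_pos hy2]; linarith
    rw [if_neg hm1, if_neg hp, if_neg hy2, psi_eq_minFac hm1]
    split_ifs with h
    · exfalso
      have h1 : (m.minFac : ℝ) ^ 2 ≤ m := by
        exact_mod_cast Nat.minFac_sq_le_self hm.1 hp
      have h2 : y ^ 2 ≤ m := (by gcongr : y ^ 2 ≤ (m.minFac : ℝ) ^ 2).trans h1
      have h3 : (m : ℝ) ≤ x := (Nat.le_floor_iff hx).1 hm.2
      refine hy2 ?_
      rw [show y ^ 2 = (m : ℝ) by linarith, Nat.floor_natCast]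
    · norm_num
  refine (Finset.sum_le_sum hterm).trans ?_
  rw [Finset.sum_add_distrib, Finset.sum_add_distrib, ← primeCounting_eq_sum,
    Finset.sum_ite_eq', Finset.sum_ite_eq']
  split_ifs <;> linarith

lemma primeCounting_le_roughCount_add (x y : ℝ) :
    (Nat.primeCounting ⌊x⌋₊ : ℝ) ≤ roughCount x y + Nat.primeCounting ⌊y⌋₊ := by
  have hterm : ∀ m ∈ Finset.Ioc 0 ⌊x⌋₊, (if m.Prime then (1 : ℝ) else 0) ≤
      psi m y + if m ∈ Finset.Ioc 0 ⌊y⌋₊ then (if m.Prime then 1 else 0) else 0 := by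
    intro m hm
    rw [Finset.mem_Ioc] at hm
    have h0 := psi_nonneg m y
    by_cases hp : m.Prime
    · by_cases hmy : m ≤ ⌊y⌋₊
      · rw [if_pos hp, if_pos (Finset.mem_Ioc.2 ⟨hm.1, hmy⟩)]; linarith
      · have : y ≤ m := (Nat.lt_of_floor_lt (by omega)).le
        rw [psi_eq_minFac hp.ne_one, hp.minFac_eq, if_pos this, if_pos hp]
        split_ifs <;> norm_num
    · rw [if_neg hp]
      split_ifs <;> linarith
  rw [primeCounting_eq_sum, primeCounting_eq_sum]
  refine (Finset.sum_le_sum hterm).trans ?_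
  rw [Finset.sum_add_distrib, roughCount]
  gcongr
  rw [← Finset.sum_filter]
  refine Finset.sum_le_sum_of_subset_of_nonneg (fun m hm => (Finset.mem_filter.1 hm).2) ?_
  intro m _ _
  split_ifs <;> norm_num

lemma exists_abs_roughCount_sub_le_of_le_two : ∃ C : ℝ, 0 < C ∧ ∀ (k : ℕ) (x y Y : ℝ), 2 ≤ y →
    y ≤ Y → Real.log Y ≤ 2 * Real.log y → 0 ≤ x → x ≤ Y →
    |roughCount x y - buch k (Real.log Y / Real.log y) * x / Real.log y| ≤
      C * (Y / Real.log Y ^ 2 + y / Real.log y) := by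
  obtain ⟨C₁, hC₁, h₁⟩ := exists_abs_primeCounting_sub_div_log_le
  obtain ⟨C₂, hC₂, h₂⟩ := exists_primeCounting_le
  refine ⟨C₁ + C₂ + 2, by linarith, fun k x y Y hy hyY hu hx hxY => ?_⟩
  have hy0 : 0 < y := by linarith
  have hY0 : 0 < Y := by linarith
  have hly : 0 < Real.log y := Real.log_pos (by linarith)
  have hlY : Real.log y ≤ Real.log Y := Real.log_le_log hy0 hyY
  have hlY0 : 0 < Real.log Y := by linarith
  have hYy : Y ≤ y ^ 2 := by
    rw [← Real.log_le_log_iff hY0 (by positivity), Real.log_pow]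
    exact_mod_cast hu
  rw [buch_eq_one_div k ((one_le_div hly).2 hlY) ((div_le_iff₀ hly).2 hu)]
  have e : 1 / (Real.log Y / Real.log y) * x / Real.log y = x / Real.log Y := by field_simp
  rw [e]
  have a1 := abs_le.1 (h₁ x Y (by linarith) hx hxY)
  have a2 := h₂ y (by linarith)
  have a3 := roughCount_le_primeCounting_add hx hy0.le (hxY.trans hYy)
  have a4 := primeCounting_le_roughCount_add x y
  have a5 : 1 ≤ y / Real.log y := by
    rw [one_le_div hly]; exact (Real.log_le_sub_one_of_pos hy0).trans (by linarith)
  have a6 : 0 ≤ Y / Real.log Y ^ 2 := by positivity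
  have e2 : C₁ * Y / Real.log Y ^ 2 = C₁ * (Y / Real.log Y ^ 2) := by ring
  rw [e2] at a1
  have a7 : 0 ≤ (C₂ + 2) * (Y / Real.log Y ^ 2) := by positivity
  have a8 : 0 ≤ C₁ * (y / Real.log y) := by positivity
  have a9 : 0 ≤ C₂ * (y / Real.log y) := by positivity
  rw [abs_le]
  constructor <;> linarith [a1.1, a1.2]

end HarmanKumchev

namespace HarmanKumchev

lemma log_le_log_natCeil {x : ℝ} (hx : 1 ≤ x) : Real.log x ≤ Real.log ⌈x⌉₊ :=
  Real.log_le_log (by linarith) (Nat.le_ceil x)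

lemma abs_log_natCeil_sub_le {x : ℝ} (hx : 1 ≤ x) : |Real.log ⌈x⌉₊ - Real.log x| ≤ 1 := by
  have hx0 : 0 < x := by linarith
  have h1 := log_le_log_natCeil hx
  rw [abs_of_nonneg (by linarith)]
  have h2 : (0 : ℝ) < ⌈x⌉₊ := hx0.trans_le (Nat.le_ceil x)
  rw [← Real.log_div h2.ne' hx0.ne']
  refine (Real.log_le_sub_one_of_pos (by positivity)).trans ?_
  rw [sub_le_iff_le_add, div_le_iff₀ hx0]
  linarith [Nat.ceil_lt_add_one hx0.le]

lemma two_le_natCeil {x : ℝ} (hx : 1 < x) : 2 ≤ ⌈x⌉₊ := Nat.lt_ceil.2 (by exact_mod_cast hx)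

/-- The asymptotic formula for `roughCount x y` uniformly in `x ≤ Y`, where `Y ≤ y ^ (k + 2)`, with
an error constant `C`. -/
def RoughAsymp (k : ℕ) (C : ℝ) : Prop := ∀ x y Y : ℝ, 2 ≤ y → y ≤ Y →
  Real.log Y ≤ (k + 2) * Real.log y → 0 ≤ x → x ≤ Y →
    |roughCount x y - buch k (Real.log Y / Real.log y) * x / Real.log y| ≤
      C * (Y / Real.log Y ^ 2 + y / Real.log y)

lemma RoughAsymp.prime_term {k : ℕ} {C : ℝ} (h : RoughAsymp k C) (hC : 0 ≤ C) {x Y p : ℝ}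
    (hp : 2 ≤ p) (hpY : p ^ 2 ≤ Y) (hYp : Real.log Y ≤ (k + 3) * Real.log p) (hx : 0 ≤ x)
    (hxY : x ≤ Y) :
    |roughCount (x / p) p - x / Real.log Y ^ 2 *
      (buchKer k (1 / (k + 3)) (Real.log p / Real.log Y) * (Real.log p / p))| ≤
      C * (4 * Y / Real.log Y ^ 2 * (1 / p) + p / Real.log p) := by
  have hp0 : 0 < p := by linarith
  have hY0 : 0 < Y := lt_of_lt_of_le (by positivity) hpY
  have hlp : 0 < Real.log p := Real.log_pos (by linarith)
  have h2 : 2 * Real.log p ≤ Real.log Y := by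
    have := Real.log_le_log (by positivity) hpY
    rw [Real.log_pow] at this
    exact_mod_cast this
  set L := Real.log Y with hL
  have hL0 : 0 < L := by linarith
  have hlog : Real.log (Y / p) = L - Real.log p := Real.log_div hY0.ne' hp0.ne'
  have h1 := h (x / p) p (Y / p) hp (by rw [le_div_iff₀ hp0]; nlinarith)
    (by rw [hlog]; linarith) (by positivity) (by gcongr)
  rw [hlog] at h1
  have hs : 1 / ((k : ℝ) + 3) ≤ Real.log p / L := by
    rw [div_le_div_iff₀ (by positivity) hL0]; linarith
  have e1 : x / L ^ 2 * (buchKer k (1 / (k + 3)) (Real.log p / L) * (Real.log p / p)) =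
      buch k ((L - Real.log p) / Real.log p) * (x / p) / Real.log p := by
    rw [buchKer, max_eq_left hs]
    have : 1 / (Real.log p / L) - 1 = (L - Real.log p) / Real.log p := by field_simp
    rw [this]
    field_simp
  rw [e1]
  refine h1.trans ?_
  have h3 : Y / p / (L - Real.log p) ^ 2 ≤ 4 * Y / L ^ 2 * (1 / p) := by
    calc Y / p / (L - Real.log p) ^ 2 ≤ Y / p / (L / 2) ^ 2 := by gcongr; linarith
      _ = _ := by ring
  gcongr

lemma log_le_two_mul_sqrt {Y : ℝ} (hY : 0 < Y) : Real.log Y ≤ 2 * √Y := by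
  have h := Real.log_le_sub_one_of_pos (Real.sqrt_pos.2 hY)
  rw [Real.log_sqrt hY.le] at h
  linarith

lemma exists_roughAsymp (k : ℕ) : ∃ C : ℝ, 0 < C ∧ RoughAsymp k C := by
  obtain ⟨C₀, hC₀, h₀⟩ := exists_abs_roughCount_sub_le_of_le_two
  induction k with
  | zero =>
    refine ⟨C₀, hC₀, fun x y Y hy hyY hu hx hxY => h₀ 0 x y Y hy hyY ?_ hx hxY⟩
    norm_num at hu
    exact hu
  | succ k ih =>
    obtain ⟨C, hC, h⟩ := ih
    have hc : 0 < 1 / ((k : ℝ) + 3) := by positivity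
    obtain ⟨K, hK⟩ := exists_bddLip_buchKer k hc
    obtain ⟨C₁, hC₁, h₁⟩ := exists_sum_prime_log_div_sub_le hc
    obtain ⟨C₂, hC₂, h₂⟩ := exists_sum_prime_one_div_le hc
    obtain ⟨C₃, hC₃, h₃⟩ := exists_primeCounting_le
    have hK0 := hK.nonneg
    refine ⟨5 * C₀ + C₁ * K + C * (4 * C₂ + 2 * C₃ * (k + 3)), by positivity,
      fun x y Y hy hyY hu hx hxY => ?_⟩
    have hy0 : 0 < y := by linarith
    have hY0 : 0 < Y := by linarith
    have hly : 0 < Real.log y := Real.log_pos (by linarith)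
    have hlY : Real.log y ≤ Real.log Y := Real.log_le_log hy0 hyY
    have hc' : 0 ≤ C₁ * K + C * (4 * C₂ + 2 * C₃ * (k + 3)) := by positivity
    rcases le_total (Real.log Y) (2 * Real.log y) with h2 | h2
    · refine (h₀ (k + 1) x y Y hy hyY h2 hx hxY).trans ?_
      have : 0 ≤ Y / Real.log Y ^ 2 + y / Real.log y := by positivity
      gcongr
      linarith
    set L := Real.log Y with hL
    have hL0 : 0 < L := by linarith
    have hL12 : 1 / 2 ≤ L := by
      have := Real.log_le_log (by norm_num) hy
      linarith [Real.log_two_gt_d9]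
    have hyY2 : y ^ 2 ≤ Y := by
      rw [← Real.log_le_log_iff (by positivity) hY0, Real.log_pow]
      exact_mod_cast h2
    set w := √Y with hw
    have hw2 : w ^ 2 = Y := Real.sq_sqrt hY0.le
    have hyw : y ≤ w := Real.le_sqrt_of_sq_le hyY2
    have hw0 : 0 < w := by linarith
    have hlw : Real.log w = L / 2 := Real.log_sqrt hY0.le
    have hLw : L ≤ 2 * w := log_le_two_mul_sqrt hY0
    have hwY : w ≤ Y := by nlinarith
    have m1 := h₀ 0 x w Y (by linarith) hwY (by rw [hlw]; linarith) hx hxY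
    have hu' : L ≤ (k + 3) * Real.log y := by push_cast at hu; linarith
    set P := (Finset.Ico ⌈y⌉₊ ⌈w⌉₊).filter Nat.Prime with hP
    have hA2 : 2 ≤ ⌈y⌉₊ := two_le_natCeil (by linarith)
    have hAB : ⌈y⌉₊ ≤ ⌈w⌉₊ := Nat.ceil_mono hyw
    have hcA : 1 / ((k : ℝ) + 3) * L ≤ Real.log ⌈y⌉₊ := by
      refine le_trans ?_ (log_le_log_natCeil (by linarith))
      rw [one_div_mul_eq_div, div_le_iff₀ (by positivity)]
      linarith
    have hlA : |Real.log ⌈y⌉₊ - 1 / (L / Real.log y) * L| ≤ 1 := by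
      have e : 1 / (L / Real.log y) * L = Real.log y := by field_simp
      rw [e]; exact abs_log_natCeil_sub_le (by linarith)
    have hlB : |Real.log ⌈w⌉₊ - 1 / 2 * L| ≤ 1 := by
      have e : 1 / 2 * L = Real.log w := by rw [hlw]; ring
      rw [e]; exact abs_log_natCeil_sub_le (by linarith)
    have hu2 : 2 ≤ L / Real.log y := by rw [le_div_iff₀ hly]; exact h2
    have hu3 : 1 / ((k : ℝ) + 3) ≤ 1 / (L / Real.log y) := by
      apply one_div_le_one_div_of_le (by positivity)
      rw [div_le_iff₀ hly]; exact hu'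
    have hu4 : 1 / (L / Real.log y) ≤ 1 / 2 := one_div_le_one_div_of_le (by norm_num) hu2
    have m2 := h₁ K L (1 / (L / Real.log y)) (1 / 2) _ _ _ hK hL12 hA2 hAB (by norm_num) hcA hlA hlB
    have m3 := h₂ L (1 / (L / Real.log y)) (1 / 2) _ _ hL12 hA2 hAB (hc.le.trans hu3) (by norm_num)
      hu4 hcA hlA hlB
    rw [integral_buchKer k hc hu3 hu2] at m2
    set J := ∫ t in (1 : ℝ)..(L / Real.log y - 1), buch k t with hJ
    have mem : ∀ p ∈ P, y ≤ p ∧ (p : ℝ) ≤ w := fun p hp => by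
      rw [hP, Finset.mem_filter, Finset.mem_Ico, Nat.ceil_le, Nat.lt_ceil] at hp
      exact ⟨hp.1.1, hp.1.2.le⟩
    have hterm : ∀ p ∈ P, |roughCount (x / p) p - x / L ^ 2 *
        (buchKer k (1 / (k + 3)) (Real.log p / L) * (Real.log p / p))| ≤
        C * (4 * Y / L ^ 2 * (1 / p) + (k + 3) * w / L) := fun p hp => by
      obtain ⟨hp1, hp2⟩ := mem p hp
      have hlyp : Real.log y ≤ Real.log p := Real.log_le_log hy0 hp1
      have hlp : 0 < Real.log p := by linarith
      have hq : (p : ℝ) / Real.log p ≤ (k + 3) * w / L := by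
        rw [div_le_div_iff₀ hlp hL0]
        calc (p : ℝ) * L ≤ w * ((k + 3) * Real.log p) := by
              gcongr; exact hu'.trans (by gcongr)
          _ = _ := by ring
      refine (h.prime_term hC.le (hy.trans hp1) (by rw [← hw2]; gcongr)
        (hu'.trans (by gcongr)) hx hxY).trans ?_
      exact mul_le_mul_of_nonneg_left (add_le_add le_rfl hq) hC.le
    have m4 := (Finset.abs_sum_le_sum_abs _ _).trans (Finset.sum_le_sum hterm)
    rw [Finset.sum_sub_distrib, ← Finset.mul_sum, ← Finset.mul_sum, Finset.sum_add_distrib,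
      ← Finset.mul_sum, Finset.sum_const, nsmul_eq_mul] at m4
    have m5 : (P.card : ℝ) ≤ C₃ * (w / (L / 2)) := by
      rw [← hlw]
      exact (card_primes_Ico_le _ w).trans (h₃ w (by linarith))
    have m6 : C * (4 * Y / L ^ 2 * ∑ p ∈ P, 1 / (p : ℝ) + P.card * ((k + 3) * w / L)) ≤
        C * (4 * C₂ + 2 * C₃ * (k + 3)) * (Y / L ^ 2) := by
      calc _ ≤ C * (4 * Y / L ^ 2 * C₂ + C₃ * (w / (L / 2)) * ((k + 3) * w / L)) := by gcongr
        _ = C * (4 * C₂ * Y + 2 * C₃ * (k + 3) * w ^ 2) / L ^ 2 := by field_simp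
        _ = _ := by rw [hw2]; ring
    have m7 : |x / L ^ 2 * ∑ p ∈ P, buchKer k (1 / (k + 3)) (Real.log p / L) * (Real.log p / p) -
        x / L * J| ≤ C₁ * K * (Y / L ^ 2) := by
      have e : x / L ^ 2 * ∑ p ∈ P, buchKer k (1 / (k + 3)) (Real.log p / L) * (Real.log p / p) -
        x / L * J = x / L ^ 2 * (∑ p ∈ P, buchKer k (1 / (k + 3)) (Real.log p / L) *
          (Real.log p / p) - L * J) := by field_simp
      rw [e, abs_mul, abs_of_nonneg (by positivity)]
      calc _ ≤ Y / L ^ 2 * (C₁ * K) := by gcongr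
        _ = _ := by ring
    have m8 : C₀ * (Y / L ^ 2 + w / Real.log w) ≤ 5 * C₀ * (Y / L ^ 2) := by
      have : w / Real.log w ≤ 4 * (Y / L ^ 2) := by
        rw [hlw, ← hw2, ← mul_div_assoc, div_le_div_iff₀ (by positivity) (by positivity)]
        calc w * L ^ 2 = w * L * L := by ring
          _ ≤ w * L * (2 * w) := by gcongr
          _ = _ := by ring
      calc _ ≤ C₀ * (Y / L ^ 2 + 4 * (Y / L ^ 2)) := by gcongr
        _ = _ := by ring
    have m1' : |roughCount x w - x / L| ≤ 5 * C₀ * (Y / L ^ 2) := by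
      refine le_trans (le_of_eq ?_) (m1.trans m8)
      have e : L / (L / 2) = 2 := by field_simp
      rw [hlw, e, buch_eq_one_div 0 (by norm_num) le_rfl]
      congr 2
      field_simp
    have e : buch (k + 1) (L / Real.log y) * x / Real.log y = x / L + x / L * J := by
      rw [buch_succ_eq k hu2, ← hJ]; field_simp
    have m9 : 0 ≤ (5 * C₀ + C₁ * K + C * (4 * C₂ + 2 * C₃ * (k + 3))) * (y / Real.log y) := by
      positivity
    rw [roughCount_eq_add x hyw, e]
    have m4' := abs_le.1 (m4.trans m6)
    have m7' := abs_le.1 m7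
    have m1'' := abs_le.1 m1'
    rw [abs_le]
    constructor <;> linarith [m4'.1, m4'.2, m7'.1, m7'.2, m1''.1, m1''.2]

end HarmanKumchev

namespace HarmanKumchev

theorem exists_abs_roughCount_sub_le (k : ℕ) : ∃ C : ℝ, 0 < C ∧ ∀ x y Y : ℝ, 1 < y → y ≤ Y →
    Real.log Y ≤ (k + 2) * Real.log y → 0 ≤ x → x ≤ Y →
    |roughCount x y - buch k (Real.log Y / Real.log y) * x / Real.log y| ≤
      C * (Y / Real.log Y ^ 2 + y / Real.log y) := by
  obtain ⟨C, hC, h⟩ := exists_roughAsymp k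
  refine ⟨C + 2 ^ (k + 2), by positivity, fun x y Y hy hyY hu hx hxY => ?_⟩
  have hy0 : 0 < y := by linarith
  have hY0 : 0 < Y := by linarith
  have hly : 0 < Real.log y := Real.log_pos hy
  rcases le_total 2 y with h2 | h2
  · refine (h x y Y h2 hyY hu hx hxY).trans ?_
    have : 0 ≤ Y / Real.log Y ^ 2 + y / Real.log y := by positivity
    have : (0 : ℝ) < 2 ^ (k + 2) := by positivity
    gcongr
    linarith
  · have hY : Y ≤ 2 ^ (k + 2) := by
      refine le_trans ?_ (by gcongr : y ^ (k + 2) ≤ 2 ^ (k + 2))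
      rw [← Real.log_le_log_iff hY0 (by positivity), Real.log_pow]
      exact_mod_cast hu
    have h1 : 1 ≤ y / Real.log y := by
      rw [one_le_div hly]; exact (Real.log_le_sub_one_of_pos hy0).trans (by linarith)
    have h3 := roughCount_le hx y
    have h4 := roughCount_nonneg x y
    have h5 : buch k (Real.log Y / Real.log y) * x / Real.log y ≤
        2 ^ (k + 2) * (y / Real.log y) := by
      have := buch_pos k (Real.log Y / Real.log y)
      calc _ ≤ 1 * Y / Real.log y := by gcongr; exact buch_le_one _ _
        _ ≤ 2 ^ (k + 2) * y / Real.log y := by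
          have : (2 : ℝ) ^ (k + 2) * 1 ≤ 2 ^ (k + 2) * y := by gcongr
          exact div_le_div_of_nonneg_right (by linarith) hly.le
        _ = _ := by ring
    have h6 : 0 ≤ buch k (Real.log Y / Real.log y) * x / Real.log y := by
      have := buch_pos k (Real.log Y / Real.log y)
      positivity
    have h7 : (2 : ℝ) ^ (k + 2) * 1 ≤ 2 ^ (k + 2) * (y / Real.log y) := by gcongr
    have h8 : 0 ≤ C * (Y / Real.log Y ^ 2 + y / Real.log y) := by positivity
    have h9 : 0 ≤ 2 ^ (k + 2) * (Y / Real.log Y ^ 2) := by positivity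
    rw [abs_le]
    constructor <;> linarith

/-- The kernel of a term `roughCount (x / p) z` in the variable `log p / log X`, where
`log z = ζ * log X` and `a + b / ζ` is the ratio `log (√X / p) / log z`. -/
def sieveKer (a b : ℝ) (ζ : ℝ → ℝ) (s : ℝ) : ℝ :=
  buch 2 (a + b * (1 / max (ζ s) (3 / 28))) * (1 / max (ζ s) (3 / 28))

/-- The density of the terms `roughCount (x / p) (z p) - roughCount (x / p) p`. -/
def sieveDens (a b : ℝ) (ζ : ℝ → ℝ) (s : ℝ) : ℝ :=
  (sieveKer a b ζ s - sieveKer (-1) (1 / 2) (fun s => s) s) * (1 / max s (3 / 28))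

lemma exists_bddLip_one_div_max {ζ : ℝ → ℝ} (h : ∀ s t, |ζ s - ζ t| ≤ |s - t|) :
    ∃ K, BddLip K fun s => 1 / max (ζ s) (3 / 28) :=
  ⟨_, BddLip.inv (K := 1) (by norm_num : (0 : ℝ) < 3 / 28) (fun s => le_max_right _ _) fun s t => by
    rw [one_mul]
    refine le_trans ?_ (h s t)
    simpa using abs_max_sub_max_le_abs (ζ s) (ζ t) (3 / 28)⟩

lemma exists_bddLip_sieveKer (a b : ℝ) {ζ : ℝ → ℝ} (h : ∀ s t, |ζ s - ζ t| ≤ |s - t|) :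
    ∃ K, BddLip K (sieveKer a b ζ) := by
  obtain ⟨K, hK⟩ := exists_bddLip_one_div_max h
  have h2 : BddLip _ fun s => buch 2 (a + b * (1 / max (ζ s) (3 / 28))) :=
    (bddLip_buch 2).comp (G₂ := fun s => a + b * (1 / max (ζ s) (3 / 28))) (K₂ := |b| * K)
      fun s t => by
        rw [add_sub_add_left_eq_sub, ← mul_sub, abs_mul, mul_assoc]
        exact mul_le_mul_of_nonneg_left (hK.lip s t) (abs_nonneg b)
  exact ⟨_, h2.mul hK⟩

lemma exists_bddLip_sieveDens (a b : ℝ) {ζ : ℝ → ℝ} (h : ∀ s t, |ζ s - ζ t| ≤ |s - t|) :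
    ∃ K, BddLip K (sieveDens a b ζ) := by
  obtain ⟨K₁, hK₁⟩ := exists_bddLip_sieveKer a b h
  obtain ⟨K₂, hK₂⟩ := exists_bddLip_sieveKer (-1) (1 / 2) (ζ := fun s => s) fun s t => le_rfl
  obtain ⟨K₃, hK₃⟩ := exists_bddLip_one_div_max (ζ := fun s => s) fun s t => le_rfl
  exact ⟨_, (hK₁.sub hK₂).mul hK₃⟩

lemma abs_roughCount_sub_sieveKer_le {C : ℝ} (hC : 0 < C)
    (h : ∀ x y Y : ℝ, 1 < y → y ≤ Y → Real.log Y ≤ ((2 : ℕ) + 2) * Real.log y → 0 ≤ x → x ≤ Y →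
      |roughCount x y - buch 2 (Real.log Y / Real.log y) * x / Real.log y| ≤
        C * (Y / Real.log Y ^ 2 + y / Real.log y)) {a b L s x p : ℝ} {ζ : ℝ → ℝ} (hL : 0 < L)
    (hp : 0 < p) (hs : Real.log p = s * L) (hs0 : 3 / 28 ≤ s) (hs1 : s ≤ 1 / 4)
    (hζ0 : 3 / 28 ≤ ζ s) (hζ1 : ζ s ≤ 1 / 4)
    (hab : a * ζ s + b = 1 / 2 - s) (hx : 0 ≤ x) (hxY : x ≤ Real.exp (1 / 2 * L)) :
    |roughCount (x / p) (Real.exp (ζ s * L)) -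
      x / L ^ 2 * (sieveKer a b ζ s * (1 / max s (3 / 28)) * (Real.log p / p))| ≤
      C * (16 * Real.exp (1 / 2 * L) / L ^ 2 * (1 / p) + 28 / 3 * Real.exp (1 / 4 * L) / L) := by
  have hs00 : 0 < s := by linarith
  have hζ00 : 0 < ζ s := by linarith
  have hpe : p = Real.exp (s * L) := by rw [← hs, Real.exp_log hp]
  have hY : Real.exp (1 / 2 * L) / p = Real.exp ((1 / 2 - s) * L) := by
    rw [hpe, ← Real.exp_sub]; ring_nf
  have h1 := h (x / p) (Real.exp (ζ s * L)) (Real.exp (1 / 2 * L) / p)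
    (Real.one_lt_exp_iff.2 (by positivity))
    (by rw [hY]; exact Real.exp_le_exp.2 (by gcongr; linarith))
    (by
      rw [hY, Real.log_exp, Real.log_exp]
      push_cast
      nlinarith)
    (by positivity) (by gcongr)
  rw [hY, Real.log_exp, Real.log_exp, mul_div_mul_right _ _ hL.ne', ← hY] at h1
  have e1 : x / L ^ 2 * (sieveKer a b ζ s * (1 / max s (3 / 28)) * (Real.log p / p)) =
      buch 2 ((1 / 2 - s) / ζ s) * (x / p) / (ζ s * L) := by
    rw [sieveKer, max_eq_left hζ0, max_eq_left hs0, hs]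
    have : a + b * (1 / ζ s) = (1 / 2 - s) / ζ s := by rw [← hab]; field_simp
    rw [this]
    field_simp
  rw [e1]
  refine h1.trans (mul_le_mul_of_nonneg_left (add_le_add ?_ ?_) hC.le)
  · calc Real.exp (1 / 2 * L) / p / ((1 / 2 - s) * L) ^ 2 ≤
        Real.exp (1 / 2 * L) / p / ((1 / 4) * L) ^ 2 := by gcongr; linarith
      _ = _ := by field_simp; norm_num
  · calc Real.exp (ζ s * L) / (ζ s * L) ≤ Real.exp (1 / 4 * L) / (3 / 28 * L) := by gcongr
      _ = _ := by field_simp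

end HarmanKumchev

namespace HarmanKumchev

/-- The contribution of the primes `p` with `α ≤ log p / log X ≤ β`, where `z p = X ^ ζ`. -/
theorem exists_abs_sum_roughCount_sub_le {a b α β : ℝ} {ζ : ℝ → ℝ}
    (hlip : ∀ s t, |ζ s - ζ t| ≤ |s - t|) (hab : ∀ s, a * ζ s + b = 1 / 2 - s)
    (hα : 3 / 28 ≤ α) (hαβ : α ≤ β) (hβ : β ≤ 1 / 4)
    (hζ : ∀ s, α ≤ s → s ≤ β → 3 / 28 ≤ ζ s ∧ ζ s ≤ 1 / 4) :
    ∃ C : ℝ, 0 < C ∧ ∀ (L x : ℝ) (A B : ℕ) (z : ℕ → ℝ), 1 / 2 ≤ L → 0 ≤ x →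
      x ≤ Real.exp (1 / 2 * L) → A ≤ B → Real.exp (α * L) ≤ A →
      |Real.log A - α * L| ≤ 1 → |Real.log B - β * L| ≤ 1 →
      (∀ p ∈ Finset.Ico A B, p.Prime →
        (p : ℝ) ≤ Real.exp (β * L) ∧ z p = Real.exp (ζ (Real.log p / L) * L)) →
      |∑ p ∈ (Finset.Ico A B).filter Nat.Prime, (roughCount (x / p) (z p) - roughCount (x / p) p) -
        x / L * ∫ s in α..β, sieveDens a b ζ s| ≤ C * (Real.exp (1 / 2 * L) / L ^ 2) := by
  obtain ⟨C, hC, h⟩ := exists_abs_roughCount_sub_le 2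
  obtain ⟨K, hK⟩ := exists_bddLip_sieveDens a b hlip
  have hα0 : 0 < α := by linarith
  obtain ⟨C₁, hC₁, h₁⟩ := exists_sum_prime_log_div_sub_le hα0
  obtain ⟨C₂, hC₂, h₂⟩ := exists_sum_prime_one_div_le hα0
  obtain ⟨C₃, hC₃, h₃⟩ := exists_primeCounting_le
  have hK0 := hK.nonneg
  refine ⟨C₁ * K + 2 * C * (16 * C₂ + C₃ * (4 * (28 / 3))), by positivity,
    fun L x A B z hL hx hxY hAB hA hlA hlB hP => ?_⟩
  have hL0 : 0 < L := by linarith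
  have hA1 : (1 : ℝ) < A := lt_of_lt_of_le (Real.one_lt_exp_iff.2 (by positivity)) hA
  have hA2 : 2 ≤ A := by exact_mod_cast hA1
  have hcA : α * L ≤ Real.log A := by
    rw [← Real.log_exp (α * L)]; exact Real.log_le_log (Real.exp_pos _) hA
  set Y := Real.exp (1 / 2 * L) with hY
  set w := Real.exp (1 / 4 * L) with hw
  have hY0 : 0 < Y := Real.exp_pos _
  have hw0 : 0 < w := Real.exp_pos _
  have hw2 : w ^ 2 = Y := by rw [hw, hY, ← Real.exp_nat_mul]; congr 1; push_cast; ring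
  have m2 := h₁ K L α β _ _ _ hK hL hA2 hAB (by linarith) hcA hlA hlB
  have m3 := h₂ L α β _ _ hL hA2 hAB hα0.le (by linarith) hαβ hcA hlA hlB
  set P := (Finset.Ico A B).filter Nat.Prime with hPdef
  set J := ∫ s in α..β, sieveDens a b ζ s with hJ
  have hterm : ∀ p ∈ P, |(roughCount (x / p) (z p) - roughCount (x / p) p) - x / L ^ 2 *
      (sieveDens a b ζ (Real.log p / L) * (Real.log p / p))| ≤
      2 * C * (16 * Y / L ^ 2 * (1 / p) + 28 / 3 * w / L) := fun p hp => by
    rw [hPdef, Finset.mem_filter] at hp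
    obtain ⟨hpB, hpz⟩ := hP p hp.1 hp.2
    have hp0 : (0 : ℝ) < p := by exact_mod_cast hp.2.pos
    have hpA : (A : ℝ) ≤ p := by exact_mod_cast (Finset.mem_Ico.1 hp.1).1
    set s := Real.log p / L with hsdef
    have hs : Real.log p = s * L := by rw [hsdef]; field_simp
    have hs0 : α ≤ s := by
      rw [hsdef, le_div_iff₀ hL0]
      exact hcA.trans (Real.log_le_log (by linarith) hpA)
    have hs1 : s ≤ β := by
      rw [hsdef, div_le_iff₀ hL0, ← Real.log_exp (β * L)]
      exact Real.log_le_log hp0 hpB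
    obtain ⟨hz0, hz1⟩ := hζ s hs0 hs1
    have t1 := abs_roughCount_sub_sieveKer_le hC h hL0 hp0 hs (by linarith) (by linarith) hz0 hz1
      (hab s) hx hxY
    have t2 := abs_roughCount_sub_sieveKer_le (a := -1) (b := 1 / 2) (ζ := fun s => s) hC h hL0 hp0
      hs (by linarith) (by linarith) (by linarith) (by linarith) (by ring) hx hxY
    rw [← hpz] at t1
    rw [← hs, Real.exp_log hp0] at t2
    have e : (roughCount (x / p) (z p) - roughCount (x / p) p) - x / L ^ 2 *
        (sieveDens a b ζ s * (Real.log p / p)) =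
        (roughCount (x / p) (z p) - x / L ^ 2 *
          (sieveKer a b ζ s * (1 / max s (3 / 28)) * (Real.log p / p))) -
        (roughCount (x / p) p - x / L ^ 2 * (sieveKer (-1) (1 / 2) (fun s => s) s *
          (1 / max s (3 / 28)) * (Real.log p / p))) := by
      rw [sieveDens]; ring
    rw [e]
    refine (abs_sub _ _).trans ?_
    linarith
  have m4 := (Finset.abs_sum_le_sum_abs _ _).trans (Finset.sum_le_sum hterm)
  rw [Finset.sum_sub_distrib, ← Finset.mul_sum, ← Finset.mul_sum, Finset.sum_add_distrib,
    ← Finset.mul_sum, Finset.sum_const, nsmul_eq_mul] at m4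
  have m5 : (P.card : ℝ) ≤ C₃ * (4 * w / L) := by
    have hsub : P ⊆ (Finset.Ico 0 (⌊w⌋₊ + 1)).filter Nat.Prime := fun p hp => by
      rw [hPdef, Finset.mem_filter] at hp
      rw [Finset.mem_filter, Finset.mem_Ico]
      have h1 : (p : ℝ) ≤ w := (hP p hp.1 hp.2).1.trans (Real.exp_le_exp.2 (by gcongr))
      exact ⟨⟨Nat.zero_le _, Nat.lt_succ_of_le (Nat.le_floor h1)⟩, hp.2⟩
    have h2 : (P.card : ℝ) ≤ Nat.primeCounting ⌊w⌋₊ := by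
      have h3 := Finset.card_le_card hsub
      rw [Nat.Ico_zero_eq_range, ← Nat.count_eq_card_filter_range] at h3
      exact_mod_cast h3
    refine h2.trans ((h₃ w (Real.one_lt_exp_iff.2 (by positivity))).trans (le_of_eq ?_))
    rw [hw, Real.log_exp]
    field_simp
  have m6 : 2 * C * (16 * Y / L ^ 2 * ∑ p ∈ P, 1 / (p : ℝ) + P.card * (28 / 3 * w / L)) ≤
      2 * C * (16 * C₂ + C₃ * (4 * (28 / 3))) * (Y / L ^ 2) := by
    calc _ ≤ 2 * C * (16 * Y / L ^ 2 * C₂ + C₃ * (4 * w / L) * (28 / 3 * w / L)) := by gcongr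
      _ = 2 * C * (16 * C₂ * Y + C₃ * (4 * (28 / 3)) * w ^ 2) / L ^ 2 := by field_simp
      _ = _ := by rw [hw2]; ring
  have m7 : |x / L ^ 2 * ∑ p ∈ P, sieveDens a b ζ (Real.log p / L) * (Real.log p / p) -
      x / L * J| ≤ C₁ * K * (Y / L ^ 2) := by
    have e : x / L ^ 2 * ∑ p ∈ P, sieveDens a b ζ (Real.log p / L) * (Real.log p / p) -
      x / L * J = x / L ^ 2 * (∑ p ∈ P, sieveDens a b ζ (Real.log p / L) *
        (Real.log p / p) - L * J) := by field_simp
    rw [e, abs_mul, abs_of_nonneg (by positivity)]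
    calc _ ≤ Y / L ^ 2 * (C₁ * K) := by gcongr
      _ = _ := by ring
  have m4' := abs_le.1 (m4.trans m6)
  have m7' := abs_le.1 m7
  rw [abs_le]
  constructor <;> linarith [m4'.1, m4'.2, m7'.1, m7'.2]

lemma integral_sieveDens_le {a b α β : ℝ} {ζ : ℝ → ℝ} (hlip : ∀ s t, |ζ s - ζ t| ≤ |s - t|)
    (hα : 5 / 42 ≤ α) (hαβ : α ≤ β) (hβ : β ≤ 1 / 4) (hζ : ∀ s, α ≤ s → s ≤ β → 3 / 28 ≤ ζ s ∧
      2 ≤ a + b * (1 / ζ s) ∧ a + b * (1 / ζ s) ≤ 10 / 3) :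
    ∫ s in α..β, sieveDens a b ζ s ≤ (β - α) * (68 / 15 * (1 / α)) := by
  obtain ⟨K, hK⟩ := exists_bddLip_sieveDens a b hlip
  have hα0 : 0 < α := by linarith
  have h : ∫ s in α..β, sieveDens a b ζ s ≤ ∫ s in α..β, 68 / 15 * (1 / α) := by
    refine intervalIntegral.integral_mono_on hαβ (hK.continuous.intervalIntegrable _ _)
      (continuous_const.intervalIntegrable _ _) fun s hs => ?_
    obtain ⟨hz0, hz1, hz2⟩ := hζ s hs.1 hs.2
    have hs0 : 0 < s := by linarith [hs.1]
    have hs5 : 5 / 42 ≤ s := hα.trans hs.1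
    have hs4 : s ≤ 1 / 4 := hs.2.trans hβ
    have hz : 0 < ζ s := by linarith
    rw [sieveDens, sieveKer, sieveKer, max_eq_left hz0, max_eq_left (by linarith : 3 / 28 ≤ s)]
    have h1 : buch 2 (a + b * (1 / ζ s)) ≤ 7 / 10 := by
      refine (buch_succ_le 1 hz1).trans ?_
      have : 1 / (10 / 3 : ℝ) ≤ 1 / (a + b * (1 / ζ s)) :=
        one_div_le_one_div_of_le (by linarith) hz2
      linarith
    have h2 : 1 / ζ s ≤ 28 / 3 := by
      rw [div_le_iff₀ hz]; linarith
    have h3 : 1 / 2 ≤ buch 2 (-1 + 1 / 2 * (1 / s)) := by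
      have h4 : 4 ≤ 1 / s := by rw [le_div_iff₀ hs0]; linarith
      have h5 : 1 / s ≤ 42 / 5 := by rw [div_le_iff₀ hs0]; linarith
      exact half_le_buch 2 (by linarith) (by push_cast; linarith)
    have h4 : 4 ≤ 1 / s := by rw [le_div_iff₀ hs0]; linarith
    have h5 : buch 2 (a + b * (1 / ζ s)) * (1 / ζ s) ≤ 7 / 10 * (28 / 3) := by gcongr
    have h6 : 1 / 2 * 4 ≤ buch 2 (-1 + 1 / 2 * (1 / s)) * (1 / s) := by
      have := buch_pos 2 (-1 + 1 / 2 * (1 / s))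
      gcongr
    have h7 : 1 / s ≤ 1 / α := one_div_le_one_div_of_le hα0 hs.1
    calc _ ≤ (7 / 10 * (28 / 3) - 1 / 2 * 4) * (1 / s) := by gcongr
      _ ≤ (7 / 10 * (28 / 3) - 1 / 2 * 4) * (1 / α) := by gcongr
      _ = _ := by norm_num
  rwa [intervalIntegral.integral_const, smul_eq_mul] at h

end HarmanKumchev

namespace HarmanKumchev

lemma rpow_eq_exp_mul_log {X : ℝ} (hX : 0 < X) (c : ℝ) : X ^ c = Real.exp (c * Real.log X) := by
  rw [Real.rpow_def_of_pos hX, mul_comm]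

/-- The asymptotic formula for the summatory function of `rho X`. -/
theorem exists_abs_sum_rho_sub_le : ∃ ℓ : ℝ, 0 < ℓ ∧ ∃ C : ℝ, 0 < C ∧ ∀ X : ℝ, 2 ≤ X →
    ∀ x : ℝ, 0 ≤ x → x ≤ X ^ ((1 : ℝ) / 2) →
    |∑ m ∈ Finset.Ioc 0 ⌊x⌋₊, rho X m - ℓ * (x / Real.log X)| ≤
      C * (X ^ ((1 : ℝ) / 2) / Real.log X ^ 2) := by
  have hlip₁ : ∀ s t : ℝ, |(5 / 28 - s / 2) - (5 / 28 - t / 2)| ≤ |s - t| := fun s t => by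
    have e : (5 / 28 - s / 2) - (5 / 28 - t / 2) = -(1 / 2) * (s - t) := by ring
    rw [e, abs_mul, abs_neg, abs_of_pos (by norm_num : (0 : ℝ) < 1 / 2)]
    linarith [abs_nonneg (s - t)]
  have hlip₂ : ∀ s t : ℝ, |(5 / 14 - s) - (5 / 14 - t)| ≤ |s - t| := fun s t => by
    rw [sub_sub_sub_cancel_left, abs_sub_comm]
  obtain ⟨C₁, hC₁, h₁⟩ := exists_abs_sum_roughCount_sub_le (a := 2) (b := 1 / 7) (α := 5 / 42)
    (β := 1 / 7) hlip₁ (fun s => by ring) (by norm_num) (by norm_num) (by norm_num)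
    fun s h1 h2 => ⟨by linarith, by linarith⟩
  obtain ⟨C₂, hC₂, h₂⟩ := exists_abs_sum_roughCount_sub_le (a := 1) (b := 1 / 7) (α := 3 / 14)
    (β := 1 / 4) hlip₂ (fun s => by ring) (by norm_num) (by norm_num) (by norm_num)
    fun s h1 h2 => ⟨by linarith, by linarith⟩
  obtain ⟨C₀, hC₀, h₀⟩ := exists_abs_roughCount_sub_le 0
  have hJ₁ := integral_sieveDens_le (a := 2) (b := 1 / 7) (α := 5 / 42) (β := 1 / 7) hlip₁
    (by norm_num) (by norm_num) (by norm_num) fun s h1 h2 => by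
      have h3 : (0 : ℝ) < 5 / 28 - s / 2 := by linarith
      have h4 : 0 < 1 / (5 / 28 - s / 2) := by positivity
      have h5 : 1 / (5 / 28 - s / 2) ≤ 28 / 3 := by rw [div_le_iff₀ h3]; linarith
      exact ⟨by linarith, by linarith, by linarith⟩
  have hJ₂ := integral_sieveDens_le (a := 1) (b := 1 / 7) (α := 3 / 14) (β := 1 / 4) hlip₂
    (by norm_num) (by norm_num) (by norm_num) fun s h1 h2 => by
      have h3 : (0 : ℝ) < 5 / 14 - s := by linarith
      have h4 : 7 ≤ 1 / (5 / 14 - s) := by rw [le_div_iff₀ h3]; linarith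
      have h5 : 1 / (5 / 14 - s) ≤ 28 / 3 := by rw [div_le_iff₀ h3]; linarith
      exact ⟨by linarith, by linarith, by linarith⟩
  set J₁ := ∫ s in (5 / 42 : ℝ)..(1 / 7), sieveDens 2 (1 / 7) (fun s => 5 / 28 - s / 2) s with hJ₁d
  set J₂ := ∫ s in (3 / 14 : ℝ)..(1 / 4), sieveDens 1 (1 / 7) (fun s => 5 / 14 - s) s with hJ₂d
  refine ⟨2 - J₁ - J₂, by norm_num at hJ₁ hJ₂; linarith, 20 * C₀ + C₁ + C₂, by positivity,
    fun X hX x hx hxY => ?_⟩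
  have hX0 : 0 < X := by linarith
  set L := Real.log X with hL
  have hL12 : 1 / 2 ≤ L := by
    have := Real.log_le_log (by norm_num) hX
    linarith [Real.log_two_gt_d9]
  have hL0 : 0 < L := by linarith
  have hpow : ∀ c : ℝ, X ^ c = Real.exp (c * L) := rpow_eq_exp_mul_log hX0
  have hceil : ∀ c : ℝ, 0 ≤ c → |Real.log ⌈X ^ c⌉₊ - c * L| ≤ 1 := fun c hc => by
    rw [hL, ← Real.log_rpow hX0]
    exact abs_log_natCeil_sub_le (Real.one_le_rpow (by linarith) hc)
  have hmono : ∀ c d : ℝ, c ≤ d → X ^ c ≤ X ^ d := fun c d hcd =>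
    Real.rpow_le_rpow_of_exponent_le (by linarith) hcd
  rw [sum_rho_eq (by linarith) x]
  -- the main term
  have hlw : Real.log (X ^ ((1 : ℝ) / 4)) = L / 4 := by rw [Real.log_rpow hX0]; ring
  have hlY : Real.log (X ^ ((1 : ℝ) / 2)) = L / 2 := by rw [Real.log_rpow hX0]; ring
  have m0 := h₀ x (X ^ ((1 : ℝ) / 4)) (X ^ ((1 : ℝ) / 2))
    (Real.one_lt_rpow (by linarith) (by norm_num)) (hmono _ _ (by norm_num))
    (by rw [hlw, hlY]; norm_num; linarith) hx hxY
  have hw2 : (X ^ ((1 : ℝ) / 4)) ^ 2 = X ^ ((1 : ℝ) / 2) := by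
    rw [← Real.rpow_natCast, ← Real.rpow_mul hX0.le]; norm_num
  have hLw : L ≤ 4 * X ^ ((1 : ℝ) / 4) := by
    have := Real.log_le_sub_one_of_pos (by positivity : 0 < X ^ ((1 : ℝ) / 4))
    rw [hlw] at this
    linarith
  have m0' : |roughCount x (X ^ ((1 : ℝ) / 4)) - 2 * (x / L)| ≤
      20 * C₀ * (X ^ ((1 : ℝ) / 2) / L ^ 2) := by
    have e : L / 2 / (L / 4) = 2 := by field_simp; norm_num
    rw [hlw, hlY, e, buch_eq_one_div 0 (by norm_num) le_rfl] at m0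
    have e2 : 1 / 2 * x / (L / 4) = 2 * (x / L) := by field_simp; ring
    rw [e2] at m0
    refine m0.trans ?_
    have h3 : X ^ ((1 : ℝ) / 4) / (L / 4) ≤ 16 * (X ^ ((1 : ℝ) / 2) / L ^ 2) := by
      rw [← hw2, ← mul_div_assoc, div_le_div_iff₀ (by positivity) (by positivity)]
      calc X ^ ((1 : ℝ) / 4) * L ^ 2 = X ^ ((1 : ℝ) / 4) * L * L := by ring
        _ ≤ X ^ ((1 : ℝ) / 4) * (4 * X ^ ((1 : ℝ) / 4)) * L := by gcongr
        _ = _ := by ring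
    have e3 : X ^ ((1 : ℝ) / 2) / (L / 2) ^ 2 = 4 * (X ^ ((1 : ℝ) / 2) / L ^ 2) := by
      field_simp; norm_num
    rw [e3]
    calc _ ≤ C₀ * (4 * (X ^ ((1 : ℝ) / 2) / L ^ 2) + 16 * (X ^ ((1 : ℝ) / 2) / L ^ 2)) := by gcongr
      _ = _ := by ring
  -- the primes below `X ^ (1 / 7)`
  have m1 := h₁ L x ⌈X ^ ((5 : ℝ) / 42)⌉₊ ⌈X ^ ((1 : ℝ) / 7)⌉₊ (zfun X) hL12 hx
    (by rwa [← hpow]) (Nat.ceil_mono (hmono _ _ (by norm_num)))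
    (by rw [← hpow]; exact Nat.le_ceil _) (hceil _ (by norm_num)) (hceil _ (by norm_num))
    (fun p hp hpp => by
      have hp0 : (0 : ℝ) < p := by exact_mod_cast hpp.pos
      have hlt : (p : ℝ) < X ^ ((1 : ℝ) / 7) := Nat.lt_ceil.1 (Finset.mem_Ico.1 hp).2
      refine ⟨by rw [← hpow]; exact hlt.le, ?_⟩
      rw [zfun, if_pos hlt, hpow, rpow_eq_exp_mul_log hp0, ← Real.exp_add]
      congr 1
      field_simp
      ring)
  -- the primes above `X ^ (3 / 14)`
  have h3lt : X ^ ((3 : ℝ) / 14) < X ^ ((1 : ℝ) / 4) :=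
    Real.rpow_lt_rpow_of_exponent_lt (by linarith) (by norm_num)
  have h3one : 1 ≤ X ^ ((3 : ℝ) / 14) := Real.one_le_rpow (by linarith) (by norm_num)
  have h3B : ⌊X ^ ((3 : ℝ) / 14)⌋₊ + 1 ≤ ⌈X ^ ((1 : ℝ) / 4)⌉₊ :=
    Nat.lt_ceil.2 ((Nat.floor_le (by linarith)).trans_lt h3lt)
  have h3A : X ^ ((3 : ℝ) / 14) ≤ (⌊X ^ ((3 : ℝ) / 14)⌋₊ + 1 : ℕ) := by
    push_cast; exact (Nat.lt_floor_add_one _).le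
  have m2 := h₂ L x (⌊X ^ ((3 : ℝ) / 14)⌋₊ + 1) ⌈X ^ ((1 : ℝ) / 4)⌉₊ (zfun X) hL12 hx
    (by rwa [← hpow]) h3B (by rw [← hpow]; exact h3A)
    (by
      rw [hL, ← Real.log_rpow hX0]
      have h1 := Real.log_le_log (by linarith) h3A
      rw [abs_of_nonneg (by linarith), ← Real.log_div (by positivity) (by positivity)]
      refine (Real.log_le_sub_one_of_pos (by positivity)).trans ?_
      rw [sub_le_iff_le_add, div_le_iff₀ (by linarith)]
      push_cast
      linarith [Nat.floor_le (by linarith : 0 ≤ X ^ ((3 : ℝ) / 14))])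
    (hceil _ (by norm_num))
    (fun p hp hpp => by
      have hp0 : (0 : ℝ) < p := by exact_mod_cast hpp.pos
      have hlt : (p : ℝ) < X ^ ((1 : ℝ) / 4) := Nat.lt_ceil.1 (Finset.mem_Ico.1 hp).2
      have hgt : X ^ ((3 : ℝ) / 14) < p := Nat.lt_of_floor_lt (Finset.mem_Ico.1 hp).1
      refine ⟨by rw [← hpow]; exact hlt.le, ?_⟩
      have h17 := hmono (1 / 7) (3 / 14) (by norm_num)
      rw [zfun, if_neg (by linarith), if_neg (by linarith), hpow, ← Real.rpow_neg_one,
        rpow_eq_exp_mul_log hp0, ← Real.exp_add]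
      congr 1
      field_simp
      ring)
  rw [← hpow] at m1
  rw [← hpow] at m2
  have h7A : ⌈X ^ ((5 : ℝ) / 42)⌉₊ ≤ ⌈X ^ ((1 : ℝ) / 7)⌉₊ := Nat.ceil_mono (hmono _ _ (by norm_num))
  have h7B : ⌈X ^ ((1 : ℝ) / 7)⌉₊ ≤ ⌊X ^ ((3 : ℝ) / 14)⌋₊ + 1 := by
    rw [Nat.ceil_le]; exact (hmono _ _ (by norm_num)).trans h3A
  have hmid : ∑ p ∈ (Finset.Ico ⌈X ^ ((1 : ℝ) / 7)⌉₊ (⌊X ^ ((3 : ℝ) / 14)⌋₊ + 1)).filter Nat.Prime,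
      (roughCount (x / p) (zfun X p) - roughCount (x / p) p) = 0 := by
    refine Finset.sum_eq_zero fun p hp => ?_
    rw [Finset.mem_filter, Finset.mem_Ico, Nat.ceil_le] at hp
    have hle : (p : ℝ) ≤ X ^ ((3 : ℝ) / 14) :=
      (Nat.le_floor_iff (by linarith)).1 (Nat.lt_succ_iff.1 hp.1.2)
    rw [zfun, if_neg (not_lt.2 hp.1.1), if_pos hle, sub_self]
  have hsplit : ∑ p ∈ (Finset.Ico ⌈X ^ ((5 : ℝ) / 42)⌉₊ ⌈X ^ ((1 : ℝ) / 4)⌉₊).filter Nat.Prime,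
      (roughCount (x / p) (zfun X p) - roughCount (x / p) p) =
      ∑ p ∈ (Finset.Ico ⌈X ^ ((5 : ℝ) / 42)⌉₊ ⌈X ^ ((1 : ℝ) / 7)⌉₊).filter Nat.Prime,
        (roughCount (x / p) (zfun X p) - roughCount (x / p) p) +
      ∑ p ∈ (Finset.Ico (⌊X ^ ((3 : ℝ) / 14)⌋₊ + 1) ⌈X ^ ((1 : ℝ) / 4)⌉₊).filter Nat.Prime,
        (roughCount (x / p) (zfun X p) - roughCount (x / p) p) := by
    rw [Finset.sum_filter] at hmid ⊢
    rw [Finset.sum_filter, Finset.sum_filter,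
      ← Finset.sum_Ico_consecutive _ h7A (h7B.trans h3B), ← Finset.sum_Ico_consecutive _ h7B h3B,
      hmid, zero_add]
  have m0'' := abs_le.1 m0'
  have m1' := abs_le.1 m1
  have m2' := abs_le.1 m2
  have e : (2 - J₁ - J₂) * (x / L) = 2 * (x / L) - x / L * J₁ - x / L * J₂ := by ring
  rw [hsplit, e, abs_le]
  constructor <;> linarith [m0''.1, m0''.2, m1'.1, m1'.2, m2'.1, m2'.2]

end HarmanKumchev


theorem statement9 (δ : ℝ) (hδ0 : 0 < δ) (hδ1 : δ < 1) :
    ∃ ℓ > (0 : ℝ), ∃ C > 0, ∀ X ≥ (2 : ℝ), ∀ a b : ℝ,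
      (δ * X) ^ ((1 : ℝ) / 2) ≤ a → a ≤ b → b ≤ X ^ ((1 : ℝ) / 2) →
      |(∑ m ∈ Finset.Icc ⌈a⌉₊ ⌊b⌋₊, rho X m) - ℓ * (b - a) * (Real.log X)⁻¹| ≤
        C * X ^ ((1 : ℝ) / 2) * ((Real.log X) ^ 2)⁻¹ := by
  obtain ⟨ℓ, hℓ, C, hC, h⟩ := HarmanKumchev.exists_abs_sum_rho_sub_le
  refine ⟨ℓ, hℓ, 2 * C + 2 * ℓ, by positivity, fun X hX a b ha hab hb => ?_⟩
  have hX0 : 0 < X := by linarith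
  have hL : 0 < Real.log X := Real.log_pos (by linarith)
  have ha0 : 0 < a := (Real.rpow_pos_of_pos (mul_pos hδ0 hX0) _).trans_le ha
  obtain ⟨n, hn⟩ : ∃ n, ⌈a⌉₊ = n + 1 := Nat.exists_eq_succ_of_ne_zero (Nat.ceil_pos.2 ha0).ne'
  have hna : (n : ℝ) < a := Nat.lt_ceil.1 (by omega)
  have han : a ≤ n + 1 := by
    have := Nat.le_ceil a
    rw [hn] at this
    exact_mod_cast this
  have hnb : n ≤ ⌊b⌋₊ := Nat.le_floor (by linarith)
  have hIcc : Finset.Icc ⌈a⌉₊ ⌊b⌋₊ = Finset.Ioc n ⌊b⌋₊ := by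
    ext m
    simp only [Finset.mem_Icc, Finset.mem_Ioc]
    omega
  have hsum := Finset.sum_Ioc_consecutive (rho X) (Nat.zero_le n) hnb
  have h₁ := abs_le.1 (h X hX b (by linarith) hb)
  have h₂ := h X hX n n.cast_nonneg (by linarith)
  rw [Nat.floor_natCast] at h₂
  replace h₂ := abs_le.1 h₂
  have hlog : Real.log X ≤ 2 * X ^ ((1 : ℝ) / 2) := by
    rw [← Real.sqrt_eq_rpow]
    exact HarmanKumchev.log_le_two_mul_sqrt hX0
  have hinv : (Real.log X)⁻¹ ≤ 2 * (X ^ ((1 : ℝ) / 2) / Real.log X ^ 2) := by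
    rw [← mul_div_assoc, le_div_iff₀ (by positivity), pow_two, inv_mul_cancel_left₀ hL.ne']
    exact hlog
  have hgap : |ℓ * ((a - n) * (Real.log X)⁻¹)| ≤
      2 * ℓ * (X ^ ((1 : ℝ) / 2) / Real.log X ^ 2) := by
    rw [abs_of_nonneg (mul_nonneg hℓ.le (mul_nonneg (by linarith) (inv_nonneg.2 hL.le)))]
    have := mul_le_mul_of_nonneg_right (by linarith : a - n ≤ 1) (inv_nonneg.2 hL.le)
    have := mul_le_mul_of_nonneg_left (this.trans ((one_mul _).trans_le hinv)) hℓ.le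
    linarith
  replace hgap := abs_le.1 hgap
  have hmain : ℓ * (b - a) * (Real.log X)⁻¹ =
      ℓ * (b / Real.log X) - ℓ * (n / Real.log X) - ℓ * ((a - n) * (Real.log X)⁻¹) := by
    ring
  have herr : (2 * C + 2 * ℓ) * X ^ ((1 : ℝ) / 2) * ((Real.log X) ^ 2)⁻¹ =
      2 * (C * (X ^ ((1 : ℝ) / 2) / Real.log X ^ 2)) +
        2 * ℓ * (X ^ ((1 : ℝ) / 2) / Real.log X ^ 2) := by
    ring
  rw [hIcc, hmain, herr, abs_le]
  constructor <;> linarith [h₁.1, h₁.2, h₂.1, h₂.2, hgap.1, hgap.2]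

end
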